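/- arXiv:math/0210367 — 4 statements merged into one kernel-verified Lean document; each statement's English description precedes it below -/
import Mathlib

section
/- Let n ≥ 2 and let b = (b_1, ..., b_{n-1}) ∈ ℝ^{n-1} be regarded as a 1×(n-1) matrix. The map ℝ → ℝ^n given by x ↦ (x, b_1 x, ..., b_{n-1} x) (parametrizing a line through the origin of ℝ^n) is extremal if and only if b ∉ W_n^+(1, n-1), that is, if and only if for every v > n there are only finitely many q ∈ ℤ^{n-1} for which |b·q + p| ≤ ‖q‖^{-v} for some p ∈ ℤ. -/
open MeasureTheory

/-- `y ∈ W_v(1,n)`: infinitely many `q ∈ ℤ^n` with `|y·q + p| ≤ ‖q‖^{-v}` for some `p ∈ ℤ`. -/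
def InW {n : ℕ} (y : Fin n → ℝ) (v : ℝ) : Prop :=
  {q : Fin n → ℤ | ∃ p : ℤ,
    |(∑ i, y i * (q i : ℝ)) + (p : ℝ)| ≤
      ‖(fun i => (q i : ℝ) : Fin n → ℝ)‖ ^ (-v)}.Infinite

/-- `y` is very well approximable. -/
def IsVWA {n : ℕ} (y : Fin n → ℝ) : Prop :=
  ∃ v : ℝ, (n : ℝ) < v ∧ InW y v

/-- `f` is extremal on `U`: `f x` is not VWA for a.e. `x ∈ U`. -/
def IsExtremal {α : Type*} [MeasureSpace α] {n : ℕ} (U : Set α) (f : α → Fin n → ℝ) : Prop :=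
  volume {x ∈ U | IsVWA (f x)} = 0

/-- The sup norm of an integer vector agrees with that of its image in `ℝ^n`. -/
lemma norm_intCast_pi {n : ℕ} (q : Fin n → ℤ) :
    ‖(fun i => (q i : ℝ) : Fin n → ℝ)‖ = ‖q‖ := by
  simp only [Pi.norm_def]
  congr 2

lemma finite_setOf_norm_le_int_pi (n : ℕ) (K : ℝ) : {q : Fin n → ℤ | ‖q‖ ≤ K}.Finite := by
  have h := (isCompact_closedBall (0 : Fin n → ℤ) K).finite_of_discrete
  refine h.subset fun q hq => ?_
  simpa using hq

lemma one_le_norm_int_pi {n : ℕ} {q : Fin n → ℤ} (hq : q ≠ 0) : 1 ≤ ‖q‖ := by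
  obtain ⟨i, hi⟩ := Function.ne_iff.mp hq
  refine le_trans ?_ (norm_le_pi_norm q i)
  rw [Int.norm_eq_abs]
  exact_mod_cast Int.one_le_abs hi

/-- Decay rates `‖q‖^{-v}` of integer vectors are antitone in `v > 0`. -/
lemma norm_rpow_neg_le_int_pi {n : ℕ} (q : Fin n → ℤ) {u v : ℝ} (hu : 0 < u) (huv : u ≤ v) :
    ‖q‖ ^ (-v) ≤ ‖q‖ ^ (-u) := by
  rcases eq_or_ne q 0 with rfl | hq
  · rw [norm_zero, Real.zero_rpow (by linarith), Real.zero_rpow (by linarith)]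
  · exact Real.rpow_le_rpow_of_exponent_le (one_le_norm_int_pi hq) (by linarith)

lemma norm_rpow_neg_le_one_int_pi {n : ℕ} (q : Fin n → ℤ) {v : ℝ} (hv : 0 < v) :
    ‖q‖ ^ (-v) ≤ 1 := by
  rcases eq_or_ne q 0 with rfl | hq
  · rw [norm_zero, Real.zero_rpow (by linarith)]
    exact zero_le_one
  · exact Real.rpow_le_one_of_one_le_of_nonpos (one_le_norm_int_pi hq) (by linarith)

lemma summable_norm_rpow_int_pi (n : ℕ) {v : ℝ} (hv : (n : ℝ) < v) :
    Summable fun q : Fin n → ℤ => ‖q‖ ^ (-v) := by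
  let L := Submodule.span ℤ (Set.range (Pi.basisFun ℝ (Fin n)))
  have hrank : Module.finrank ℤ L = n := by
    rw [ZLattice.rank ℝ L]
    simp
  have hs : Summable fun z : L => ‖z‖ ^ (-v) :=
    ZLattice.summable_norm_rpow L (-v) (by rw [hrank]; linarith)
  have hmem (q : Fin n → ℤ) : (fun i => (q i : ℝ)) ∈ L := by
    rw [Module.Basis.mem_span_iff_repr_mem]
    intro i
    exact ⟨q i, by simp⟩
  let g : (Fin n → ℤ) → L := fun q => ⟨_, hmem q⟩
  have hg : Function.Injective g := by
    intro q r h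
    have h' := congrArg Subtype.val h
    ext i
    have h_i : (q i : ℝ) = r i := congrFun h' i
    exact_mod_cast h_i
  refine (hs.comp_injective hg).congr fun q => ?_
  simp only [Function.comp_apply, g, Submodule.coe_norm, norm_intCast_pi]

lemma exists_forall_mul_rpow_neg_le (C : ℝ) {u v : ℝ} (huv : u < v) :
    ∃ M : ℝ, 1 ≤ M ∧ ∀ t, M ≤ t → C * t ^ (-v) ≤ t ^ (-u) := by
  have h := (tendsto_rpow_atTop (sub_pos.mpr huv)).eventually_ge_atTop C
  obtain ⟨M, hM⟩ := Filter.eventually_atTop.mp h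
  refine ⟨max M 1, le_max_right _ _, fun t ht => ?_⟩
  have ht0 : 0 < t := lt_of_lt_of_le one_pos ((le_max_right _ _).trans ht)
  calc C * t ^ (-v) ≤ t ^ (v - u) * t ^ (-v) := by
        gcongr
        exact hM t ((le_max_left _ _).trans ht)
    _ = t ^ (-u) := by
        rw [← Real.rpow_add ht0]
        congr 1
        ring

lemma abs_sum_mul_intCast_le {m : ℕ} (b : Fin m → ℝ) (q : Fin m → ℤ) :
    |∑ i, b i * (q i : ℝ)| ≤ (∑ i, |b i|) * ‖q‖ := by
  rw [Finset.sum_mul]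
  refine (Finset.abs_sum_le_sum_abs _ _).trans (Finset.sum_le_sum fun i _ => ?_)
  rw [abs_mul]
  gcongr
  simpa [Int.norm_eq_abs] using norm_le_pi_norm q i

lemma norm_le_of_tail {m : ℕ} {q : Fin (m + 1) → ℤ} {K : ℝ}
    (h0 : |(q 0 : ℝ)| ≤ K) (ht : ‖Fin.tail q‖ ≤ K) : ‖q‖ ≤ K := by
  have hK : 0 ≤ K := (norm_nonneg _).trans ht
  rw [pi_norm_le_iff_of_nonneg hK]
  intro i
  refine Fin.cases ?_ (fun j => ?_) i
  · rwa [Int.norm_eq_abs]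
  · exact (norm_le_pi_norm (Fin.tail q) j).trans ht

lemma norm_tail_le {m : ℕ} (q : Fin (m + 1) → ℤ) : ‖Fin.tail q‖ ≤ ‖q‖ := by
  rw [pi_norm_le_iff_of_nonneg (norm_nonneg _)]
  exact fun j => norm_le_pi_norm q j.succ

lemma sum_cons_mul {m : ℕ} (b : Fin m → ℝ) (x : ℝ) (q : Fin (m + 1) → ℤ) :
    ∑ i, (Fin.cons x (fun i => b i * x) : Fin (m + 1) → ℝ) i * (q i : ℝ) =
      x * ((q 0 : ℝ) + ∑ i, b i * (Fin.tail q i : ℝ)) := by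
  rw [Fin.sum_univ_succ, mul_add, Finset.mul_sum]
  simp only [Fin.cons_zero, Fin.cons_succ, Fin.tail]
  congr 1
  exact Finset.sum_congr rfl fun i _ => by ring

/-- Every point of the line is very well approximable if the slope vector is too well
approximable. -/
lemma isVWA_cons_of_infinite {m : ℕ} (b : Fin m → ℝ) {v : ℝ} (hv : (m : ℝ) + 1 < v)
    (h : InW b v) (x : ℝ) : IsVWA (Fin.cons x (fun i => b i * x) : Fin (m + 1) → ℝ) := by
  obtain ⟨u, hmu, huv⟩ := exists_between hv
  have hm0 : (0 : ℝ) ≤ m := Nat.cast_nonneg m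
  refine ⟨u, by push_cast; exact hmu, fun hfin => h ?_⟩
  set D : ℝ := ∑ i, |b i| + 1 with hD
  have hD1 : 1 ≤ D := by
    have : 0 ≤ ∑ i, |b i| := Finset.sum_nonneg fun i _ => abs_nonneg _
    linarith
  obtain ⟨M, hM1, hM⟩ := exists_forall_mul_rpow_neg_le (|x| * D ^ u) huv
  refine ((finite_setOf_norm_le_int_pi m M).union (hfin.image Fin.tail)).subset ?_
  rintro q ⟨p, hp⟩
  rw [norm_intCast_pi] at hp
  rcases le_or_gt ‖q‖ M with hq | hq
  · exact Or.inl hq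
  refine Or.inr ⟨Fin.cons p q, ⟨0, ?_⟩, Fin.tail_cons _ _⟩
  have hq0 : 1 ≤ ‖q‖ := hM1.trans hq.le
  have hp1 : |(∑ i, b i * (q i : ℝ)) + (p : ℝ)| ≤ 1 :=
    hp.trans (norm_rpow_neg_le_one_int_pi q (by linarith))
  have hpD : |(p : ℝ)| ≤ D * ‖q‖ := by
    have h1 := abs_sum_mul_intCast_le b q
    have h2 : |(p : ℝ)| ≤ |(∑ i, b i * (q i : ℝ)) + (p : ℝ)| + |∑ i, b i * (q i : ℝ)| := by
      simpa using abs_sub ((∑ i, b i * (q i : ℝ)) + (p : ℝ)) (∑ i, b i * (q i : ℝ))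
    rw [hD, add_mul]
    linarith
  have hnorm : ‖(Fin.cons p q : Fin (m + 1) → ℤ)‖ ≤ D * ‖q‖ := by
    refine norm_le_of_tail (by simpa using hpD) ?_
    rw [Fin.tail_cons]
    exact le_mul_of_one_le_left (norm_nonneg _) hD1
  have hpos : 0 < ‖(Fin.cons p q : Fin (m + 1) → ℤ)‖ := by
    have := norm_tail_le (Fin.cons p q : Fin (m + 1) → ℤ)
    rw [Fin.tail_cons] at this
    linarith
  rw [norm_intCast_pi, sum_cons_mul, Int.cast_zero, add_zero, abs_mul, Fin.tail_cons,
    Fin.cons_zero, add_comm (p : ℝ)]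
  calc |x| * |(∑ i, b i * (q i : ℝ)) + (p : ℝ)| ≤ |x| * ‖q‖ ^ (-v) := by gcongr
    _ = D ^ (-u) * ((|x| * D ^ u) * ‖q‖ ^ (-v)) := by
        have hDu : D ^ (-u) * D ^ u = 1 := by
          rw [← Real.rpow_add (by linarith), neg_add_cancel, Real.rpow_zero]
        linear_combination (-(|x| * ‖q‖ ^ (-v))) * hDu
    _ ≤ D ^ (-u) * ‖q‖ ^ (-u) := by
        gcongr
        exact hM _ hq.le
    _ = (D * ‖q‖) ^ (-u) := (Real.mul_rpow (by linarith) (norm_nonneg _)).symm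
    _ ≤ _ := Real.rpow_le_rpow_of_nonpos hpos hnorm (by linarith)

/-- If the slope vector is not too well approximable, then `q 0 + b · tail q` is rarely small. -/
lemma finite_setOf_abs_linear_form_le {m : ℕ} (b : Fin m → ℝ)
    {u v : ℝ} (hu : 0 < u) (huv : u < v) (h : ¬ InW b u) (C : ℝ) :
    {q : Fin (m + 1) → ℤ |
      |(q 0 : ℝ) + ∑ i, b i * (Fin.tail q i : ℝ)| ≤ C * ‖q‖ ^ (-v)}.Finite := by
  wlog hC : 0 ≤ C generalizing C
  · refine (this 0 le_rfl).subset fun q hq => ?_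
    rw [Set.mem_ofPred_eq] at hq ⊢
    refine hq.trans (mul_le_mul_of_nonneg_right (not_le.mp hC).le (by positivity))
  obtain ⟨M, hM1, hM⟩ := exists_forall_mul_rpow_neg_le C huv
  have hF := ((finite_setOf_norm_le_int_pi m M).union (Set.not_infinite.mp h)).isBounded
  obtain ⟨B, hB⟩ := hF.exists_norm_le
  refine (finite_setOf_norm_le_int_pi (m + 1) (max B ((∑ i, |b i|) * B + C))).subset ?_
  intro q hq
  rw [Set.mem_ofPred_eq] at hq
  have htail : ‖Fin.tail q‖ ≤ B := by
    refine hB _ ?_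
    rcases le_or_gt ‖Fin.tail q‖ M with hqM | hqM
    · exact Or.inl hqM
    · refine Or.inr ⟨q 0, ?_⟩
      rw [norm_intCast_pi, add_comm]
      refine hq.trans (le_trans ?_ (hM _ hqM.le))
      gcongr C * ?_
      exact Real.rpow_le_rpow_of_nonpos (by linarith) (norm_tail_le q) (by linarith)
  refine norm_le_of_tail (le_trans ?_ (le_max_right _ _)) (htail.trans (le_max_left _ _))
  have h1 := abs_sum_mul_intCast_le b (Fin.tail q)
  have h2 : (∑ i, |b i|) * ‖Fin.tail q‖ ≤ (∑ i, |b i|) * B := by gcongr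
  have h3 : C * ‖q‖ ^ (-v) ≤ C * 1 := by
    gcongr
    exact norm_rpow_neg_le_one_int_pi q (hu.trans huv)
  have h4 : |(q 0 : ℝ)| ≤ |(q 0 : ℝ) + ∑ i, b i * (Fin.tail q i : ℝ)| +
      |∑ i, b i * (Fin.tail q i : ℝ)| := by
    simpa using abs_sub ((q 0 : ℝ) + ∑ i, b i * (Fin.tail q i : ℝ))
      (∑ i, b i * (Fin.tail q i : ℝ))
  linarith

/-- The points of `[-R, R]` whose multiple by `l` is `ε`-close to a nonzero integer form a set of
measure `O(R ε)`, uniformly in `l`. -/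
lemma volume_near_nonzero_int_le (R l ε : ℝ) (hR : 0 ≤ R) (hε : 0 ≤ ε) :
    volume {x : ℝ | |x| ≤ R ∧ ∃ p : ℤ, p ≠ 0 ∧ |x * l + p| ≤ ε} ≤ ENNReal.ofReal (12 * R * ε) := by
  rcases le_or_gt (1 / 2) ε with hε2 | hε2
  · calc volume {x : ℝ | |x| ≤ R ∧ ∃ p : ℤ, p ≠ 0 ∧ |x * l + p| ≤ ε}
        ≤ volume (Set.Icc (-R) R) := measure_mono fun x hx => abs_le.mp hx.1
      _ ≤ _ := by
        rw [Real.volume_Icc]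
        apply ENNReal.ofReal_le_ofReal
        nlinarith
  have key : ∀ x : ℝ, |x| ≤ R → ∀ p : ℤ, p ≠ 0 → |x * l + p| ≤ ε →
      1 / 2 ≤ R * |l| ∧ |(p : ℝ)| ≤ 2 * R * |l| := by
    intro x hx p hp h
    have h1 : (1 : ℝ) ≤ |(p : ℝ)| := by exact_mod_cast Int.one_le_abs hp
    have h2 : |(p : ℝ)| ≤ |x * l + p| + |x * l| := by
      simpa using abs_sub (x * l + p) (x * l)
    have h3 : |x * l| ≤ R * |l| := by rw [abs_mul]; gcongr
    constructor <;> linarith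
  by_cases hl : 1 / 2 ≤ R * |l|
  swap
  · have : {x : ℝ | |x| ≤ R ∧ ∃ p : ℤ, p ≠ 0 ∧ |x * l + p| ≤ ε} = ∅ := by
      ext x
      simp only [Set.mem_ofPred_eq, Set.mem_empty_iff_false, iff_false]
      rintro ⟨hx, p, hp, h⟩
      exact hl (key x hx p hp h).1
    rw [this]
    simp
  have hl0 : l ≠ 0 := by
    rintro rfl
    norm_num at hl
  have hl' : 0 < |l| := abs_pos.mpr hl0
  set N : ℕ := ⌊2 * R * |l|⌋₊ with hN
  have hNle : (N : ℝ) ≤ 2 * R * |l| := Nat.floor_le (by positivity)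
  calc volume {x : ℝ | |x| ≤ R ∧ ∃ p : ℤ, p ≠ 0 ∧ |x * l + p| ≤ ε}
      ≤ volume (⋃ p ∈ Finset.Icc (-(N : ℤ)) N, Metric.closedBall (-(p : ℝ) / l) (ε / |l|)) := by
        refine measure_mono ?_
        rintro x ⟨hx, p, hp, h⟩
        have hpN : |p| ≤ (N : ℤ) := by
          have h1 : p.natAbs ≤ N := Nat.le_floor (by
            rw [Nat.cast_natAbs, Int.cast_abs]
            exact (key x hx p hp h).2)
          rw [Int.abs_eq_natAbs]
          exact_mod_cast h1
        refine Set.mem_biUnion (Finset.mem_coe.mpr (Finset.mem_Icc.mpr (abs_le.mp hpN))) ?_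
        rw [Metric.mem_closedBall, Real.dist_eq, le_div_iff₀ hl', ← abs_mul]
        have : (x - -(p : ℝ) / l) * l = x * l + p := by
          field_simp
          ring
        rwa [this]
    _ ≤ ∑ p ∈ Finset.Icc (-(N : ℤ)) N, volume (Metric.closedBall (-(p : ℝ) / l) (ε / |l|)) :=
        measure_biUnion_finset_le _ _
    _ = ENNReal.ofReal ((2 * N + 1) * (2 * (ε / |l|))) := by
        simp only [Real.volume_closedBall, Finset.sum_const, Int.card_Icc, nsmul_eq_mul]
        have hcard : ((N : ℤ) + 1 - -(N : ℤ)).toNat = 2 * N + 1 := by omega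
        rw [hcard, ← ENNReal.ofReal_natCast, ← ENNReal.ofReal_mul (by positivity)]
        push_cast
        rfl
    _ ≤ ENNReal.ofReal (12 * R * ε) := by
        apply ENNReal.ofReal_le_ofReal
        calc (2 * N + 1) * (2 * (ε / |l|)) ≤ (6 * (R * |l|)) * (2 * (ε / |l|)) := by
              gcongr
              linarith
          _ = 12 * R * ε := by
              field_simp
              ring

/-- Borel–Cantelli for approximations of a one-parameter family of linear forms by nonzero
integers. -/
lemma ae_finite_near_nonzero_int {n : ℕ} (l : (Fin n → ℤ) → ℝ) {v : ℝ} (hv : (n : ℝ) < v) :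
    ∀ᵐ x : ℝ, {q : Fin n → ℤ | ∃ p : ℤ, p ≠ 0 ∧ |x * l q + p| ≤ ‖q‖ ^ (-v)}.Finite := by
  have hR (R : ℕ) : ∀ᵐ x : ℝ, {q : Fin n → ℤ |
      x ∈ {x : ℝ | |x| ≤ R ∧ ∃ p : ℤ, p ≠ 0 ∧ |x * l q + p| ≤ ‖q‖ ^ (-v)}}.Finite := by
    refine ae_finite_setOfPred_mem (ne_top_of_le_ne_top ?_ (ENNReal.tsum_le_tsum fun q =>
      volume_near_nonzero_int_le R (l q) (‖q‖ ^ (-v)) R.cast_nonneg (by positivity)))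
    exact ((summable_norm_rpow_int_pi n hv).mul_left (12 * (R : ℝ))).tsum_ofReal_ne_top
  filter_upwards [ae_all_iff.mpr hR] with x hx
  obtain ⟨R, hxR⟩ := exists_nat_ge |x|
  exact (hx R).subset fun q hq => ⟨hxR, hq⟩

/-- **Theorem 1.3, case (1.6)** (lines through the origin; here `n = m + 1 ≥ 2`).
The line of `ℝ^n` parametrized by `x ↦ (x, b_1 x, …, b_{n-1} x)` is extremal if and
only if `b ∉ W_n^+(1,n-1)`, i.e. iff for every `v > n` there are only finitely many
`q ∈ ℤ^{n-1}` with `|b·q + p| ≤ ‖q‖^{-v}` for some `p ∈ ℤ`. -/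
theorem line_through_origin_extremal_iff (m : ℕ) (hm : 1 ≤ m) (b : Fin m → ℝ) :
    IsExtremal (Set.univ : Set ℝ)
      (fun x => Fin.cons x (fun i => b i * x)) ↔
    ∀ v : ℝ, ((m : ℝ) + 1) < v →
      {q : Fin m → ℤ | ∃ p : ℤ,
        |(∑ i, b i * (q i : ℝ)) + (p : ℝ)| ≤
          ‖(fun i => (q i : ℝ) : Fin m → ℝ)‖ ^ (-v)}.Finite := by
  constructor
  · intro h v hv
    by_contra hinf
    have huniv : {x ∈ (Set.univ : Set ℝ) |
        IsVWA (Fin.cons x (fun i => b i * x) : Fin (m + 1) → ℝ)} = Set.univ :=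
      Set.eq_univ_of_forall fun x => ⟨trivial, isVWA_cons_of_infinite b hv hinf x⟩
    rw [IsExtremal, huniv, Real.volume_univ] at h
    exact ENNReal.top_ne_zero h
  · intro h
    have hae : ∀ᵐ x : ℝ, ∀ k : ℕ, {q : Fin (m + 1) → ℤ | ∃ p : ℤ, p ≠ 0 ∧
        |x * ((q 0 : ℝ) + ∑ i, b i * (Fin.tail q i : ℝ)) + p| ≤
          ‖q‖ ^ (-((m : ℝ) + 1 + 1 / ((k : ℝ) + 1)))}.Finite := by
      refine ae_all_iff.mpr fun k => ae_finite_near_nonzero_int _ ?_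
      push_cast
      exact lt_add_of_pos_right _ (by positivity)
    have hne : ∀ᵐ x : ℝ, x ≠ 0 := Measure.ae_ne volume 0
    have hnot : ∀ᵐ x : ℝ, ¬ (x ∈ (Set.univ : Set ℝ) ∧
        IsVWA (Fin.cons x (fun i => b i * x) : Fin (m + 1) → ℝ)) := by
      filter_upwards [hae, hne] with x hx hx0
      rintro ⟨-, v, hv, hinf⟩
      push_cast at hv
      obtain ⟨k, hk⟩ := exists_nat_one_div_lt (sub_pos.mpr hv)
      set w : ℝ := (m : ℝ) + 1 + 1 / ((k : ℝ) + 1) with hw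
      have hmw : (m : ℝ) + 1 < w := lt_add_of_pos_right _ (by positivity)
      obtain ⟨u, hmu, huw⟩ := exists_between hmw
      have hu : 0 < u := lt_trans (by positivity) hmu
      have hzero := finite_setOf_abs_linear_form_le b hu huw
        (Set.not_infinite.mpr (h u hmu)) |x|⁻¹
      refine hinf (((hx k).union hzero).subset ?_)
      rintro q ⟨p, hp⟩
      rw [norm_intCast_pi, sum_cons_mul] at hp
      replace hp := hp.trans (norm_rpow_neg_le_int_pi q (hu.trans huw)
        (by linarith : w ≤ v))
      rcases eq_or_ne p 0 with rfl | hp0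
      · right
        rw [Int.cast_zero, add_zero, abs_mul] at hp
        exact (le_inv_mul_iff₀ (abs_pos.mpr hx0)).mpr hp
      · exact Or.inl ⟨p, hp0, hp⟩
    have hnull := ae_iff.mp hnot
    simp only [not_not] at hnull
    exact hnull
end

section
/- Let L be an affine subspace of ℝ^n. (a) If L is strongly extremal and f : U → L, U ⊂ ℝ^d open, is a smooth map which is nondegenerate in L, then f (viewed as a map into ℝ^n) is strongly extremal. (b) If L is not strongly extremal, then every point of L is VWMA. -/
open MeasureTheory

/-- `y` is very well multiplicatively approximable: for some `v > n` there are infinitely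
many `q ∈ ℤ^n` with `|y·q + p| ≤ Π_+(q)^{-v/n}` for some `p ∈ ℤ`, where
`Π_+(q) = ∏ᵢ max(|qᵢ|,1)`. -/
def IsVWMA {n : ℕ} (y : Fin n → ℝ) : Prop :=
  ∃ v : ℝ, (n : ℝ) < v ∧
    {q : Fin n → ℤ | ∃ p : ℤ,
      |(∑ i, y i * (q i : ℝ)) + (p : ℝ)| ≤
        (∏ i, max |(q i : ℝ)| 1) ^ (-(v / n))}.Infinite

/-- `f` is strongly extremal on `U`: `f x` is not VWMA for a.e. `x ∈ U`. -/
def IsStronglyExtremal {α : Type*} [MeasureSpace α] {n : ℕ} (U : Set α)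
    (f : α → Fin n → ℝ) : Prop :=
  volume {x ∈ U | IsVWMA (f x)} = 0

/-- An affine subspace of `ℝ^n` is strongly extremal if any (equivalently, one) injective
affine parametrization of it is a strongly extremal map. -/
def AffineStronglyExtremal {n : ℕ} (L : AffineSubspace ℝ (Fin n → ℝ)) : Prop :=
  ∀ (s : ℕ) (h : (Fin s → ℝ) →ᵃ[ℝ] (Fin n → ℝ)), Function.Injective h →
    Set.range h = (L : Set (Fin n → ℝ)) → IsStronglyExtremal Set.univ (fun x => h x)

/-- `f : U → L` is nondegenerate in `L` at `x`: for some `l`, the partial derivatives of `f`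
at `x` of order up to `l` span the linear part of `L`. -/
def NondegAt {d n : ℕ} (U : Set (Fin d → ℝ)) (L : AffineSubspace ℝ (Fin n → ℝ))
    (f : (Fin d → ℝ) → Fin n → ℝ) (x : Fin d → ℝ) : Prop :=
  ∃ l : ℕ, Submodule.span ℝ
      {y : Fin n → ℝ | ∃ m : ℕ, 1 ≤ m ∧ m ≤ l ∧
        ∃ u : Fin m → (Fin d → ℝ), y = iteratedFDerivWithin ℝ m f U x u} = L.direction

/-- The largest absolute value of a maximal minor of the matrix with rows `M i`. -/
noncomputable def minorNorm {j : ℕ} {κ : Type*} [Fintype κ] (M : Fin j → κ → ℝ) : ℝ :=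
  ‖fun σ : Fin j → κ => (Matrix.of fun i k => M i (σ k)).det‖

theorem det_cons {j : ℕ} {κ : Type*} (v : κ → ℝ) (M : Fin j → κ → ℝ) (σ : Fin (j + 1) → κ) :
    (Matrix.of fun i k => (Fin.cons v M : Fin (j + 1) → κ → ℝ) i (σ k)).det =
      ∑ k : Fin (j + 1), (-1) ^ (k : ℕ) * v (σ k) *
        (Matrix.of fun i k' => M i (σ (k.succAbove k'))).det := by
  rw [Matrix.det_succ_row_zero]
  rfl

section Minors

variable {j : ℕ} {κ : Type*} [Fintype κ]

theorem abs_det_le_minorNorm (M : Fin j → κ → ℝ) (σ : Fin j → κ) :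
    |(Matrix.of fun i k => M i (σ k)).det| ≤ minorNorm M :=
  norm_le_pi_norm (fun σ : Fin j → κ => (Matrix.of fun i k => M i (σ k)).det) σ

theorem minorNorm_nonneg (M : Fin j → κ → ℝ) : 0 ≤ minorNorm M := norm_nonneg _

theorem minorNorm_le {M : Fin j → κ → ℝ} {c : ℝ} (hc : 0 ≤ c)
    (h : ∀ σ : Fin j → κ, |(Matrix.of fun i k => M i (σ k)).det| ≤ c) : minorNorm M ≤ c :=
  (pi_norm_le_iff_of_nonneg hc).2 h

theorem exists_abs_det_eq_minorNorm [Nonempty κ] (M : Fin j → κ → ℝ) :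
    ∃ σ : Fin j → κ, |(Matrix.of fun i k => M i (σ k)).det| = minorNorm M := by
  obtain ⟨σ, hσ⟩ := Finite.exists_max
    fun σ : Fin j → κ => |(Matrix.of fun i k => M i (σ k)).det|
  exact ⟨σ, le_antisymm (abs_det_le_minorNorm M σ) (minorNorm_le (abs_nonneg _) hσ)⟩

/-- Base change multiplies all the maximal minors by the same determinant. -/
theorem minorNorm_mul (A : Matrix (Fin j) (Fin j) ℝ) (M : Fin j → κ → ℝ) :
    minorNorm (fun i l => ∑ i', A i i' * M i' l) = |A.det| * minorNorm M := by
  have h : (fun σ : Fin j → κ => (Matrix.of fun i k => ∑ i', A i i' * M i' (σ k)).det) =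
      A.det • fun σ : Fin j → κ => (Matrix.of fun i k => M i (σ k)).det := by
    funext σ
    rw [Pi.smul_apply, smul_eq_mul, ← Matrix.det_mul]
    congr 1
  rw [minorNorm, h, norm_smul]
  rfl

theorem det_sum_mul (M : Fin j → κ → ℝ) (N : κ → Fin j → ℝ) :
    (Matrix.of fun i k => ∑ l, M i l * N l k).det =
      ∑ σ : Fin j → κ, (∏ k, N (σ k) k) * (Matrix.of fun i k => M i (σ k)).det := by
  classical
  rw [← Matrix.det_transpose]
  have h : (Matrix.of fun i k => ∑ l, M i l * N l k).transpose =
      fun k => ∑ l, N l k • fun i => M i l := by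
    ext k i
    simp [mul_comm]
  rw [h]
  refine ((Matrix.detRowAlternating (n := Fin j) (R := ℝ)).toMultilinearMap.map_sum
    (fun (k : Fin j) (l : κ) => N l k • fun i => M i l)).trans ?_
  refine Finset.sum_congr rfl fun σ _ => ?_
  refine (((Matrix.detRowAlternating (n := Fin j) (R := ℝ)).toMultilinearMap.map_smul_univ
    (fun k => N (σ k) k) (fun k i => M i (σ k)))).trans ?_
  rw [smul_eq_mul, ← Matrix.det_transpose (Matrix.of fun i k => M i (σ k))]
  rfl

theorem linearIndependent_iff_minorNorm_pos (M : Fin j → κ → ℝ) :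
    LinearIndependent ℝ M ↔ 0 < minorNorm M := by
  classical
  constructor
  · intro h
    refine (minorNorm_nonneg M).lt_of_ne fun h0 => ?_
    have hz (σ : Fin j → κ) : (Matrix.of fun i k => M i (σ k)).det = 0 :=
      abs_nonpos_iff.1 ((abs_det_le_minorNorm M σ).trans h0.ge)
    obtain ⟨g, hg⟩ := LinearMap.exists_leftInverse_of_injective
      (Fintype.linearCombination ℝ M) (LinearMap.ker_eq_bot.2
        ((linearIndependent_iff_injective_fintypeLinearCombination).1 h))
    have key := det_sum_mul M (fun l k => g (Pi.single l 1) k)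
    simp only [hz, mul_zero, Finset.sum_const_zero] at key
    have h1 : (Matrix.of fun i k => ∑ l, M i l * g (Pi.single l 1) k) = 1 := by
      ext i k
      have h2 : g (M i) = Pi.single i 1 := by
        have := LinearMap.congr_fun hg (Pi.single i 1)
        simpa [Fintype.linearCombination_apply, Pi.single_apply, ite_smul] using this
      have h3 : M i = ∑ l, M i l • (Pi.single l 1 : κ → ℝ) := by
        simpa using (pi_eq_sum_univ' (M i))
      have h4 : g (M i) k = ∑ l, M i l * g (Pi.single l 1) k := by
        conv_lhs => rw [h3]
        simp [map_sum]
      rw [Matrix.of_apply, ← h4, h2, Matrix.one_apply, Pi.single_apply]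
      simp [eq_comm]
    rw [h1, Matrix.det_one] at key
    exact one_ne_zero key
  · intro h
    rw [Fintype.linearIndependent_iff]
    by_contra! hc
    obtain ⟨g, hg, i, hi⟩ := hc
    refine h.not_ge (minorNorm_le le_rfl fun σ => ?_)
    rw [abs_nonpos_iff]
    refine Matrix.exists_vecMul_eq_zero_iff.1 ⟨g, fun h => hi (congrFun h i), ?_⟩
    ext k
    simpa [Matrix.vecMul, dotProduct] using congrFun hg (σ k)

theorem minorNorm_linearMap_le (H : (κ → ℝ) →ₗ[ℝ] (κ → ℝ)) (j : ℕ) :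
    ∃ C : ℝ, 0 < C ∧ ∀ M : Fin j → κ → ℝ, minorNorm (fun i => H (M i)) ≤ C * minorNorm M := by
  classical
  let D : (Fin j → κ) → ℝ := fun τ =>
    ∑ σ : Fin j → κ, |∏ k, H (Pi.single (σ k) 1) (τ k)|
  have hD (τ) : 0 ≤ D τ := Finset.sum_nonneg fun _ _ => abs_nonneg _
  refine ⟨∑ τ, D τ + 1, by
    positivity [Finset.sum_nonneg fun τ (_ : τ ∈ Finset.univ) => hD τ], fun M => ?_⟩
  have hs := Finset.sum_nonneg fun τ (_ : τ ∈ Finset.univ) => hD τ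
  refine minorNorm_le (mul_nonneg (by linarith) (minorNorm_nonneg _)) fun τ => ?_
  have h1 : (Matrix.of fun i k => H (M i) (τ k)) =
      Matrix.of fun i k => ∑ l, M i l * H (Pi.single l 1) (τ k) := by
    ext i k
    have h3 : M i = ∑ l, M i l • (Pi.single l 1 : κ → ℝ) := by
      simpa using (pi_eq_sum_univ' (M i))
    simp only [Matrix.of_apply]
    conv_lhs => rw [h3]
    simp [map_sum]
  rw [h1, det_sum_mul M (fun l k => H (Pi.single l 1) (τ k))]
  refine (Finset.abs_sum_le_sum_abs _ _).trans ?_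
  calc _ ≤ ∑ σ : Fin j → κ, |∏ k, H (Pi.single (σ k) 1) (τ k)| * minorNorm M := by
        refine Finset.sum_le_sum fun σ _ => ?_
        rw [abs_mul]
        exact mul_le_mul_of_nonneg_left (abs_det_le_minorNorm M σ) (abs_nonneg _)
    _ = D τ * minorNorm M := by rw [Finset.sum_mul]
    _ ≤ _ := by
        refine mul_le_mul_of_nonneg_right ?_ (minorNorm_nonneg M)
        linarith [Finset.single_le_sum (fun τ _ => hD τ) (Finset.mem_univ τ)]

theorem minorNorm_cons_le (v : κ → ℝ) (M : Fin j → κ → ℝ) :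
    minorNorm (Fin.cons v M : Fin (j + 1) → κ → ℝ) ≤ (j + 1) * ‖v‖ * minorNorm M := by
  refine minorNorm_le (by positivity [minorNorm_nonneg M]) fun σ => ?_
  rw [det_cons]
  refine (Finset.abs_sum_le_sum_abs _ _).trans ?_
  calc _ ≤ ∑ k : Fin (j + 1), ‖v‖ * minorNorm M := by
        refine Finset.sum_le_sum fun k _ => ?_
        rw [abs_mul, abs_mul, abs_pow, abs_neg, abs_one, one_pow, one_mul]
        exact mul_le_mul (norm_le_pi_norm v _)
          (abs_det_le_minorNorm M (fun k' => σ (k.succAbove k'))) (abs_nonneg _) (norm_nonneg _)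
    _ = _ := by simp; ring

theorem exists_nat_eq_minorNorm (b : Fin j → κ → ℤ) :
    ∃ N : ℕ, minorNorm (fun i l => (b i l : ℝ)) = N := by
  have h (σ : Fin j → κ) : (Matrix.of fun i k => (b i (σ k) : ℝ)).det =
      ((Matrix.of fun i k => b i (σ k)).det : ℤ) := by
    rw [Int.cast_det]
    rfl
  rcases isEmpty_or_nonempty (Fin j → κ) with he | hne
  · refine ⟨0, le_antisymm (minorNorm_le (by simp) fun σ => he.elim σ) ?_⟩
    simpa using minorNorm_nonneg _
  · obtain ⟨σ, hσ⟩ := Finite.exists_max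
      fun σ : Fin j → κ => |(Matrix.of fun i k => (b i (σ k) : ℝ)).det|
    refine ⟨((Matrix.of fun i k => b i (σ k)).det).natAbs, ?_⟩
    rw [← le_antisymm (abs_det_le_minorNorm (fun i l => (b i l : ℝ)) σ)
      (minorNorm_le (abs_nonneg _) hσ), h, Nat.cast_natAbs, Int.cast_abs]

/-- Finiteness of the set of rational subspaces of bounded height. -/
theorem finite_setOf_span_minorNorm_le (j : ℕ) (κ : Type*) [Fintype κ] (R : ℝ) :
    {W : Submodule ℝ (κ → ℝ) | ∃ b : Fin j → κ → ℤ,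
      LinearIndependent ℝ (fun i l => (b i l : ℝ)) ∧
      Submodule.span ℝ (Set.range fun i l => (b i l : ℝ)) = W ∧
      minorNorm (fun i l => (b i l : ℝ)) ≤ R}.Finite := by
  classical
  let Φ : ((Fin j → κ) → ℤ) → Set (κ → ℝ) := fun p =>
    {v | ∀ σ : Fin (j + 1) → κ, ∑ k : Fin (j + 1), (-1) ^ (k : ℕ) * v (σ k) *
        (p (fun k' => σ (k.succAbove k')) : ℝ) = 0}
  have hfin : (Set.pi Set.univ fun _ : Fin j → κ => Set.Icc (-⌈R⌉) ⌈R⌉).Finite :=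
    Set.Finite.pi fun _ => Set.finite_Icc _ _
  refine Set.Finite.of_finite_image ((hfin.image Φ).subset ?_)
    (f := fun W : Submodule ℝ (κ → ℝ) => (W : Set (κ → ℝ))) SetLike.coe_injective.injOn
  rintro _ ⟨W, ⟨b, hb, rfl, hR⟩, rfl⟩
  have h (σ : Fin j → κ) : (Matrix.of fun i k => (b i (σ k) : ℝ)).det =
      ((Matrix.of fun i k => b i (σ k)).det : ℤ) := by
    rw [Int.cast_det]
    rfl
  refine ⟨fun σ => (Matrix.of fun i k => b i (σ k)).det, fun σ _ => ?_, ?_⟩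
  · have h1 := (abs_det_le_minorNorm (fun i l => (b i l : ℝ)) σ).trans hR
    rw [h, ← Int.cast_abs] at h1
    have h2 : |(Matrix.of fun i k => b i (σ k)).det| ≤ ⌈R⌉ := by
      exact_mod_cast h1.trans (Int.le_ceil R)
    exact abs_le.1 h2
  · ext v
    have h1 : v ∈ Submodule.span ℝ (Set.range fun i l => (b i l : ℝ)) ↔
        ¬ LinearIndependent ℝ (Fin.cons v (fun i l => (b i l : ℝ)) : Fin (j + 1) → κ → ℝ) := by
      rw [linearIndependent_finCons]
      tauto
    rw [SetLike.mem_coe, h1, linearIndependent_iff_minorNorm_pos]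
    have h2 (σ : Fin (j + 1) → κ) := det_cons v (fun i l => (b i l : ℝ)) σ
    have h3 : v ∈ Φ (fun σ => (Matrix.of fun i k => b i (σ k)).det) ↔
        ∀ σ : Fin (j + 1) → κ, (Matrix.of fun i k =>
          (Fin.cons v (fun i l => (b i l : ℝ)) : Fin (j + 1) → κ → ℝ) i (σ k)).det = 0 := by
      refine forall_congr' fun σ => ?_
      rw [h2]
      simp only [h]
    rw [h3]
    constructor
    · intro h0
      exact (minorNorm_le le_rfl fun σ => by rw [h0, abs_zero]).not_gt
    · intro h0 σ
      exact abs_nonpos_iff.1 ((abs_det_le_minorNorm _ σ).trans (not_lt.1 h0))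

end Minors

/-- Minkowski's first theorem for a lattice that need not have full rank. -/
theorem exists_int_combination_norm_le {j : ℕ} (hj : 0 < j) {κ : Type*} [Fintype κ] [Nonempty κ]
    {M : Fin j → κ → ℝ} (hM : LinearIndependent ℝ M) :
    ∃ c : Fin j → ℤ, c ≠ 0 ∧
      ‖∑ i, (c i : ℝ) • M i‖ ≤ 2 * j * minorNorm M ^ ((j : ℝ)⁻¹) := by
  classical
  have hm := (linearIndependent_iff_minorNorm_pos M).1 hM
  obtain ⟨σ, hσ⟩ := exists_abs_det_eq_minorNorm M
  set m := minorNorm M with hmdef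
  set B : Matrix (Fin j) (Fin j) ℝ := Matrix.of fun i k => M i (σ k) with hB
  have hdet : B.det ≠ 0 := by
    intro h; rw [h, abs_zero] at hσ; exact hm.ne hσ
  set r := m ^ ((j : ℝ)⁻¹) with hr
  have hr0 : 0 < r := Real.rpow_pos_of_pos hm _
  have hrj : r ^ j = m := Real.rpow_inv_natCast_pow hm.le hj.ne'
  set f : (Fin j → ℝ) →ₗ[ℝ] (Fin j → ℝ) := Matrix.toLin' B.transpose with hf
  have hfdet : LinearMap.det f = B.det := by
    rw [hf, LinearMap.det_toLin', Matrix.det_transpose]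
  have hvol : volume (f ⁻¹' Metric.closedBall 0 (2 * r)) = ENNReal.ofReal (4 ^ j) := by
    rw [Measure.addHaar_preimage_linearMap _ (by rwa [hfdet]),
      Real.volume_pi_closedBall _ (by positivity), ← ENNReal.ofReal_mul (abs_nonneg _), hfdet,
      abs_inv, hσ, Fintype.card_fin, ← hrj]
    congr 1
    rw [← mul_assoc, mul_pow]
    norm_num
    field_simp
  have hbf := ZSpan.isAddFundamentalDomain' (Pi.basisFun ℝ (Fin j)) (volume : Measure (Fin j → ℝ))
  have hfd : volume (ZSpan.fundamentalDomain (Pi.basisFun ℝ (Fin j))) = 1 := by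
    rw [ZSpan.fundamentalDomain_pi_basisFun, volume_pi_pi]; simp
  have : Countable (Submodule.span ℤ (Set.range (Pi.basisFun ℝ (Fin j)))).toAddSubgroup :=
    inferInstanceAs (Countable (Submodule.span ℤ (Set.range (Pi.basisFun ℝ (Fin j)))))
  obtain ⟨⟨x, hxL⟩, hx0, hx⟩ := exists_ne_zero_mem_lattice_of_measure_mul_two_pow_lt_measure
    (F := ZSpan.fundamentalDomain (Pi.basisFun ℝ (Fin j)))
    (s := f ⁻¹' Metric.closedBall 0 (2 * r)) hbf
    (fun x hx => by simpa [map_neg] using hx)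
    ((convex_closedBall _ _).linear_preimage f) (by
      rw [hvol, hfd, one_mul, Module.finrank_fin_fun, ENNReal.ofReal_pow (by norm_num)]
      refine ENNReal.pow_lt_pow_left hj.ne' ?_
      rw [show (2 : ENNReal) = ENNReal.ofReal 2 by simp]
      exact (ENNReal.ofReal_lt_ofReal_iff (by norm_num)).2 (by norm_num))
  have hxL' : x ∈ Submodule.span ℤ (Set.range (Pi.basisFun ℝ (Fin j))) := hxL
  rw [Module.Basis.mem_span_iff_repr_mem] at hxL'
  choose c hc using hxL'
  have hcx : ∀ i, (c i : ℝ) = x i := fun i => by simpa using hc i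
  refine ⟨c, fun h => hx0 ?_, ?_⟩
  · ext i
    simp [← hcx, h]
  rw [Set.mem_preimage, mem_closedBall_zero_iff] at hx
  rw [pi_norm_le_iff_of_nonneg (by positivity)]
  intro l
  set b : Fin j → ℝ := fun i => M i l
  have hcr : ∀ k, |B.cramer b k| ≤ m := fun k => by
    rw [Matrix.cramer_apply]
    convert abs_det_le_minorNorm M (Function.update σ k l) using 3
    ext i k'
    by_cases h : k' = k
    · subst h; simp [b]
    · simp [h, hB]
  have h1 := Matrix.mulVec_cramer B b
  have h2 : B.det * (∑ i, (c i : ℝ) • M i) l = ∑ k, f x k * B.cramer b k := by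
    have h3 : (∑ i, (c i : ℝ) • M i) l = x ⬝ᵥ b := by
      simp [dotProduct, hcx, b]
    have h4 : ∑ k, f x k * B.cramer b k = x ⬝ᵥ (B.mulVec (B.cramer b)) := by
      rw [Matrix.dotProduct_mulVec, hf, Matrix.toLin'_apply, Matrix.mulVec_transpose]
      rfl
    rw [h3, h4, h1, dotProduct_smul, smul_eq_mul]
  have h5 : m * |(∑ i, (c i : ℝ) • M i) l| ≤ m * (2 * j * r) := by
    rw [← hσ, ← abs_mul, h2]
    refine (Finset.abs_sum_le_sum_abs _ _).trans ?_
    calc _ ≤ ∑ k : Fin j, 2 * r * m := by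
          refine Finset.sum_le_sum fun k _ => ?_
          rw [abs_mul]
          exact mul_le_mul ((norm_le_pi_norm (f x) k).trans hx) (hcr k) (abs_nonneg _)
            (by positivity)
      _ = _ := by simp [hσ]; ring
  exact le_of_mul_le_mul_left h5 hm

/-- `x` is marked by a family `P` of functions: some finite set `F` of pairwise comparable members
of `P` takes values in `[ε, ρ)` at `x`, and every member of `P` comparable to all of `F` is at
least `ρ` at `x`. -/
def Marked {S : Type*} (R : S → S → Prop) (ψ : S → ℝ → ℝ) (ε ρ : ℝ) (P : Set S) (x : ℝ) : Prop :=
  ∃ F : Finset S, (F : Set S) ⊆ P ∧ (F : Set S).Pairwise R ∧ (∀ s ∈ F, ε ≤ ψ s x ∧ ψ s x < ρ) ∧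
    ∀ s ∈ P, (∀ f ∈ F, R s f) → ρ ≤ ψ s x

theorem Marked.insert {S : Type*} {R : S → S → Prop} (hsymm : ∀ s t, R s t → R t s)
    {ψ : S → ℝ → ℝ} {ε ρ : ℝ} {P : Set S} {x : ℝ} {s : S} (hs : s ∈ P)
    (hx : Marked R ψ ε ρ {t ∈ P | R t s} x) (h1 : ε ≤ ψ s x) (h2 : ψ s x < ρ) :
    Marked R ψ ε ρ P x := by
  classical
  obtain ⟨F, hFP, hF, hFx, hmax⟩ := hx
  refine ⟨Insert.insert s F, ?_, ?_, ?_, ?_⟩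
  · rw [Finset.coe_insert, Set.insert_subset_iff]
    exact ⟨hs, fun t ht => (hFP ht).1⟩
  · rw [Finset.coe_insert]
    exact hF.insert fun t ht _ => ⟨hsymm _ _ (hFP ht).2, (hFP ht).2⟩
  · intro t ht
    rcases Finset.mem_insert.1 ht with rfl | ht
    exacts [⟨h1, h2⟩, hFx t ht]
  · intro t ht htF
    exact hmax t ⟨ht, htF s (Finset.mem_insert_self _ _)⟩
      fun f hf => htF f (Finset.mem_insert_of_mem hf)

/-- Quantitative nondivergence for families of functions on an interval. -/
theorem volume_not_marked_le {N : ℕ} {τ : ℝ} (hτ : 1 < τ)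
    (hN : IsEmpty (Besicovitch.SatelliteConfig ℝ N τ)) {S : Type*} {R : S → S → Prop}
    (hsymm : ∀ s t, R s t → R t s) (hirr : ∀ s, ¬ R s s) {ψ : S → ℝ → ℝ} {ε ρ : ℝ}
    {δ : ENNReal} (k : ℕ) : ∀ (P : Set S) (a b : ℝ),
      (∀ F : Finset S, (F : Set S) ⊆ P → (F : Set S).Pairwise R → F.card ≤ k) →
      (∀ s ∈ P, ContinuousOn (ψ s) (Set.Icc a b)) →
      (∀ s ∈ P, ∃ x ∈ Set.Icc a b, ρ ≤ ψ s x) →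
      (∀ y ∈ Set.Icc a b, {s ∈ P | ψ s y < ρ}.Finite) →
      (∀ s ∈ P, ∀ c d, a ≤ c → d ≤ b → (∃ x ∈ Set.Icc c d, ρ ≤ ψ s x) →
        volume {x ∈ Set.Icc c d | ψ s x < ε} ≤ δ * volume (Set.Icc c d)) →
      volume {x ∈ Set.Icc a b | ¬ Marked R ψ ε ρ P x} ≤
        (k * (N + 1) ^ k : ℕ) * δ * volume (Set.Icc a b) := by
  classical
  induction k with
  | zero =>
    intro P a b hP _ _ _ _
    have : {x ∈ Set.Icc a b | ¬ Marked R ψ ε ρ P x} = ∅ := by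
      refine Set.eq_empty_of_forall_notMem fun x hx => hx.2 ⟨∅, by simp, by simp, by simp, ?_⟩
      intro s hs
      have := hP {s} (by simpa using hs) (by simp)
      simp at this
    rw [this]
    simp
  | succ k ih =>
    intro P a b hP hcont hsup hfin hgood
    -- the bad set is covered by maximal balls
    let E : Set ℝ := {y ∈ Set.Icc a b | ∃ s ∈ P, ψ s y < ρ}
    let K : S → Set ℝ := fun s => {x ∈ Set.Icc a b | ρ ≤ ψ s x}
    have hKc : ∀ s ∈ P, IsCompact (K s) := fun s hs =>
      isCompact_Icc.of_isClosed_subset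
        ((hcont s hs).preimage_isClosed_of_isClosed isClosed_Icc isClosed_Ici) (fun x hx => hx.1)
    have hKn : ∀ s ∈ P, (K s).Nonempty := fun s hs => by
      obtain ⟨x, hx, h⟩ := hsup s hs
      exact ⟨x, hx, h⟩
    have hch : ∀ y : E, ∃ s ∈ P, ψ s y < ρ ∧
        ∀ t ∈ P, ψ t y < ρ → Metric.infDist (y : ℝ) (K t) ≤ Metric.infDist (y : ℝ) (K s) := by
      rintro ⟨y, hy, s0, hs0, hlt⟩
      obtain ⟨s, hs, hmax⟩ := Set.exists_max_image {s ∈ P | ψ s y < ρ}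
        (fun s => Metric.infDist y (K s)) (hfin y hy) ⟨s0, hs0, hlt⟩
      exact ⟨s, hs.1, hs.2, fun t ht1 ht2 => hmax t ⟨ht1, ht2⟩⟩
    choose sel hselP hsel hselmax using hch
    let r : E → ℝ := fun y => Metric.infDist (y : ℝ) (K (sel y))
    have hrpos : ∀ y, 0 < r y := fun y =>
      ((hKc _ (hselP y)).isClosed.notMem_iff_infDist_pos (hKn _ (hselP y))).1
        fun h => (hsel y).not_ge h.2
    let q : Besicovitch.BallPackage E ℝ :=
      { c := fun y => y
        r := r
        rpos := hrpos
        r_bound := b - a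
        r_le := fun y => by
          obtain ⟨x, hx⟩ := hKn _ (hselP y)
          refine (Metric.infDist_le_dist_of_mem hx).trans ?_
          rw [Real.dist_eq, abs_le]
          have h1 := y.2.1
          have h2 := hx.1
          constructor <;> linarith [h1.1, h1.2, h2.1, h2.2] }
    obtain ⟨u, hdisj, hcov⟩ := Besicovitch.exist_disjoint_covering_families hτ hN q
    let l : E → ℝ := fun y => max a (y - r y)
    let m : E → ℝ := fun y => min b (y + r y)
    have hJ : ∀ y, Set.Icc (l y) (m y) = Set.Icc a b ∩ Metric.closedBall (y : ℝ) (r y) := by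
      intro y
      rw [Real.closedBall_eq_Icc, Set.Icc_inter_Icc]
    have hhit : ∀ y, ∀ t ∈ P, ∃ x ∈ Set.Icc (l y) (m y), ρ ≤ ψ t x := by
      intro y t ht
      rw [hJ]
      by_cases hty : ψ t y < ρ
      · obtain ⟨x, hx, hxd⟩ := (hKc t ht).exists_infDist_eq_dist (hKn t ht) (y : ℝ)
        refine ⟨x, ⟨hx.1, ?_⟩, hx.2⟩
        rw [Metric.mem_closedBall, dist_comm, ← hxd]
        exact hselmax y t ht hty
      · exact ⟨y, ⟨y.2.1, Metric.mem_closedBall_self (hrpos y).le⟩, not_lt.1 hty⟩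
    let B : E → Set ℝ := fun y =>
      {x ∈ Set.Icc (l y) (m y) | ¬ Marked R ψ ε ρ {t ∈ P | R t (sel y)} x} ∪
        {x ∈ Set.Icc (l y) (m y) | ψ (sel y) x < ε}
    have hB : ∀ y, volume (B y) ≤
        ((k * (N + 1) ^ k : ℕ) + 1) * δ * volume (Set.Icc (l y) (m y)) := by
      intro y
      have hsub : Set.Icc (l y) (m y) ⊆ Set.Icc a b := by rw [hJ]; exact Set.inter_subset_left
      have h1 := ih {t ∈ P | R t (sel y)} (l y) (m y) (fun F hF hFR => by
          have hnot : sel y ∉ F := fun h => hirr _ (hF h).2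
          have := hP (insert (sel y) F) (by
            rw [Finset.coe_insert, Set.insert_subset_iff]
            exact ⟨hselP y, fun t ht => (hF ht).1⟩) (by
            rw [Finset.coe_insert]
            exact hFR.insert fun t ht _ => ⟨hsymm _ _ (hF ht).2, (hF ht).2⟩)
          rw [Finset.card_insert_of_notMem hnot] at this
          omega)
        (fun s hs => (hcont s hs.1).mono hsub) (fun s hs => hhit y s hs.1)
        (fun z hz => (hfin z (hsub hz)).subset fun s hs => ⟨hs.1.1, hs.2⟩)
        (fun s hs c d hc hd => hgood s hs.1 c d ((le_max_left _ _).trans hc)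
          (hd.trans (min_le_left _ _)))
      have h2 := hgood (sel y) (hselP y) (l y) (m y) (le_max_left _ _) (min_le_left _ _)
        (hhit y _ (hselP y))
      refine (measure_union_le _ _).trans ((add_le_add h1 h2).trans_eq ?_)
      rw [add_mul, add_mul, one_mul]
    have hcover : {x ∈ Set.Icc a b | ¬ Marked R ψ ε ρ P x} ⊆ ⋃ i, ⋃ y ∈ u i, B y := by
      rintro x ⟨hx, hxm⟩
      have hxE : x ∈ E := by
        refine ⟨hx, ?_⟩
        by_contra! hcon
        exact hxm ⟨∅, by simp, by simp, by simp, fun s hs _ => hcon s hs⟩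
      have hxc := hcov ⟨⟨x, hxE⟩, rfl⟩
      simp only [Set.mem_iUnion] at hxc ⊢
      obtain ⟨i, y, hyu, hxy⟩ := hxc
      refine ⟨i, y, hyu, ?_⟩
      have hxy' : dist x y < r y := hxy
      have hxJ : x ∈ Set.Icc (l y) (m y) := by
        rw [hJ]; exact ⟨hx, hxy'.le⟩
      have hlt : ψ (sel y) x < ρ := by
        by_contra! hge
        have := Metric.infDist_le_dist_of_mem (x := (y : ℝ)) (show x ∈ K (sel y) from ⟨hx, hge⟩)
        rw [dist_comm] at this
        exact this.not_gt hxy'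
      by_contra hcon
      simp only [B, Set.mem_union, Set.mem_ofPred_eq, not_or, not_and, not_not, not_lt] at hcon
      exact hxm (Marked.insert hsymm (hselP y) (hcon.1 hxJ) (hcon.2 hxJ) hlt)
    have hcount : ∀ i, (u i).Countable := fun i =>
      (hdisj i).countable_of_nonempty_interior fun y _ =>
        (Metric.nonempty_ball.2 (hrpos y)).mono Metric.ball_subset_interior_closedBall
    have hsum : ∀ i, volume (⋃ y ∈ u i, B y) ≤
        ((k * (N + 1) ^ k : ℕ) + 1) * δ * volume (Set.Icc a b) := by
      intro i
      have := (hcount i).to_subtype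
      refine (measure_biUnion_le volume (hcount i) B).trans ?_
      calc _ ≤ ∑' y : u i, ((k * (N + 1) ^ k : ℕ) + 1) * δ * volume (Set.Icc (l y) (m y)) :=
            ENNReal.tsum_le_tsum fun y => hB y
        _ = ((k * (N + 1) ^ k : ℕ) + 1) * δ * ∑' y : u i, volume (Set.Icc (l y) (m y)) :=
            ENNReal.tsum_mul_left
        _ = ((k * (N + 1) ^ k : ℕ) + 1) * δ * volume (⋃ y ∈ u i, Set.Icc (l y) (m y)) := by
            rw [measure_biUnion (hcount i) _ fun y _ => measurableSet_Icc]
            refine (hdisj i).mono_on fun y _ => ?_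
            simp only [hJ]
            exact Set.inter_subset_right
        _ ≤ _ := by
            gcongr
            refine Set.iUnion₂_subset fun y _ => ?_
            rw [hJ]
            exact Set.inter_subset_left
    calc _ ≤ volume (⋃ i, ⋃ y ∈ u i, B y) := measure_mono hcover
      _ ≤ ∑ i : Fin N, volume (⋃ y ∈ u i, B y) := measure_iUnion_fintype_le _ _
      _ ≤ ∑ i : Fin N, ((k * (N + 1) ^ k : ℕ) + 1) * δ * volume (Set.Icc a b) :=
          Finset.sum_le_sum fun i _ => hsum i
      _ = (N * (k * (N + 1) ^ k + 1) : ℕ) * δ * volume (Set.Icc a b) := by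
          simp [mul_assoc]
      _ ≤ _ := by
          have h1 : 1 ≤ (N + 1) ^ k := Nat.one_le_pow _ _ (by omega)
          have h2 : N * (k * (N + 1) ^ k + 1) ≤ (k + 1) * (N + 1) ^ (k + 1) := by
            have : (k + 1) * (N + 1) ^ (k + 1) = (N + 1) * (k * (N + 1) ^ k + (N + 1) ^ k) := by
              ring
            rw [this]
            exact Nat.mul_le_mul (by omega) (by omega)
          exact mul_le_mul_left (mul_le_mul_left (Nat.cast_le.2 h2) _) _

/-- A function on an interval whose `k`-th derivative is large has small sublevel sets. -/
theorem exists_volume_sublevel_le (k : ℕ) : ∃ C : ℝ, 0 < C ∧ ∀ φ : ℝ → ℝ, ContDiff ℝ (⊤ : ℕ∞) φ →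
    ∀ J : Set ℝ, J.OrdConnected → ∀ ε m : ℝ, 0 < ε → 0 < m →
      (∀ t ∈ J, C * ε / m ^ k < |iteratedDeriv k φ t|) →
      volume {x ∈ J | |φ x| < ε} ≤ ENNReal.ofReal m := by
  induction k with
  | zero =>
    refine ⟨1, one_pos, fun φ _ J _ ε m _ _ h => ?_⟩
    have : {x ∈ J | |φ x| < ε} = ∅ := by
      refine Set.eq_empty_of_forall_notMem fun x hx => ?_
      have := h x hx.1
      simp only [one_mul, pow_zero, div_one, iteratedDeriv_zero] at this
      exact this.not_gt hx.2
    rw [this]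
    simp
  | succ k ih =>
    obtain ⟨C, hC, ih⟩ := ih
    refine ⟨4 * 4 ^ k * C, by positivity, fun φ hφ J hJ ε m hε hm h => ?_⟩
    set g := iteratedDeriv k φ with hg
    have hgd : Differentiable ℝ g := hφ.differentiable_iteratedDeriv k
      (by exact_mod_cast WithTop.coe_lt_top _)
    have hg' : deriv g = iteratedDeriv (k + 1) φ := iteratedDeriv_succ.symm
    have hg'c : Continuous (deriv g) := by
      rw [hg']; exact hφ.continuous_iteratedDeriv (k + 1) (by exact_mod_cast le_top)
    set ε₁ := C * ε / (m / 4) ^ k with hε₁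
    have hε₁0 : 0 < ε₁ := by positivity
    have hlow : ∀ t ∈ J, 4 * ε₁ / m < |deriv g t| := by
      intro t ht
      have := h t ht
      rw [hg']
      refine lt_of_eq_of_lt ?_ this
      rw [hε₁, div_pow]
      field_simp
      ring
    have hne : ∀ t ∈ J, deriv g t ≠ 0 := fun t ht h0 => by
      have := hlow t ht
      rw [h0, abs_zero] at this
      exact absurd this (not_lt.2 (by positivity))
    have hmono : MonotoneOn g J ∨ AntitoneOn g J := by
      by_cases hp : ∀ t ∈ J, 0 < deriv g t
      · exact Or.inl (monotoneOn_of_deriv_nonneg hJ.convex hgd.continuous.continuousOn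
          hgd.differentiableOn fun x hx => (hp x (interior_subset hx)).le)
      · push Not at hp
        obtain ⟨s, hs, hs0⟩ := hp
        refine Or.inr (antitoneOn_of_deriv_nonpos hJ.convex hgd.continuous.continuousOn
          hgd.differentiableOn fun x hx => ?_)
        by_contra! hcon
        obtain ⟨y, hy, hy0⟩ := hJ.isPreconnected.intermediate_value hs (interior_subset hx)
          hg'c.continuousOn ⟨hs0, hcon.le⟩
        exact hne y hy hy0
    have hordP : {x ∈ J | ε₁ < g x}.OrdConnected := by
      refine ⟨fun x hx y hy z hz => ?_⟩
      have hzJ := hJ.out hx.1 hy.1 hz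
      refine ⟨hzJ, ?_⟩
      rcases hmono with hm | hm
      · exact hx.2.trans_le (hm hx.1 hzJ hz.1)
      · exact hy.2.trans_le (hm hzJ hy.1 hz.2)
    have hordN : {x ∈ J | g x < -ε₁}.OrdConnected := by
      refine ⟨fun x hx y hy z hz => ?_⟩
      have hzJ := hJ.out hx.1 hy.1 hz
      refine ⟨hzJ, ?_⟩
      rcases hmono with hm | hm
      · exact (hm hzJ hy.1 hz.2).trans_lt hy.2
      · exact (hm hx.1 hzJ hz.1).trans_lt hx.2
    have h1 := ih φ hφ _ hordP ε (m / 4) hε (by positivity)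
      fun t ht => ht.2.trans_le (le_abs_self _)
    have h2 := ih φ hφ _ hordN ε (m / 4) hε (by positivity) fun t ht => by
      have := ht.2
      exact (lt_neg.1 this).trans_le (neg_le_abs _)
    have h3 : volume {x ∈ J | |g x| ≤ ε₁} ≤ ENNReal.ofReal (m / 2) := by
      refine (Real.volume_le_diam _).trans (Metric.ediam_le fun x hx y hy => ?_)
      rw [edist_dist]
      refine ENNReal.ofReal_le_ofReal ?_
      wlog hxy : x ≤ y generalizing x y
      · rw [dist_comm]; exact this y hy x hx (not_le.1 hxy).le
      rcases hxy.eq_or_lt with rfl | hxy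
      · simp; positivity
      obtain ⟨ξ, hξ, he⟩ := exists_deriv_eq_slope g hxy hgd.continuous.continuousOn
        hgd.differentiableOn
      have hl := hlow ξ (hJ.out hx.1 hy.1 ⟨hξ.1.le, hξ.2.le⟩)
      rw [he, abs_div, abs_of_pos (sub_pos.2 hxy), div_lt_div_iff₀ hm (sub_pos.2 hxy)] at hl
      have hu : |g y - g x| ≤ 2 * ε₁ := by
        refine (abs_sub _ _).trans ?_
        linarith [hx.2, hy.2]
      rw [dist_comm, Real.dist_eq, abs_of_pos (sub_pos.2 hxy)]
      have : 4 * ε₁ * (y - x) < 4 * ε₁ * (m / 2) := by nlinarith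
      exact (lt_of_mul_lt_mul_left this (by positivity)).le
    have hcov : {x ∈ J | |φ x| < ε} ⊆ ({x ∈ {x ∈ J | ε₁ < g x} | |φ x| < ε} ∪
        {x ∈ {x ∈ J | g x < -ε₁} | |φ x| < ε}) ∪ {x ∈ J | |g x| ≤ ε₁} := by
      rintro x ⟨hx, hxε⟩
      by_cases ha : ε₁ < g x
      · exact Or.inl (Or.inl ⟨⟨hx, ha⟩, hxε⟩)
      by_cases hb : g x < -ε₁
      · exact Or.inl (Or.inr ⟨⟨hx, hb⟩, hxε⟩)
      · exact Or.inr ⟨hx, abs_le.2 ⟨not_lt.1 hb, not_lt.1 ha⟩⟩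
    calc _ ≤ _ := measure_mono hcov
      _ ≤ _ := measure_union_le _ _
      _ ≤ _ := add_le_add (measure_union_le _ _) le_rfl
      _ ≤ ENNReal.ofReal (m / 4) + ENNReal.ofReal (m / 4) + ENNReal.ofReal (m / 2) :=
          add_le_add (add_le_add h1 h2) h3
      _ = ENNReal.ofReal m := by
          rw [← ENNReal.ofReal_add (by positivity) (by positivity),
            ← ENNReal.ofReal_add (by positivity) (by positivity)]
          congr 1; ring

theorem exists_abs_le_sublevel (k : ℕ) (K : ℝ) : ∃ C : ℝ, 1 ≤ C ∧ ∀ φ : ℝ → ℝ,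
    ContDiff ℝ (⊤ : ℕ∞) φ → ∀ c d : ℝ, ∀ κ > 0,
      (∀ t ∈ Set.Icc c d, κ ≤ |iteratedDeriv k φ t| ∧ |iteratedDeriv k φ t| ≤ K * κ) →
      ∀ ε > 0, ∀ m > 0, volume {x ∈ Set.Icc c d | |φ x| < ε} = ENNReal.ofReal m →
      ∀ x ∈ Set.Icc c d, |φ x| ≤ C * ε * ((d - c) / m) ^ k := by
  choose C hC hsub using exists_volume_sublevel_le
  -- the constants for the half measure
  let C' : ℕ → ℝ := fun i => C i * 2 ^ i
  have hC' : ∀ i, 0 < C' i := fun i => by have := hC i; positivity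
  refine ⟨1 + |K| * C' k + ∑ i ∈ Finset.range k, C' i, ?_, ?_⟩
  · have : 0 ≤ ∑ i ∈ Finset.range k, C' i := Finset.sum_nonneg fun i _ => (hC' i).le
    have := hC' k
    have : 0 ≤ |K| * C' k := by positivity
    linarith
  intro φ hφ c d κ hκ hk ε hε m hm hvol x hx
  have hcd : c ≤ d := hx.1.trans hx.2
  have hmD : m ≤ d - c := by
    have h1 : volume {x ∈ Set.Icc c d | |φ x| < ε} ≤ volume (Set.Icc c d) :=
      measure_mono fun x hx => hx.1
    rw [hvol, Real.volume_Icc] at h1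
    exact (ENNReal.ofReal_le_ofReal_iff (by linarith)).1 h1
  have hD : 0 < d - c := hm.trans_le hmD
  have hpt : ∀ i, ∃ ξ ∈ Set.Icc c d, |iteratedDeriv i φ ξ| ≤ C' i * ε / m ^ i := by
    intro i
    by_contra! hcon
    have := hsub i φ hφ (Set.Icc c d) Set.ordConnected_Icc ε (m / 2) hε (by positivity)
      fun t ht => by
        refine lt_of_eq_of_lt ?_ (hcon t ht)
        simp only [C', div_pow]
        field_simp
    rw [hvol, ENNReal.ofReal_le_ofReal_iff (by positivity)] at this
    linarith
  have key : ∀ i ≤ k, ∀ x ∈ Set.Icc c d, |iteratedDeriv (k - i) φ x| ≤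
      (1 + |K| * C' k + ∑ l ∈ Finset.Ico (k - i) k, C' l) * ε * (d - c) ^ i / m ^ k := by
    intro i
    induction i with
    | zero =>
      intro _ x hx
      obtain ⟨ξ, hξ, hξ'⟩ := hpt k
      have h1 := (hk ξ hξ).1.trans hξ'
      simp only [Nat.sub_zero, Finset.Ico_self, Finset.sum_empty, add_zero, pow_zero, mul_one]
      have h0 : 0 < ε / m ^ k := by positivity
      calc _ ≤ K * κ := (hk x hx).2
        _ ≤ |K| * κ := by gcongr; exact le_abs_self K
        _ ≤ |K| * (C' k * ε / m ^ k) := by gcongr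
        _ = |K| * C' k * (ε / m ^ k) := by ring
        _ ≤ (1 + |K| * C' k) * (ε / m ^ k) := by gcongr; linarith
        _ = _ := by ring
    | succ i ih =>
      intro hi x hx
      have ih := ih (by omega)
      obtain ⟨j, hj⟩ : ∃ j, k = j + i + 1 := ⟨k - (i + 1), by omega⟩
      have e1 : k - i = j + 1 := by omega
      have e2 : k - (i + 1) = j := by omega
      rw [e1] at ih
      rw [e2]
      obtain ⟨ξ, hξ, hξ'⟩ := hpt j
      set B := (1 + |K| * C' k + ∑ l ∈ Finset.Ico (j + 1) k, C' l) with hB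
      have hBs : (1 + |K| * C' k + ∑ l ∈ Finset.Ico j k, C' l) = B + C' j := by
        rw [hB, Finset.sum_eq_sum_Ico_succ_bot (by omega)]; ring
      have hmv : |iteratedDeriv j φ x - iteratedDeriv j φ ξ| ≤
          (B * ε * (d - c) ^ i / m ^ k) * |x - ξ| := by
        have := Convex.norm_image_sub_le_of_norm_deriv_le (f := iteratedDeriv j φ)
          (s := Set.Icc c d) (x := ξ) (y := x) (C := B * ε * (d - c) ^ i / m ^ k)
          (fun t _ => (hφ.differentiable_iteratedDeriv j
            (by exact_mod_cast WithTop.coe_lt_top _)) t)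
          (fun t ht => by rw [← iteratedDeriv_succ]; exact ih t ht) (convex_Icc _ _) hξ hx
        exact this
      have hxξ : |x - ξ| ≤ d - c := by
        rw [abs_le]; constructor <;> linarith [hx.1, hx.2, hξ.1, hξ.2]
      have hBn : 0 ≤ B := by
        have : 0 ≤ ∑ l ∈ Finset.Ico (j + 1) k, C' l := Finset.sum_nonneg fun i _ => (hC' i).le
        have := hC' k
        positivity
      have hpow : C' j * ε / m ^ j ≤ C' j * ε * (d - c) ^ (i + 1) / m ^ k := by
        rw [div_le_div_iff₀ (by positivity) (by positivity), hj, add_assoc, pow_add]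
        have h1 : m ^ (i + 1) ≤ (d - c) ^ (i + 1) := pow_le_pow_left₀ hm.le hmD _
        have := hC' j
        calc _ = C' j * ε * m ^ j * m ^ (i + 1) := by ring
          _ ≤ C' j * ε * m ^ j * (d - c) ^ (i + 1) := by gcongr
          _ = _ := by ring
      rw [hBs]
      calc |iteratedDeriv j φ x|
          ≤ |iteratedDeriv j φ ξ| + |iteratedDeriv j φ x - iteratedDeriv j φ ξ| := by
            have := abs_add_le (iteratedDeriv j φ ξ) (iteratedDeriv j φ x - iteratedDeriv j φ ξ)
            simpa using this
        _ ≤ C' j * ε * (d - c) ^ (i + 1) / m ^ k +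
            (B * ε * (d - c) ^ i / m ^ k) * (d - c) := by
            refine add_le_add (hξ'.trans hpow) (hmv.trans ?_)
            gcongr
        _ = _ := by ring
  have := key k le_rfl x hx
  simp only [Nat.sub_self, iteratedDeriv_zero, ← Finset.range_eq_Ico] at this
  refine this.trans_eq ?_
  rw [div_pow]; ring

/-- Functions on an interval with comparable `k`-th derivatives, `1 ≤ k ≤ M`, are uniformly
`(C, 1 / M)`-good. -/
theorem exists_good (M : ℕ) (K : ℝ) : ∃ C : ℝ, 1 ≤ C ∧ ∀ φ : ℝ → ℝ,
    ContDiff ℝ (⊤ : ℕ∞) φ → ∀ c d : ℝ, ∀ κ > 0,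
      (∃ k, 1 ≤ k ∧ k ≤ M ∧
        ∀ t ∈ Set.Icc c d, κ ≤ |iteratedDeriv k φ t| ∧ |iteratedDeriv k φ t| ≤ K * κ) →
      ∀ ε ρ : ℝ, 0 < ε → ε ≤ ρ → (∃ x ∈ Set.Icc c d, ρ ≤ |φ x|) →
      volume {x ∈ Set.Icc c d | |φ x| < ε} ≤
        ENNReal.ofReal (C * (ε / ρ) ^ ((M : ℝ)⁻¹)) * volume (Set.Icc c d) := by
  choose C hC hsub using fun k => exists_abs_le_sublevel k K
  refine ⟨∑ k ∈ Finset.range (M + 1), C k, ?_, ?_⟩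
  · refine (hC 0).trans (Finset.single_le_sum (f := C) (fun i _ => ?_) (by simp))
    exact zero_le_one.trans (hC i)
  rintro φ hφ c d κ hκ ⟨k, hk1, hkM, hk⟩ ε ρ hε hερ ⟨x, hx, hxρ⟩
  have hcd : c ≤ d := hx.1.trans hx.2
  have hCk : C k ≤ ∑ k ∈ Finset.range (M + 1), C k :=
    Finset.single_le_sum (f := C) (fun i _ => zero_le_one.trans (hC i)) (by simp; omega)
  have hρ : 0 < ρ := hε.trans_le hερ
  set v := volume {x ∈ Set.Icc c d | |φ x| < ε} with hv
  have hvle : v ≤ volume (Set.Icc c d) := measure_mono fun x hx => hx.1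
  have hvfin : v ≠ ⊤ := (hvle.trans_lt (by simp)).ne
  rcases eq_or_ne v 0 with h0 | h0
  · rw [h0]; exact zero_le
  have hm : 0 < v.toReal := ENNReal.toReal_pos h0 hvfin
  have hmD : v.toReal ≤ d - c := by
    rw [Real.volume_Icc] at hvle
    exact ENNReal.toReal_le_of_le_ofReal (by linarith) hvle
  have h := hxρ.trans (hsub k φ hφ c d κ hκ hk ε hε v.toReal hm (ENNReal.ofReal_toReal hvfin).symm
    x hx)
  rw [Real.volume_Icc, ← ENNReal.ofReal_mul (by have := (hC k).trans hCk; positivity),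
    ← ENNReal.ofReal_toReal hvfin]
  refine ENNReal.ofReal_le_ofReal ?_
  have hD : 0 < d - c := hm.trans_le hmD
  -- invert the inequality
  have h1 : (v.toReal / (d - c)) ^ k ≤ C k * (ε / ρ) := by
    rw [div_pow] at h ⊢
    rw [div_le_iff₀ (by positivity)]
    have h2 : ρ * v.toReal ^ k ≤ C k * ε * (d - c) ^ k := by
      calc _ ≤ (C k * ε * ((d - c) ^ k / v.toReal ^ k)) * v.toReal ^ k := by gcongr
        _ = _ := by field_simp
    calc v.toReal ^ k = (ρ * v.toReal ^ k) / ρ := by field_simp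
      _ ≤ (C k * ε * (d - c) ^ k) / ρ := by gcongr
      _ = _ := by ring
  have hCk1 := hC k
  have hkR : (1 : ℝ) ≤ k := by exact_mod_cast hk1
  have h2 : v.toReal / (d - c) ≤ C k * (ε / ρ) ^ ((M : ℝ)⁻¹) := by
    have h3 : v.toReal / (d - c) ≤ (C k * (ε / ρ)) ^ ((k : ℝ)⁻¹) := by
      rw [Real.le_rpow_inv_iff_of_pos (by positivity) (by positivity) (by positivity)]
      exact_mod_cast h1
    refine h3.trans ?_
    rw [Real.mul_rpow (by positivity) (by positivity)]
    refine mul_le_mul ?_ ?_ (by positivity) (by positivity)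
    · calc C k ^ ((k : ℝ)⁻¹) ≤ C k ^ (1 : ℝ) :=
          Real.rpow_le_rpow_of_exponent_le hCk1 (inv_le_one_of_one_le₀ hkR)
        _ = C k := Real.rpow_one _
    · refine Real.rpow_le_rpow_of_exponent_ge (by positivity) ((div_le_one hρ).2 hερ) ?_
      gcongr
  calc v.toReal = v.toReal / (d - c) * (d - c) := by field_simp
    _ ≤ _ := by gcongr; exact h2.trans (by gcongr)

/-- The unipotent map attached to `y` followed by the diagonal map attached to `T`, which expands
the zeroth coordinate by `2 ^ ∑ T` and contracts the `i`-th by `2 ^ T i`. -/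
noncomputable def flow {n : ℕ} (T : Fin n → ℕ) (y : Fin n → ℝ) :
    (Fin (n + 1) → ℝ) →ₗ[ℝ] (Fin (n + 1) → ℝ) where
  toFun v := Fin.cons (2 ^ (∑ i, T i) * (v 0 + ∑ i, y i * v i.succ))
    (fun i => v i.succ / 2 ^ T i)
  map_add' u v := by
    ext i
    refine Fin.cases ?_ (fun i => ?_) i
    · simp [mul_add, Finset.sum_add_distrib]; ring
    · simp [add_div]
  map_smul' c v := by
    ext i
    refine Fin.cases ?_ (fun i => ?_) i
    · simp only [Fin.cons_zero, Pi.smul_apply, smul_eq_mul, RingHom.id_apply, mul_left_comm _ c,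
        ← Finset.mul_sum, ← mul_add]
    · simp [mul_div_assoc]

section Flow

variable {n : ℕ}

@[simp] theorem flow_zero (T : Fin n → ℕ) (y : Fin n → ℝ) (v : Fin (n + 1) → ℝ) :
    flow T y v 0 = 2 ^ (∑ i, T i) * (v 0 + ∑ i, y i * v i.succ) := rfl

@[simp] theorem flow_succ (T : Fin n → ℕ) (y : Fin n → ℝ) (v : Fin (n + 1) → ℝ) (i : Fin n) :
    flow T y v i.succ = v i.succ / 2 ^ T i := rfl

theorem flow_injective (T : Fin n → ℕ) (y : Fin n → ℝ) : Function.Injective (flow T y) := by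
  rw [injective_iff_map_eq_zero]
  intro v hv
  have h1 : ∀ i : Fin n, v i.succ = 0 := fun i => by
    have := congrFun hv i.succ
    simpa using this
  have h0 := congrFun hv 0
  simp only [flow_zero, h1, mul_zero, Finset.sum_const_zero, add_zero, Pi.zero_apply,
    mul_eq_zero] at h0
  ext i
  exact Fin.cases (h0.resolve_left (by positivity)) h1 i

/-- The lattice `flow T y ℤ^(n+1)` has a nonzero vector of norm less than `ε`. -/
def SmallVec (T : Fin n → ℕ) (y : Fin n → ℝ) (ε : ℝ) : Prop :=
  ∃ v : Fin (n + 1) → ℤ, v ≠ 0 ∧ ‖flow T y fun i => (v i : ℝ)‖ < ε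

theorem tendsto_sum_cofinite_atTop :
    Filter.Tendsto (fun T : Fin n → ℕ => ∑ i, T i) Filter.cofinite Filter.atTop := by
  refine Filter.tendsto_atTop.2 fun N => ?_
  rw [Filter.eventually_cofinite]
  refine (Set.finite_Iic fun _ : Fin n => N).subset fun T hT i => ?_
  exact (Finset.single_le_sum (f := T) (fun i _ => Nat.zero_le _) (Finset.mem_univ i)).trans
    (not_le.1 hT).le

theorem eventually_mul_two_rpow_lt {C α η : ℝ} (hα : 0 < α) (hη : 0 < η) :
    ∀ᶠ T : Fin n → ℕ in Filter.cofinite, C * (2 : ℝ) ^ (-(α * (∑ i, T i : ℕ))) < η := by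
  have h1 : Filter.Tendsto (fun N : ℕ => C * (2 : ℝ) ^ (-(α * N))) Filter.atTop
      (nhds (C * 0)) := by
    refine Filter.Tendsto.const_mul _ ?_
    have h2 : (fun N : ℕ => (2 : ℝ) ^ (-(α * N))) = fun N : ℕ => ((2 : ℝ) ^ (-α)) ^ N := by
      funext N
      rw [← neg_mul, Real.rpow_mul two_pos.le, Real.rpow_natCast]
    rw [h2]
    exact tendsto_pow_atTop_nhds_zero_of_lt_one (by positivity)
      (Real.rpow_lt_one_of_one_lt_of_neg one_lt_two (by linarith))
  rw [mul_zero] at h1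
  exact tendsto_sum_cofinite_atTop.eventually (h1.eventually_lt_const hη)

theorem isVWMA_of_frequently_smallVec {y : Fin n → ℝ} {γ C : ℝ} (hγ : 0 < γ)
    (h : ∃ᶠ T in Filter.cofinite, SmallVec T y (C * (2 : ℝ) ^ (-(γ * (∑ i, T i : ℕ))))) :
    IsVWMA y := by
  have hn : 0 < n := by
    rcases Nat.eq_zero_or_pos n with rfl | hn
    · rw [Filter.frequently_cofinite_iff_infinite] at h
      exact (h (Set.toFinite _)).elim
    · exact hn
  have hnR : (0 : ℝ) < n := by exact_mod_cast hn
  refine ⟨n * (1 + γ / 2), by nlinarith, ?_⟩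
  rw [mul_div_cancel_left₀ _ hnR.ne']
  set A := {q : Fin n → ℤ | ∃ p : ℤ, |(∑ i, y i * (q i : ℝ)) + (p : ℝ)| ≤
        (∏ i, max |(q i : ℝ)| 1) ^ (-(1 + γ / 2))} with hA
  intro hfin
  by_cases hex : ∃ q : Fin n → ℤ, q ≠ 0 ∧ ∃ p : ℤ, (∑ i, y i * (q i : ℝ)) + (p : ℝ) = 0
  · obtain ⟨q, hq, p, hp⟩ := hex
    have hinj : Function.Injective fun k : ℤ => k • q := by
      obtain ⟨i, hi⟩ := Function.ne_iff.1 hq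
      intro k l hkl
      have := congrFun hkl i
      simp only [Pi.smul_apply, smul_eq_mul] at this
      exact mul_right_cancel₀ hi this
    refine Set.infinite_of_injective_forall_mem hinj (fun k => ?_) hfin
    refine ⟨k * p, ?_⟩
    have : (∑ i, y i * (((k • q) i : ℤ) : ℝ)) + ((k * p : ℤ) : ℝ) =
        k * ((∑ i, y i * (q i : ℝ)) + (p : ℝ)) := by
      rw [mul_add, Finset.mul_sum]
      push_cast
      congr 1
      refine Finset.sum_congr rfl fun i _ => ?_
      simp only [Pi.smul_apply, smul_eq_mul]
      push_cast; ring
    rw [this, hp, mul_zero, abs_zero]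
    positivity
  · push Not at hex
    obtain ⟨η, hη, hηA⟩ : ∃ η > 0, ∀ q ∈ A, q ≠ 0 → ∀ p : ℤ,
        η ≤ |(∑ i, y i * (q i : ℝ)) + (p : ℝ)| := by
      let B := hfin.toFinset.filter (· ≠ 0)
      have hround : ∀ q : Fin n → ℤ, ∀ p : ℤ,
          |(∑ i, y i * (q i : ℝ)) - round (∑ i, y i * (q i : ℝ))| ≤
          |(∑ i, y i * (q i : ℝ)) + (p : ℝ)| := fun q p => by
        have := round_le (∑ i, y i * (q i : ℝ)) (-p)
        simpa using this
      rcases B.eq_empty_or_nonempty with hB | hB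
      · refine ⟨1, one_pos, fun q hq hq0 => ?_⟩
        have : q ∈ B := by simp [B, hq, hq0]
        simp [hB] at this
      · obtain ⟨q0, hq0, hmin⟩ := B.exists_min_image
          (fun q => |(∑ i, y i * (q i : ℝ)) - round (∑ i, y i * (q i : ℝ))|) hB
        refine ⟨_, abs_pos.2 (?_ : (∑ i, y i * (q0 i : ℝ)) - round (∑ i, y i * (q0 i : ℝ)) ≠ 0),
          fun q hq hq0 p => (hmin q (by simp [B, hq, hq0])).trans (hround q p)⟩
        have := hex q0 (Finset.mem_filter.1 hq0).2 (-round (∑ i, y i * (q0 i : ℝ)))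
        push_cast at this
        rwa [← sub_eq_add_neg] at this
    have e1 := eventually_mul_two_rpow_lt (n := n) (C := C) (half_pos hγ) one_pos
    have e2 := eventually_mul_two_rpow_lt (n := n) (C := C) hγ (lt_min hη one_pos)
    obtain ⟨T, ⟨v, hv, hvT⟩, h1, h2⟩ := (h.and_eventually (e1.and e2)).exists
    set N : ℕ := ∑ i, T i with hN
    have hlt : ‖flow T y fun i => (v i : ℝ)‖ < min η 1 := hvT.trans h2
    have h2N : (1 : ℝ) ≤ 2 ^ N := one_le_pow₀ one_le_two
    -- zeroth coordinate
    have h0 : 2 ^ N * |(v 0 : ℝ) + ∑ i, y i * v i.succ| < C * (2 : ℝ) ^ (-(γ * N)) := by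
      have := (norm_le_pi_norm (flow T y fun i => (v i : ℝ)) 0).trans_lt hvT
      rwa [flow_zero, Real.norm_eq_abs, abs_mul, abs_of_pos (by positivity)] at this
    have h0' : |(v 0 : ℝ) + ∑ i, y i * v i.succ| < min η 1 := by
      refine lt_of_le_of_lt ?_ (h0.trans h2)
      exact le_mul_of_one_le_left (abs_nonneg _) h2N
    have hs : ∀ i : Fin n, |(v i.succ : ℝ)| ≤ 2 ^ T i := fun i => by
      have := (norm_le_pi_norm (flow T y fun i => (v i : ℝ)) i.succ).trans_lt
        (hlt.trans_le (min_le_right _ _))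
      rw [flow_succ, Real.norm_eq_abs, abs_div, abs_of_pos (by positivity : (0 : ℝ) < 2 ^ T i),
        div_lt_one (by positivity)] at this
      exact this.le
    have hq0 : (fun i : Fin n => v i.succ) ≠ 0 := by
      intro hq
      have hq' : ∀ i : Fin n, v i.succ = 0 := congrFun hq
      apply hv
      ext i
      refine Fin.cases ?_ hq' i
      have := h0'.trans_le (min_le_right _ _)
      simp only [hq', Int.cast_zero, mul_zero, Finset.sum_const_zero, add_zero] at this
      exact Int.abs_lt_one_iff.1 (by exact_mod_cast this)
    have hprod : ∏ i : Fin n, max |((v i.succ : ℤ) : ℝ)| 1 ≤ 2 ^ N := by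
      rw [hN, ← Finset.prod_pow_eq_pow_sum]
      exact Finset.prod_le_prod (fun i _ => by positivity)
        fun i _ => max_le (hs i) (one_le_pow₀ one_le_two)
    have hprod1 : 0 < ∏ i : Fin n, max |((v i.succ : ℤ) : ℝ)| 1 :=
      Finset.prod_pos fun i _ => by positivity
    have hmem : (fun i : Fin n => v i.succ) ∈ A := by
      refine ⟨v 0, ?_⟩
      rw [add_comm]
      have hle : |(v 0 : ℝ) + ∑ i, y i * v i.succ| ≤ ((2 : ℝ) ^ N) ^ (-(1 + γ / 2)) := by
        have e3 : ((2 : ℝ) ^ N) ^ (-(1 + γ / 2)) =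
            (2 : ℝ) ^ (-(γ * N)) * (2 : ℝ) ^ (γ / 2 * N) / 2 ^ N := by
          rw [← Real.rpow_natCast, ← Real.rpow_mul two_pos.le, ← Real.rpow_add two_pos,
            ← Real.rpow_sub two_pos]
          congr 1; ring
        have e4 : C ≤ (2 : ℝ) ^ (γ / 2 * N) := by
          rw [Real.rpow_neg two_pos.le, ← div_eq_mul_inv, div_lt_one (by positivity)] at h1
          exact h1.le
        rw [e3, le_div_iff₀ (by positivity), mul_comm]
        refine h0.le.trans ?_
        rw [mul_comm]
        gcongr
      refine hle.trans ?_
      exact Real.rpow_le_rpow_of_nonpos hprod1 hprod (by linarith)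
    have := hηA _ hmem hq0 (v 0)
    rw [add_comm] at this
    exact absurd (h0'.trans_le (min_le_left _ _)) (not_lt.2 this)

theorem IsVWMA.exists_frequently_smallVec {y : Fin n → ℝ} (hy : IsVWMA y) :
    ∃ m : ℕ, ∃ᶠ T in Filter.cofinite,
      SmallVec T y ((2 : ℝ) ^ (-(1 / ((m : ℝ) + 1) * (∑ i, T i : ℕ)))) := by
  obtain ⟨v, hv, hA⟩ := hy
  have hn : 0 < n := by
    rcases Nat.eq_zero_or_pos n with rfl | hn
    · exact (hA (Set.toFinite _)).elim
    · exact hn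
  have hnR : (0 : ℝ) < n := by exact_mod_cast hn
  set A := {q : Fin n → ℤ | ∃ p : ℤ, |(∑ i, y i * (q i : ℝ)) + (p : ℝ)| ≤
        (∏ i, max |(q i : ℝ)| 1) ^ (-(v / n))} with hAdef
  obtain ⟨δ, hδ, hvδ⟩ : ∃ δ > 0, v / n = 1 + (n + 1) * δ :=
    ⟨(v / n - 1) / (n + 1), div_pos (sub_pos.2 ((one_lt_div hnR).2 hv)) (by positivity),
      by field_simp; ring⟩
  set γ := δ / (1 + n * δ) with hγ
  have hγ0 : 0 < γ := by positivity
  obtain ⟨m, hm⟩ := exists_nat_one_div_lt hγ0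
  refine ⟨m, ?_⟩
  set Pi : (Fin n → ℤ) → ℝ := fun q => ∏ i, max |(q i : ℝ)| 1 with hPi
  have hPi1 : ∀ q, 1 ≤ Pi q := fun q => Finset.one_le_prod fun i _ => le_max_right _ _
  let τ : (Fin n → ℤ) → Fin n → ℕ := fun q i =>
    ⌈Real.logb 2 (max |(q i : ℝ)| 1 * Pi q ^ δ)⌉₊
  have hτ1 : ∀ q i, max |(q i : ℝ)| 1 * Pi q ^ δ ≤ 2 ^ τ q i := fun q i => by
    have hpos : 0 < max |(q i : ℝ)| 1 * Pi q ^ δ := by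
      have := hPi1 q
      positivity
    have h := Nat.le_ceil (Real.logb 2 (max |(q i : ℝ)| 1 * Pi q ^ δ))
    rw [Real.logb_le_iff_le_rpow one_lt_two hpos, Real.rpow_natCast] at h
    exact h
  have hτ2 : ∀ q i, (2 : ℝ) ^ τ q i ≤ 2 * (max |(q i : ℝ)| 1 * Pi q ^ δ) := fun q i => by
    have h1 : 1 ≤ max |(q i : ℝ)| 1 * Pi q ^ δ :=
      one_le_mul_of_one_le_of_one_le (le_max_right _ _) (Real.one_le_rpow (hPi1 q) hδ.le)
    have h := Nat.ceil_lt_add_one (Real.logb_nonneg one_lt_two h1)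
    have h2 : (2 : ℝ) ^ ((τ q i : ℕ) : ℝ) ≤
        2 ^ (Real.logb 2 (max |(q i : ℝ)| 1 * Pi q ^ δ) + 1) :=
      Real.rpow_le_rpow_of_exponent_le one_le_two h.le
    rw [Real.rpow_natCast, Real.rpow_add two_pos, Real.rpow_one,
      Real.rpow_logb two_pos (by norm_num) (by linarith)] at h2
    linarith
  have hτ3 : ∀ q i, |q i| ≤ 2 ^ τ q i := fun q i => by
    have h1 : |(q i : ℝ)| ≤ 2 ^ τ q i := by
      refine le_trans ?_ (hτ1 q i)
      refine (le_max_left _ 1).trans ?_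
      exact le_mul_of_one_le_right (by positivity) (Real.one_le_rpow (hPi1 q) hδ.le)
    exact_mod_cast h1
  have hτ4 : ∀ q, (2 : ℝ) ^ (∑ i, τ q i) ≤ 2 ^ n * Pi q ^ (1 + n * δ) := fun q => by
    have := hPi1 q
    rw [← Finset.prod_pow_eq_pow_sum]
    refine (Finset.prod_le_prod (fun i _ => by positivity) fun i _ => hτ2 q i).trans_eq ?_
    rw [Finset.prod_mul_distrib, Finset.prod_mul_distrib, Finset.prod_const, Finset.prod_const,
      Finset.card_univ, Fintype.card_fin, Real.rpow_add (by linarith), Real.rpow_one,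
      mul_comm (n : ℝ) δ, Real.rpow_mul (by linarith), Real.rpow_natCast]
  have hsmall : ∀ q ∈ A, q ≠ 0 →
      SmallVec (τ q) y (2 ^ n * (2 ^ n) ^ γ * (2 : ℝ) ^ (-(γ * (∑ i, τ q i : ℕ))) * 2) := by
    rintro q ⟨p, hp⟩ hq0
    have hP1 := hPi1 q
    have hP0 : 0 < Pi q := by linarith
    refine ⟨Fin.cons p q, fun h0 => hq0 ?_, ?_⟩
    · ext i
      have := congrFun h0 i.succ
      simpa using this
    have hb : ‖flow (τ q) y fun i => (((Fin.cons p q : Fin (n + 1) → ℤ) i : ℤ) : ℝ)‖ ≤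
        2 ^ n * Pi q ^ (-δ) := by
      rw [pi_norm_le_iff_of_nonneg (by positivity)]
      intro i
      refine Fin.cases ?_ (fun i => ?_) i
      · rw [flow_zero, Real.norm_eq_abs, abs_mul, abs_of_pos (by positivity)]
        simp only [Fin.cons_zero, Fin.cons_succ]
        rw [add_comm]
        calc _ ≤ (2 ^ n * Pi q ^ (1 + n * δ)) * Pi q ^ (-(v / n)) :=
              mul_le_mul (hτ4 q) hp (abs_nonneg _) (by positivity)
          _ = _ := by
              rw [mul_assoc, ← Real.rpow_add hP0, hvδ]
              congr 2; ring
      · rw [flow_succ, Real.norm_eq_abs, abs_div, abs_of_pos (by positivity : (0 : ℝ) < 2 ^ τ q i),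
          div_le_iff₀ (by positivity)]
        simp only [Fin.cons_succ]
        calc |(q i : ℝ)| ≤ max |(q i : ℝ)| 1 := le_max_left _ _
          _ = 1 * Pi q ^ (-δ) * (max |(q i : ℝ)| 1 * Pi q ^ δ) := by
              rw [Real.rpow_neg hP0.le]; field_simp
          _ ≤ 2 ^ n * Pi q ^ (-δ) * 2 ^ τ q i := by
              gcongr
              · exact one_le_pow₀ one_le_two
              · exact hτ1 q i
    have hb2 : Pi q ^ (-δ) ≤ (2 ^ n) ^ γ * (2 : ℝ) ^ (-(γ * (∑ i, τ q i : ℕ))) := by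
      have h1 := Real.rpow_le_rpow (by positivity) (hτ4 q) hγ0.le
      rw [Real.mul_rpow (by positivity) (by positivity), ← Real.rpow_mul hP0.le,
        ← Real.rpow_natCast, ← Real.rpow_mul two_pos.le] at h1
      have h2 : (1 + n * δ) * γ = δ := by rw [hγ]; field_simp
      rw [h2] at h1
      rw [Real.rpow_neg hP0.le, Real.rpow_neg two_pos.le, ← div_eq_mul_inv, inv_eq_one_div,
        div_le_div_iff₀ (by positivity) (by positivity), one_mul, mul_comm γ]
      exact h1
    calc _ ≤ 2 ^ n * Pi q ^ (-δ) := hb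
      _ ≤ 2 ^ n * ((2 ^ n) ^ γ * (2 : ℝ) ^ (-(γ * (∑ i, τ q i : ℕ)))) := by gcongr
      _ < _ := by
          rw [← mul_assoc]
          refine lt_mul_of_one_lt_right (by positivity) one_lt_two
  rw [Filter.frequently_cofinite_iff_infinite]
  intro hfin
  have hev := eventually_mul_two_rpow_lt (n := n) (C := 2 ^ n * (2 ^ n) ^ γ * 2)
    (sub_pos.2 hm) one_pos
  rw [Filter.eventually_cofinite] at hev
  have hF := hfin.union hev
  refine hA (Set.Finite.subset ((hF.biUnion fun T _ =>
    (Set.finite_Icc (fun i : Fin n => -(2 ^ T i : ℤ)) (fun i : Fin n => (2 ^ T i : ℤ)))).union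
      (Set.finite_singleton 0)) fun q hq => ?_)
  by_cases hq0 : q = 0
  · exact Or.inr hq0
  refine Or.inl (Set.mem_biUnion (x := τ q) ?_ ⟨fun i => (abs_le.1 (hτ3 q i)).1,
    fun i => (abs_le.1 (hτ3 q i)).2⟩)
  by_cases hbig : 2 ^ n * (2 ^ n) ^ γ * 2 *
      (2 : ℝ) ^ (-((γ - 1 / ((m : ℝ) + 1)) * (∑ i, τ q i : ℕ))) < 1
  · obtain ⟨w, hw, hwl⟩ := hsmall q hq hq0
    refine Or.inl ⟨w, hw, hwl.trans ?_⟩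
    have e : (2 : ℝ) ^ (-(γ * (∑ i, τ q i : ℕ))) =
        (2 : ℝ) ^ (-((γ - 1 / ((m : ℝ) + 1)) * (∑ i, τ q i : ℕ))) *
        (2 : ℝ) ^ (-(1 / ((m : ℝ) + 1) * (∑ i, τ q i : ℕ))) := by
      rw [← Real.rpow_add two_pos]; congr 1; ring
    rw [e]
    calc _ = (2 ^ n * (2 ^ n) ^ γ * 2 *
        (2 : ℝ) ^ (-((γ - 1 / ((m : ℝ) + 1)) * (∑ i, τ q i : ℕ)))) *
        (2 : ℝ) ^ (-(1 / ((m : ℝ) + 1) * (∑ i, τ q i : ℕ))) := by ring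
      _ < 1 * (2 : ℝ) ^ (-(1 / ((m : ℝ) + 1) * (∑ i, τ q i : ℕ))) := by gcongr
      _ = _ := one_mul _
  · exact Or.inr hbig

end Flow

section RationalSubspaces

variable {κ : Type*} {j : ℕ}

/-- `b` is a basis of `W` consisting of integer vectors. -/
def IsIntBasis (b : Fin j → κ → ℤ) (W : Submodule ℝ (κ → ℝ)) : Prop :=
  LinearIndependent ℝ (fun i l => (b i l : ℝ)) ∧
    Submodule.span ℝ (Set.range fun i l => (b i l : ℝ)) = W

/-- `W` is spanned by linearly independent integer vectors. -/
def IsRational (W : Submodule ℝ (κ → ℝ)) : Prop :=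
  ∃ (j : ℕ) (b : Fin j → κ → ℤ), IsIntBasis b W

theorem IsIntBasis.finrank_eq {b : Fin j → κ → ℤ} {W : Submodule ℝ (κ → ℝ)}
    (h : IsIntBasis b W) : Module.finrank ℝ W = j := by
  rw [← h.2, finrank_span_eq_card h.1, Fintype.card_fin]

theorem IsIntBasis.cons {b : Fin j → κ → ℤ} {W : Submodule ℝ (κ → ℝ)} (h : IsIntBasis b W)
    {v : κ → ℤ} (hv : (fun l => (v l : ℝ)) ∉ W) :
    IsIntBasis (Fin.cons v b : Fin (j + 1) → κ → ℤ)
      (W ⊔ Submodule.span ℝ {fun l => (v l : ℝ)}) := by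
  have e : (fun i l => (((Fin.cons v b : Fin (j + 1) → κ → ℤ) i l : ℤ) : ℝ)) =
      Fin.cons (fun l => (v l : ℝ)) (fun i l => (b i l : ℝ)) := by
    ext i l
    refine Fin.cases ?_ (fun i => ?_) i <;> simp
  refine ⟨?_, ?_⟩
  · rw [e, linearIndependent_finCons, h.2]
    exact ⟨h.1, hv⟩
  · rw [e, Fin.range_cons, Set.insert_eq, Submodule.span_union, h.2, sup_comm]

variable [Fintype κ]

theorem IsRational.exists_min {W : Submodule ℝ (κ → ℝ)} (hW : IsRational W) :
    ∃ b : Fin (Module.finrank ℝ W) → κ → ℤ, IsIntBasis b W ∧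
      ∀ b' : Fin (Module.finrank ℝ W) → κ → ℤ, IsIntBasis b' W →
        minorNorm (fun i l => (b i l : ℝ)) ≤ minorNorm fun i l => (b' i l : ℝ) := by
  obtain ⟨j, b0, hb0⟩ := hW
  obtain rfl := hb0.finrank_eq
  choose N hN using fun b : Fin (Module.finrank ℝ W) → κ → ℤ => exists_nat_eq_minorNorm b
  obtain ⟨b, hb, hmin⟩ := WellFounded.has_min (measure N).wf
    {b : Fin (Module.finrank ℝ W) → κ → ℤ | IsIntBasis b W} ⟨b0, hb0⟩
  refine ⟨b, hb, fun b' hb' => ?_⟩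
  rw [hN, hN]
  exact_mod_cast not_lt.1 (hmin b' hb')

open Classical in
/-- An integer basis of the rational subspace `W` of minimal covolume. -/
noncomputable def minBasis (W : Submodule ℝ (κ → ℝ)) : Fin (Module.finrank ℝ W) → κ → ℤ :=
  if h : IsRational W then h.exists_min.choose else 0

theorem IsRational.minBasis {W : Submodule ℝ (κ → ℝ)} (h : IsRational W) :
    IsIntBasis (minBasis W) W := by
  rw [_root_.minBasis, dif_pos h]
  exact h.exists_min.choose_spec.1

theorem IsRational.minorNorm_minBasis_le {W : Submodule ℝ (κ → ℝ)} (h : IsRational W)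
    {b : Fin (Module.finrank ℝ W) → κ → ℤ} (hb : IsIntBasis b W) :
    minorNorm (fun i l => (_root_.minBasis W i l : ℝ)) ≤ minorNorm fun i l => (b i l : ℝ) := by
  rw [_root_.minBasis, dif_pos h]
  exact h.exists_min.choose_spec.2 b hb

/-- The covolume of the image under `H` of the integer points of the rational subspace `W`. -/
noncomputable def covol (H : (κ → ℝ) →ₗ[ℝ] (κ → ℝ)) (W : Submodule ℝ (κ → ℝ)) : ℝ :=
  minorNorm fun i => H fun l => (minBasis W i l : ℝ)

theorem covol_le (H : (κ → ℝ) →ₗ[ℝ] (κ → ℝ)) {W : Submodule ℝ (κ → ℝ)} {b : Fin j → κ → ℤ}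
    (hb : IsIntBasis b W) : covol H W ≤ minorNorm fun i => H fun l => (b i l : ℝ) := by
  obtain rfl := hb.finrank_eq
  have hW : IsRational W := ⟨_, b, hb⟩
  have hm := hW.minBasis
  have hmem : ∀ i, (fun l => (b i l : ℝ)) ∈
      Submodule.span ℝ (Set.range fun i l => (minBasis W i l : ℝ)) := fun i => by
    rw [hm.2, ← hb.2]
    exact Submodule.subset_span ⟨i, rfl⟩
  choose A hA using fun i => (Submodule.mem_span_range_iff_exists_fun ℝ).1 (hmem i)
  have e1 : (fun i l => (b i l : ℝ)) =
      fun i l => ∑ i', Matrix.of A i i' * (minBasis W i' l : ℝ) := by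
    ext i l
    rw [← congrFun (hA i) l]
    simp
  have e2 : (fun i => H fun l => (b i l : ℝ)) = fun i l => ∑ i', Matrix.of A i i' *
      (H fun l => (minBasis W i' l : ℝ)) l := by
    ext i l
    rw [← hA i, map_sum]
    simp
  have h1 := hW.minorNorm_minBasis_le hb
  rw [e1, minorNorm_mul] at h1
  have hpos := (linearIndependent_iff_minorNorm_pos _).1 hm.1
  have hdet : 1 ≤ |(Matrix.of A).det| := by
    by_contra! hlt
    nlinarith
  rw [e2, minorNorm_mul]
  exact le_mul_of_one_le_left (minorNorm_nonneg _) hdet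

theorem finite_setOf_covol_lt {H : (κ → ℝ) →ₗ[ℝ] (κ → ℝ)} (hH : Function.Injective H) (ρ : ℝ) :
    {W : Submodule ℝ (κ → ℝ) | IsRational W ∧ covol H W < ρ}.Finite := by
  let e := LinearEquiv.ofInjectiveEndo H hH
  choose C hC hle using fun j => minorNorm_linearMap_le (e.symm : (κ → ℝ) →ₗ[ℝ] (κ → ℝ)) j
  have hcard : ∀ W : Submodule ℝ (κ → ℝ), Module.finrank ℝ W ≤ Fintype.card κ := fun W => by
    simpa using Submodule.finrank_le W
  refine ((Finset.range (Fintype.card κ + 1)).finite_toSet.biUnion fun j _ =>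
    finite_setOf_span_minorNorm_le j κ (C j * ρ)).subset ?_
  rintro W ⟨hW, hlt⟩
  refine Set.mem_biUnion (x := Module.finrank ℝ W) (by
    simpa using Nat.lt_succ_of_le (hcard W)) ?_
  refine ⟨minBasis W, hW.minBasis.1, hW.minBasis.2, ?_⟩
  have := hle (Module.finrank ℝ W) fun i => H fun l => (minBasis W i l : ℝ)
  have e1 : (fun i => (e.symm : (κ → ℝ) →ₗ[ℝ] (κ → ℝ)) (H fun l => (minBasis W i l : ℝ))) =
      fun i l => (minBasis W i l : ℝ) := by
    ext1 i
    exact e.symm_apply_apply _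
  rw [e1] at this
  exact this.trans (mul_le_mul_of_nonneg_left hlt.le (hC _).le)

theorem exists_int_norm_le_covol [Nonempty κ] {H : (κ → ℝ) →ₗ[ℝ] (κ → ℝ)}
    (hH : Function.Injective H) {W : Submodule ℝ (κ → ℝ)} (hW : IsRational W) (h0 : W ≠ ⊥) :
    ∃ v : κ → ℤ, v ≠ 0 ∧ ‖H fun l => (v l : ℝ)‖ ≤
      2 * Module.finrank ℝ W * covol H W ^ ((Module.finrank ℝ W : ℝ)⁻¹) := by
  have hb := hW.minBasis
  have hpos : 0 < Module.finrank ℝ W := by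
    rw [Nat.pos_iff_ne_zero]
    exact fun h => h0 (Submodule.finrank_eq_zero.1 h)
  have hli : LinearIndependent ℝ fun i => H fun l => (minBasis W i l : ℝ) :=
    hb.1.map' H (LinearMap.ker_eq_bot.2 hH)
  obtain ⟨c, hc, hle⟩ := exists_int_combination_norm_le hpos hli
  have e : (∑ i, (c i : ℝ) • H fun l => (minBasis W i l : ℝ)) =
      H fun l => ((∑ i, c i * minBasis W i l : ℤ) : ℝ) := by
    simp_rw [← map_smul]
    rw [← map_sum]
    congr 1
    ext l
    simp
  refine ⟨fun l => ∑ i, c i * minBasis W i l, fun h => hc ?_, by rw [← e]; exact hle⟩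
  ext i
  have h1 := Fintype.linearIndependent_iff.1 hb.1 (fun i => (c i : ℝ)) (by
    ext l
    have := congrArg (fun z : ℤ => (z : ℝ)) (congrFun h l)
    simpa using this) i
  exact_mod_cast h1

theorem card_le_of_pairwise_lt {F : Finset (Submodule ℝ (κ → ℝ))}
    (hF : (F : Set (Submodule ℝ (κ → ℝ))).Pairwise fun V W => V < W ∨ W < V) :
    F.card ≤ Fintype.card κ + 1 := by
  have hcard : ∀ W : Submodule ℝ (κ → ℝ), Module.finrank ℝ W ≤ Fintype.card κ := fun W => by
    simpa using Submodule.finrank_le W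
  rw [← Finset.card_range (Fintype.card κ + 1)]
  refine Finset.card_le_card_of_injOn (fun W => Module.finrank ℝ W) (fun W _ => ?_) ?_
  · simpa using Nat.lt_succ_of_le (hcard W)
  · intro V hV W hW h
    by_contra hne
    rcases hF hV hW hne with h1 | h1
    · exact (Submodule.finrank_lt_finrank_of_lt h1).ne h
    · exact (Submodule.finrank_lt_finrank_of_lt h1).ne' h

/-- Lattices marked by a flag have no short vectors. -/
theorem le_norm_of_flag {H : (κ → ℝ) →ₗ[ℝ] (κ → ℝ)} {ε ρ : ℝ} (hερ : ε ≤ ρ) (hρ : ρ ≤ 1)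
    {F : Finset (Submodule ℝ (κ → ℝ))} (hFr : ∀ W ∈ F, IsRational W)
    (hF : (F : Set (Submodule ℝ (κ → ℝ))).Pairwise fun V W => V < W ∨ W < V)
    (hFε : ∀ W ∈ F, ε ≤ covol H W ∧ covol H W < ρ)
    (hmax : ∀ W, IsRational W → W ≠ ⊥ → (∀ V ∈ F, W < V ∨ V < W) → ρ ≤ covol H W)
    {v : κ → ℤ} (hv : v ≠ 0) : ε ≤ Fintype.card κ * ‖H fun l => (v l : ℝ)‖ := by
  classical
  set w : κ → ℝ := fun l => (v l : ℝ) with hw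
  have hw0 : w ≠ 0 := fun h => hv (by
    ext l
    have := congrFun h l
    simpa [hw] using this)
  have hcomp : ∀ V ∈ insert ⊥ F, ∀ W ∈ insert ⊥ F, V ≤ W ∨ W ≤ V := by
    intro V hV W hW
    rcases Finset.mem_insert.1 hV with rfl | hV
    · exact Or.inl bot_le
    rcases Finset.mem_insert.1 hW with rfl | hW
    · exact Or.inr bot_le
    by_cases h : V = W
    · exact Or.inl h.le
    · exact (hF hV hW h).imp le_of_lt le_of_lt
  obtain ⟨W, hW, hWmax⟩ := ((insert ⊥ F).filter (w ∉ ·)).exists_max_image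
    (fun W => Module.finrank ℝ W) ⟨⊥, by simp [hw0]⟩
  rw [Finset.mem_filter] at hW
  obtain ⟨hWF, hwW⟩ := hW
  set D := W ⊔ Submodule.span ℝ {w} with hD
  have hwD : w ∈ D := Submodule.mem_sup_right (Submodule.mem_span_singleton_self w)
  have hWD : W < D := lt_of_le_of_ne le_sup_left fun h => hwW (by rw [h]; exact hwD)
  have hWr : IsRational W := by
    rcases Finset.mem_insert.1 hWF with rfl | h
    · exact ⟨0, Fin.elim0, linearIndependent_empty_type, by simp⟩
    · exact hFr W h
  have hWc : covol H W ≤ 1 := by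
    rcases Finset.mem_insert.1 hWF with rfl | h
    · have hb : IsIntBasis (Fin.elim0 : Fin 0 → κ → ℤ) (⊥ : Submodule ℝ (κ → ℝ)) :=
        ⟨linearIndependent_empty_type, by simp⟩
      refine (covol_le H hb).trans (minorNorm_le zero_le_one fun σ => ?_)
      simp
    · exact (hFε W h).2.le.trans hρ
  have hDb := hWr.minBasis.cons hwW
  have hDr : IsRational D := ⟨_, _, hDb⟩
  have hDε : ε ≤ covol H D := by
    by_cases hDF : D ∈ F
    · exact (hFε D hDF).1
    refine hερ.trans (hmax D hDr (bot_le.trans_lt hWD).ne' fun V hV => ?_)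
    by_cases hwV : w ∈ V
    · left
      refine lt_of_le_of_ne (sup_le ?_ ?_) (fun h => hDF (h ▸ hV))
      · rcases hcomp W hWF V (Finset.mem_insert_of_mem hV) with h | h
        · exact h
        · exact absurd (h hwV) hwW
      · rwa [Submodule.span_singleton_le_iff_mem]
    · right
      refine lt_of_le_of_lt ?_ hWD
      have hVm := hWmax V (Finset.mem_filter.2 ⟨Finset.mem_insert_of_mem hV, hwV⟩)
      rcases hcomp W hWF V (Finset.mem_insert_of_mem hV) with h | h
      · exact (Submodule.eq_of_le_of_finrank_le h hVm).ge
      · exact h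
  have hfr := hDb.finrank_eq
  have hcard : Module.finrank ℝ D ≤ Fintype.card κ := by simpa using Submodule.finrank_le D
  have e : (fun i => H fun l => (((Fin.cons v (minBasis W) :
      Fin (Module.finrank ℝ W + 1) → κ → ℤ) i l : ℤ) : ℝ)) =
      Fin.cons (H w) (fun i => H fun l => (minBasis W i l : ℝ)) := by
    ext1 i
    refine Fin.cases ?_ (fun i => ?_) i <;> rfl
  have h1 := hDε.trans (covol_le H hDb)
  rw [e] at h1
  refine h1.trans ((minorNorm_cons_le _ _).trans ?_)
  have h2 : ((Module.finrank ℝ W : ℝ) + 1) ≤ Fintype.card κ := by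
    exact_mod_cast hfr ▸ hcard
  calc _ ≤ ((Module.finrank ℝ W : ℝ) + 1) * ‖H w‖ * 1 := by
        refine mul_le_mul_of_nonneg_left hWc (by positivity)
    _ ≤ _ := by rw [mul_one]; gcongr

end RationalSubspaces

/-- The minors of `flow T y` are affine functions of `y`. -/
theorem exists_affine_eq_det_flow {n j : ℕ} (T : Fin n → ℕ) (B : Fin j → Fin (n + 1) → ℝ)
    (σ : Fin j → Fin (n + 1)) : ∃ θ : (Fin n → ℝ) →ᵃ[ℝ] ℝ, ∀ y,
      (Matrix.of fun i k => flow T y (B i) (σ k)).det = θ y := by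
  classical
  by_cases h2 : ∃ k k', k ≠ k' ∧ σ k = 0 ∧ σ k' = 0
  · obtain ⟨k, k', hkk, hk, hk'⟩ := h2
    refine ⟨0, fun y => ?_⟩
    exact Matrix.det_zero_of_column_eq hkk fun i => by simp [hk, hk']
  by_cases h1 : ∃ k, σ k = 0
  · obtain ⟨k0, hk0⟩ := h1
    have huniq : ∀ k, k ≠ k0 → σ k ≠ 0 := fun k hk h => h2 ⟨k, k0, hk, h, hk0⟩
    let c : Fin j → Fin j → ℝ := fun k i => flow T 0 (B i) (σ k)
    let l : (Fin j → ℝ) →ₗ[ℝ] ℝ :=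
      (Matrix.detRowAlternating (n := Fin j) (R := ℝ)).toMultilinearMap.toLinearMap c k0
    let a : (Fin n → ℝ) →ₗ[ℝ] (Fin j → ℝ) := LinearMap.pi fun i =>
      (2 : ℝ) ^ (∑ i, T i) • ∑ m, B i m.succ • LinearMap.proj m
    refine ⟨(l.toAffineMap).comp (a.toAffineMap +
      AffineMap.const ℝ _ fun i => 2 ^ (∑ i, T i) * B i 0), fun y => ?_⟩
    rw [← Matrix.det_transpose]
    change _ = Matrix.det (Function.update c k0 _)
    congr 1
    ext k i
    by_cases hk : k = k0
    · subst hk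
      simp [hk0, a, mul_add, add_comm, mul_comm]
    · rw [Function.update_of_ne hk]
      obtain ⟨m, hm⟩ := Fin.exists_succ_eq.2 (huniq k hk)
      simp [c, ← hm]
  · push Not at h1
    refine ⟨AffineMap.const ℝ _ (Matrix.of fun i k => flow T 0 (B i) (σ k)).det, fun y => ?_⟩
    rw [AffineMap.const_apply]
    congr 1
    ext i k
    obtain ⟨m, hm⟩ := Fin.exists_succ_eq.2 (h1 k)
    simp [← hm]

section Curves

variable {s : ℕ}

/-- Uniform nondegeneracy of a curve on an interval: every nontrivial linear combination of the
coordinates has a derivative of bounded positive order which is comparable to a constant. -/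
def NondegCurve (G : ℝ → Fin s → ℝ) (c d : ℝ) : Prop :=
  ∃ (M : ℕ) (K : ℝ), ∀ b : Fin s → ℝ, b ≠ 0 → ∃ κ > 0, ∃ k, 1 ≤ k ∧ k ≤ M ∧
    ∀ t ∈ Set.Icc c d, κ ≤ |iteratedDeriv k (fun t => ∑ i, b i * G t i) t| ∧
      |iteratedDeriv k (fun t => ∑ i, b i * G t i) t| ≤ K * κ

theorem AffineMap.apply_eq_add_sum (α : (Fin s → ℝ) →ᵃ[ℝ] ℝ) (x : Fin s → ℝ) :
    α x = α 0 + ∑ i, α.linear (Pi.single i 1) * x i := by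
  have h1 : α x = α.linear x + α 0 := by
    have := α.map_vadd 0 x
    simpa using this
  rw [h1, add_comm, LinearMap.pi_apply_eq_sum_univ α.linear x]
  congr 1
  refine Finset.sum_congr rfl fun i _ => ?_
  rw [smul_eq_mul, mul_comm]
  congr 2
  ext j
  simp [Pi.single_apply, eq_comm]

variable {G : ℝ → Fin s → ℝ} {c d : ℝ}

theorem contDiff_const_add_sum (hG : ContDiff ℝ (⊤ : ℕ∞) G) (a : ℝ) (b : Fin s → ℝ) :
    ContDiff ℝ (⊤ : ℕ∞) fun t => a + ∑ i, b i * G t i :=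
  contDiff_const.add (ContDiff.sum fun i _ => contDiff_const.mul (contDiff_pi.1 hG i))

/-- Affine functions are uniformly good along a nondegenerate curve. -/
theorem NondegCurve.exists_good (hG : ContDiff ℝ (⊤ : ℕ∞) G) (h : NondegCurve G c d) :
    ∃ C : ℝ, 1 ≤ C ∧ ∃ M : ℕ, 0 < M ∧ ∀ (α : (Fin s → ℝ) →ᵃ[ℝ] ℝ) (c' d' : ℝ), c ≤ c' → d' ≤ d →
      ∀ ε ρ : ℝ, 0 < ε → ε ≤ ρ → (∃ x ∈ Set.Icc c' d', ρ ≤ |α (G x)|) →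
      volume {x ∈ Set.Icc c' d' | |α (G x)| < ε} ≤
        ENNReal.ofReal (C * (ε / ρ) ^ ((M : ℝ)⁻¹)) * volume (Set.Icc c' d') := by
  obtain ⟨M, K, hb⟩ := h
  obtain ⟨C, hC, hgood⟩ := _root_.exists_good (M + 1) K
  refine ⟨C, hC, M + 1, M.succ_pos, fun α c' d' hc hd ε ρ hε hερ hx => ?_⟩
  set b : Fin s → ℝ := fun i => α.linear (Pi.single i 1) with hbdef
  have hα : (fun t => α (G t)) = fun t => α 0 + ∑ i, b i * G t i := by
    funext t; exact AffineMap.apply_eq_add_sum α (G t)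
  by_cases hb0 : b = 0
  · have hconst : ∀ t, α (G t) = α 0 := fun t => by
      rw [AffineMap.apply_eq_add_sum α (G t)]
      simp [show ∀ i, α.linear (Pi.single i 1) = 0 from congrFun hb0]
    obtain ⟨x, _, hxρ⟩ := hx
    have : {x ∈ Set.Icc c' d' | |α (G x)| < ε} = ∅ := by
      refine Set.eq_empty_of_forall_notMem fun t ht => ?_
      have := ht.2
      rw [hconst] at this hxρ
      exact absurd (hερ.trans hxρ) (not_le.2 this)
    rw [this]
    simp
  · obtain ⟨κ, hκ, k, hk1, hkM, hk⟩ := hb b hb0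
    refine hgood (fun t => α (G t)) (by rw [hα]; exact contDiff_const_add_sum hG _ _) c' d' κ hκ
      ⟨k, hk1, hkM.trans (Nat.le_succ _), fun t ht => ?_⟩ ε ρ hε hερ hx
    rw [hα, iteratedDeriv_const_add hk1]
    exact hk t ⟨hc.trans ht.1, ht.2.trans hd⟩

/-- An affine function which is large somewhere on the unit ball is large somewhere on a
nondegenerate curve. -/
theorem NondegCurve.exists_le_abs (hcd : c < d) (hG : ContDiff ℝ (⊤ : ℕ∞) G)
    (h : NondegCurve G c d) : ∃ C : ℝ, 0 < C ∧ ∀ (α : (Fin s → ℝ) →ᵃ[ℝ] ℝ) (ρ : ℝ), 0 < ρ →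
      (∃ x, ‖x‖ ≤ 1 ∧ ρ ≤ |α x|) → ∃ t ∈ Set.Icc c d, C * ρ ≤ |α (G t)| := by
  let L : (ℝ × (Fin s → ℝ)) →ₗ[ℝ] C(Set.Icc c d, ℝ) :=
    { toFun := fun p => ⟨fun t => p.1 + ∑ i, p.2 i * G t i,
        ((contDiff_const_add_sum hG p.1 p.2).continuous).comp continuous_subtype_val⟩
      map_add' := fun p q => by
        ext t
        simp [add_mul, Finset.sum_add_distrib]; ring
      map_smul' := fun r p => by
        ext t
        simp [mul_add, Finset.mul_sum, mul_assoc] }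
  have hL : LinearMap.ker L = ⊥ := by
    rw [LinearMap.ker_eq_bot']
    rintro ⟨a, b⟩ hab
    have hz : ∀ t ∈ Set.Icc c d, a + ∑ i, b i * G t i = 0 := fun t ht =>
      congrArg (fun f : C(Set.Icc c d, ℝ) => f ⟨t, ht⟩) hab
    have hb : b = 0 := by
      by_contra hb
      obtain ⟨M, K, hb'⟩ := h
      obtain ⟨κ, hκ, k, hk1, _, hk⟩ := hb' b hb
      have hmid : (c + d) / 2 ∈ Set.Ioo c d := ⟨by linarith, by linarith⟩
      have h1 := (hk _ (Set.Ioo_subset_Icc_self hmid)).1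
      rw [← iteratedDeriv_const_add hk1 a] at h1
      have h2 : (fun t => a + ∑ i, b i * G t i) =ᶠ[nhds ((c + d) / 2)] fun _ => 0 := by
        filter_upwards [Ioo_mem_nhds hmid.1 hmid.2] with t ht
        exact hz t (Set.Ioo_subset_Icc_self ht)
      rw [h2.iteratedDeriv_eq, iteratedDeriv_const] at h1
      simp [Nat.one_le_iff_ne_zero.1 hk1] at h1
      linarith
    have := hz c (Set.left_mem_Icc.2 hcd.le)
    simp only [hb, Pi.zero_apply, zero_mul, Finset.sum_const_zero, add_zero] at this
    rw [this, hb]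
    rfl
  obtain ⟨K, hK, hanti⟩ := L.exists_antilipschitzWith hL
  have hK0 : (0 : ℝ) < K := hK
  refine ⟨1 / ((s + 1) * K), by positivity, ?_⟩
  rintro α ρ hρ ⟨x, hx, hxρ⟩
  by_contra! hcon
  set b : Fin s → ℝ := fun i => α.linear (Pi.single i 1) with hbdef
  have h1 : ‖L (α 0, b)‖ < 1 / ((s + 1) * K) * ρ := by
    rw [ContinuousMap.norm_lt_iff _ (by positivity)]
    intro t
    have := hcon t t.2
    rw [AffineMap.apply_eq_add_sum α] at this
    exact this
  have h2 : ‖(α 0, b)‖ ≤ K * ‖L (α 0, b)‖ := by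
    have := hanti.le_mul_dist (α 0, b) 0
    simpa using this
  have h3 : |α x| ≤ (s + 1) * ‖(α 0, b)‖ := by
    rw [AffineMap.apply_eq_add_sum α]
    have e1 : |α 0| ≤ ‖(α 0, b)‖ := norm_fst_le (α 0, b)
    have e2 : ∀ i, |b i * x i| ≤ ‖(α 0, b)‖ := fun i => by
      rw [abs_mul]
      have h4 : |b i| ≤ ‖(α 0, b)‖ := (norm_le_pi_norm b i).trans (norm_snd_le (α 0, b))
      have h5 : |x i| ≤ 1 := (norm_le_pi_norm x i).trans hx
      calc _ ≤ ‖(α 0, b)‖ * 1 := mul_le_mul h4 h5 (abs_nonneg _) (norm_nonneg _)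
        _ = _ := mul_one _
    calc _ ≤ |α 0| + ∑ i, |b i * x i| :=
          (abs_add_le _ _).trans (add_le_add le_rfl (Finset.abs_sum_le_sum_abs _ _))
      _ ≤ ‖(α 0, b)‖ + ∑ i : Fin s, ‖(α 0, b)‖ :=
          add_le_add e1 (Finset.sum_le_sum fun i _ => e2 i)
      _ = _ := by simp; ring
  have h6 : K * ‖L (α 0, b)‖ < K * (1 / ((s + 1) * K) * ρ) := by gcongr
  have h7 : (s + 1 : ℝ) * (K * (1 / ((s + 1) * K) * ρ)) = ρ := by field_simp
  have h8 : (s + 1 : ℝ) * ‖(α 0, b)‖ < ρ := by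
    rw [← h7]
    have := h2.trans_lt h6
    gcongr
  linarith

end Curves

theorem tsum_two_rpow_sum_ne_top {n : ℕ} {α : ℝ} (hα : 0 < α) (C : ℝ) :
    ∑' T : Fin n → ℕ, ENNReal.ofReal (C * (2 : ℝ) ^ (-(α * (∑ i, T i : ℕ)))) ≠ ⊤ := by
  have hr : (2 : ℝ) ^ (-α) < 1 := Real.rpow_lt_one_of_one_lt_of_neg one_lt_two (by linarith)
  have e : (fun T : Fin n → ℕ => (2 : ℝ) ^ (-(α * (∑ i, T i : ℕ)))) =
      fun T => ∏ i, ((2 : ℝ) ^ (-α)) ^ T i := by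
    funext T
    rw [Finset.prod_pow_eq_pow_sum, ← Real.rpow_natCast, ← Real.rpow_mul two_pos.le]
    congr 1; ring
  have hs : Summable fun T : Fin n → ℕ => (2 : ℝ) ^ (-(α * (∑ i, T i : ℕ))) := by
    rw [e]
    refine summable_of_sum_le (c := (1 - (2 : ℝ) ^ (-α))⁻¹ ^ n) (fun T => by positivity) fun u => ?_
    obtain ⟨N, hN⟩ : ∃ N, ∀ T ∈ u, ∀ i, T i < N := by
      obtain ⟨B, hB⟩ := u.bddAbove
      refine ⟨∑ i, B i + 1, fun T hT i => Nat.lt_succ_of_le ?_⟩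
      exact (hB hT i).trans (Finset.single_le_sum (f := B) (fun i _ => Nat.zero_le _)
        (Finset.mem_univ i))
    calc _ ≤ ∑ T ∈ Fintype.piFinset (fun _ : Fin n => Finset.range N),
          ∏ i, ((2 : ℝ) ^ (-α)) ^ T i := by
          refine Finset.sum_le_sum_of_subset_of_nonneg (fun T hT => ?_) fun T _ _ => by positivity
          simpa using hN T hT
      _ = ∏ i : Fin n, ∑ k ∈ Finset.range N, ((2 : ℝ) ^ (-α)) ^ k :=
          (Finset.prod_univ_sum _ _).symm
      _ ≤ ∏ i : Fin n, (1 - (2 : ℝ) ^ (-α))⁻¹ := by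
          refine Finset.prod_le_prod (fun i _ => by positivity) fun i _ => ?_
          rw [← tsum_geometric_of_lt_one (by positivity) hr]
          exact (summable_geometric_of_lt_one (by positivity) hr).sum_le_tsum _
            fun k _ => by positivity
      _ = _ := by simp
  have := hs.mul_left |C|
  refine ne_top_of_le_ne_top this.tsum_ofReal_ne_top (ENNReal.tsum_le_tsum fun T => ?_)
  exact ENNReal.ofReal_le_ofReal (by gcongr; exact le_abs_self C)

/-- No rational subspace is contracted too fast at all points of the subspace parametrized by
`h`. -/
def Nondivergent {n s : ℕ} (h : (Fin s → ℝ) →ᵃ[ℝ] (Fin n → ℝ)) : Prop :=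
  ∀ β : ℝ, 0 < β → ∀ᶠ T : Fin n → ℕ in Filter.cofinite, ∀ W : Submodule ℝ (Fin (n + 1) → ℝ),
    IsRational W → W ≠ ⊥ → ∃ x, ‖x‖ ≤ 1 ∧
      (2 : ℝ) ^ (-(β * (∑ i, T i : ℕ))) ≤ covol (flow T (h x)) W

theorem volume_frequently_smallVec_eq_zero {n s : ℕ} {h : (Fin s → ℝ) →ᵃ[ℝ] (Fin n → ℝ)}
    (hh : Nondivergent h) {G : ℝ → Fin s → ℝ} (hG : ContDiff ℝ (⊤ : ℕ∞) G) {c d : ℝ} (hcd : c < d)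
    (hnd : NondegCurve G c d) {γ : ℝ} (hγ : 0 < γ) :
    volume {t ∈ Set.Icc c d | ∃ᶠ T in Filter.cofinite,
      SmallVec T (h (G t)) ((2 : ℝ) ^ (-(γ * (∑ i, T i : ℕ))))} = 0 := by
  obtain ⟨N, τ, hτ, hN⟩ := HasBesicovitchCovering.no_satelliteConfig (α := ℝ)
  obtain ⟨C, hC, M, hM, hgood⟩ := hnd.exists_good hG
  obtain ⟨c₁, hc₁, hlarge⟩ := hnd.exists_le_abs hcd hG
  set c₀ := min c₁ 1 with hc₀
  have hc₀0 : 0 < c₀ := lt_min hc₁ one_pos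
  have hγ2 : 0 < γ / 2 := half_pos hγ
  have hev1 := hh (γ / 2) hγ2
  have hev2 := eventually_mul_two_rpow_lt (n := n) (C := (n + 1) / c₀) hγ2 one_pos
  let good : (Fin n → ℕ) → Prop := fun T =>
    (∀ W : Submodule ℝ (Fin (n + 1) → ℝ), IsRational W → W ≠ ⊥ → ∃ x, ‖x‖ ≤ 1 ∧
      (2 : ℝ) ^ (-(γ / 2 * (∑ i, T i : ℕ))) ≤ covol (flow T (h x)) W) ∧
    (n + 1) / c₀ * (2 : ℝ) ^ (-(γ / 2 * (∑ i, T i : ℕ))) < 1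
  have hgoodev : ∀ᶠ T in Filter.cofinite, good T := hev1.and hev2
  let A : (Fin n → ℕ) → Set ℝ := fun T => {t ∈ Set.Icc c d | good T ∧
    SmallVec T (h (G t)) ((2 : ℝ) ^ (-(γ * (∑ i, T i : ℕ))))}
  have hM0 : (0 : ℝ) < M := by exact_mod_cast hM
  let D : ℝ := (((n + 2) * (N + 1) ^ (n + 2) : ℕ) : ℝ) *
    (C * ((n + 1) / c₀) ^ ((M : ℝ)⁻¹)) * (d - c)
  have hA : ∀ T, volume (A T) ≤
      ENNReal.ofReal (D * (2 : ℝ) ^ (-(γ / 2 * (M : ℝ)⁻¹ * (∑ i, T i : ℕ)))) := by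
    intro T
    by_cases hT : good T
    swap
    · have : A T = ∅ := Set.eq_empty_of_forall_notMem fun t ht => hT ht.2.1
      rw [this]; simp
    obtain ⟨hT1, hT2⟩ := hT
    set m : ℕ := ∑ i, T i with hm
    set ρ : ℝ := c₀ * (2 : ℝ) ^ (-(γ / 2 * m)) with hρ
    set ε : ℝ := (n + 1) * (2 : ℝ) ^ (-(γ * m)) with hε
    have hρ0 : 0 < ρ := by positivity
    have hε0 : 0 < ε := by positivity
    have hεeq : ε / ρ = (n + 1) / c₀ * (2 : ℝ) ^ (-(γ / 2 * m)) := by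
      have : (2 : ℝ) ^ (-(γ * m)) = (2 : ℝ) ^ (-(γ / 2 * m)) * (2 : ℝ) ^ (-(γ / 2 * m)) := by
        rw [← Real.rpow_add two_pos]; congr 1; ring
      rw [hε, hρ, this]
      field_simp
    have hερ : ε ≤ ρ := by
      rw [← div_le_one hρ0, hεeq]; exact hT2.le
    have hρ1 : ρ ≤ 1 := by
      have h1 : (2 : ℝ) ^ (-(γ / 2 * m)) ≤ 1 :=
        Real.rpow_le_one_of_one_le_of_nonpos one_le_two (by
          have : 0 ≤ γ / 2 * m := by positivity
          linarith)
      calc ρ ≤ 1 * 1 := mul_le_mul (min_le_right _ _) h1 (by positivity) zero_le_one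
        _ = 1 := one_mul 1
    choose θ hθ using fun (j : ℕ) (B : Fin j → Fin (n + 1) → ℝ) (σ : Fin j → Fin (n + 1)) =>
      exists_affine_eq_det_flow T B σ
    let bas : (W : Submodule ℝ (Fin (n + 1) → ℝ)) → Fin (Module.finrank ℝ W) → Fin (n + 1) → ℝ :=
      fun W i l => (minBasis W i l : ℝ)
    let α : (W : Submodule ℝ (Fin (n + 1) → ℝ)) → (Fin (Module.finrank ℝ W) → Fin (n + 1)) →
        ((Fin s → ℝ) →ᵃ[ℝ] ℝ) := fun W σ => (θ _ (bas W) σ).comp h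
    have hα : ∀ W σ x, (Matrix.of fun i k => flow T (h x) (bas W i) (σ k)).det = α W σ x :=
      fun W σ x => hθ _ _ _ _
    let ψ : Submodule ℝ (Fin (n + 1) → ℝ) → ℝ → ℝ := fun W t => covol (flow T (h (G t))) W
    have hle : ∀ W σ x, |α W σ x| ≤ covol (flow T (h x)) W := fun W σ x => by
      rw [← hα]
      exact abs_det_le_minorNorm (fun i => flow T (h x) (bas W i)) σ
    have hex : ∀ W x, ∃ σ, |α W σ x| = covol (flow T (h x)) W := fun W x => by
      obtain ⟨σ, hσ⟩ := exists_abs_det_eq_minorNorm (fun i => flow T (h x) (bas W i))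
      exact ⟨σ, by rw [← hα]; exact hσ⟩
    have hmain := volume_not_marked_le hτ hN
      (R := fun V W : Submodule ℝ (Fin (n + 1) → ℝ) => V < W ∨ W < V)
      (fun _ _ => Or.symm) (fun V hV => hV.elim (lt_irrefl _) (lt_irrefl _)) (ψ := ψ) (ε := ε)
      (ρ := ρ) (δ := ENNReal.ofReal (C * (ε / ρ) ^ ((M : ℝ)⁻¹))) (n + 2)
      {W | IsRational W ∧ W ≠ ⊥} c d
      (fun F _ hF => by simpa using card_le_of_pairwise_lt hF)
      (fun W _ => by
        refine Continuous.continuousOn ?_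
        refine continuous_norm.comp (continuous_pi fun σ => ?_)
        have h2 := (AffineMap.continuous_of_finiteDimensional (α W σ)).comp hG.continuous
        convert h2 using 2 with t
        exact hα W σ (G t))
      (fun W hW => by
        obtain ⟨x, hx, hxl⟩ := hT1 W hW.1 hW.2
        obtain ⟨σ, hσ⟩ := hex W x
        obtain ⟨t, ht, htl⟩ := hlarge (α W σ)
          ((2 : ℝ) ^ (-(γ / 2 * m))) (by positivity) ⟨x, hx, by rw [hσ]; exact hxl⟩
        refine ⟨t, ht, le_trans ?_ (htl.trans (hle W σ (G t)))⟩
        exact mul_le_mul_of_nonneg_right (min_le_left _ _) (by positivity))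
      (fun t _ => (finite_setOf_covol_lt (flow_injective T (h (G t))) ρ).subset
        fun W hW => ⟨hW.1.1, hW.2⟩)
      (fun W _ c' d' hc' hd' hx => by
        obtain ⟨x, hx, hxρ⟩ := hx
        obtain ⟨σ, hσ⟩ := hex W (G x)
        refine le_trans (measure_mono ?_) (hgood (α W σ) c' d' hc' hd' ε ρ hε0 hερ
          ⟨x, hx, by rw [hσ]; exact hxρ⟩)
        exact fun t ht => ⟨ht.1, (hle W σ (G t)).trans_lt ht.2⟩)
    have hsub : A T ⊆ {t ∈ Set.Icc c d | ¬ Marked (fun V W : Submodule ℝ (Fin (n + 1) → ℝ) =>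
        V < W ∨ W < V) ψ ε ρ {W | IsRational W ∧ W ≠ ⊥} t} := by
      rintro t ⟨ht, -, v, hv, hvl⟩
      refine ⟨ht, ?_⟩
      rintro ⟨F, hFP, hF, hFε, hmax⟩
      have := le_norm_of_flag hερ hρ1 (fun W hW => (hFP hW).1) hF hFε
        (fun W hW hW0 hWF => hmax W ⟨hW, hW0⟩ hWF) hv
      rw [Fintype.card_fin, hε] at this
      push_cast at this
      exact absurd (le_of_mul_le_mul_left this (by positivity)) (not_le.2 hvl)
    refine (measure_mono hsub).trans (hmain.trans_eq ?_)
    rw [Real.volume_Icc, hεeq, ← ENNReal.ofReal_natCast,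
      ← ENNReal.ofReal_mul (by positivity), ← ENNReal.ofReal_mul (by positivity)]
    congr 1
    rw [Real.mul_rpow (by positivity) (by positivity), ← Real.rpow_mul two_pos.le]
    have e : -(γ / 2 * (m : ℝ)) * (M : ℝ)⁻¹ = -(γ / 2 * (M : ℝ)⁻¹ * m) := by ring
    rw [e]
    simp only [D]
    push_cast
    ring
  have hlim : volume (Filter.limsup A Filter.cofinite) = 0 :=
    measure_limsup_cofinite_eq_zero (ne_top_of_le_ne_top
      (tsum_two_rpow_sum_ne_top (α := γ / 2 * (M : ℝ)⁻¹) (by positivity) D)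
      (ENNReal.tsum_le_tsum hA))
  refine measure_mono_null ?_ hlim
  rintro t ⟨ht, htf⟩
  rw [Filter.mem_limsup_iff_frequently_mem]
  exact (htf.and_eventually hgoodev).mono fun T hT => ⟨ht, hT.2, hT.1⟩

/-- If some rational subspaces are contracted too fast at all points of the subspace parametrized
by `h`, then all these points are very well multiplicatively approximable. -/
theorem isVWMA_of_not_nondivergent {n s : ℕ} {h : (Fin s → ℝ) →ᵃ[ℝ] (Fin n → ℝ)}
    (hh : ¬ Nondivergent h) (z : Fin s → ℝ) : IsVWMA (h z) := by
  unfold Nondivergent at hh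
  push Not at hh
  obtain ⟨β, hβ, hT⟩ := hh
  set A : ℝ := 1 + 2 * ‖z‖ with hA
  have hA1 : 1 ≤ A := by linarith [norm_nonneg z]
  refine isVWMA_of_frequently_smallVec (γ := β / (n + 1)) (C := 2 * (n + 1) * A + 1)
    (by positivity) (hT.mono ?_)
  rintro T ⟨W, hW, hW0, hsmall⟩
  set e : ℝ := (2 : ℝ) ^ (-(β * (∑ i, T i : ℕ))) with he
  have he0 : 0 < e := by positivity
  have he1 : e ≤ 1 := Real.rpow_le_one_of_one_le_of_nonpos one_le_two
    (neg_nonpos.2 (by positivity))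
  have hcov : covol (flow T (h z)) W ≤ A * e := by
    refine minorNorm_le (by positivity) fun σ => ?_
    obtain ⟨θ, hθ⟩ := exists_affine_eq_det_flow T (fun i l => (minBasis W i l : ℝ)) σ
    have hle : ∀ x, ‖x‖ ≤ 1 → |θ (h x)| ≤ e := fun x hx => by
      rw [← hθ]
      exact (abs_det_le_minorNorm _ σ).trans (hsmall x hx).le
    rw [hθ]
    rcases le_or_gt ‖z‖ 1 with hz | hz
    · exact (hle z hz).trans (le_mul_of_one_le_left he0.le hA1)
    have hz0 : 0 < ‖z‖ := one_pos.trans hz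
    have hline : z = AffineMap.lineMap (0 : Fin s → ℝ) (‖z‖⁻¹ • z) ‖z‖ := by
      rw [AffineMap.lineMap_apply]
      simp [smul_smul, mul_inv_cancel₀ hz0.ne']
    have h1 := hle 0 (by simp)
    have h2 := hle (‖z‖⁻¹ • z) (by rw [norm_smul, norm_inv, norm_norm, inv_mul_cancel₀ hz0.ne'])
    rw [hline, AffineMap.apply_lineMap, AffineMap.apply_lineMap, AffineMap.lineMap_apply]
    simp only [vsub_eq_sub, smul_eq_mul, vadd_eq_add]
    generalize θ (h 0) = a at *
    generalize θ (h (‖z‖⁻¹ • z)) = b at *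
    have h3 : |b - a| ≤ 2 * e := by linarith [abs_sub b a]
    calc |‖z‖ * (b - a) + a| ≤ ‖z‖ * |b - a| + |a| := by
          refine (abs_add_le _ _).trans ?_
          rw [abs_mul, abs_norm]
      _ ≤ ‖z‖ * (2 * e) + e := by gcongr
      _ = A * e := by rw [hA]; ring
  obtain ⟨v, hv0, hv⟩ := exists_int_norm_le_covol (flow_injective T (h z)) hW hW0
  refine ⟨v, hv0, hv.trans_lt ?_⟩
  set j := Module.finrank ℝ W with hj
  have hj0 : 0 < j := Nat.pos_of_ne_zero fun h => hW0 (Submodule.finrank_eq_zero.1 h)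
  have hjn : j ≤ n + 1 := by simpa using Submodule.finrank_le W
  have hjn' : (j : ℝ) ≤ n + 1 := by exact_mod_cast hjn
  have hj1 : (1 : ℝ) ≤ j := by exact_mod_cast hj0
  have hjinv : (j : ℝ)⁻¹ ≤ 1 := inv_le_one_of_one_le₀ hj1
  have key : covol (flow T (h z)) W ^ ((j : ℝ)⁻¹) ≤
      A * (2 : ℝ) ^ (-(β / (n + 1) * (∑ i, T i : ℕ))) := by
    calc _ ≤ (A * e) ^ ((j : ℝ)⁻¹) :=
          Real.rpow_le_rpow (minorNorm_nonneg _) hcov (by positivity)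
      _ = A ^ ((j : ℝ)⁻¹) * e ^ ((j : ℝ)⁻¹) := Real.mul_rpow (by positivity) he0.le
      _ ≤ A ^ (1 : ℝ) * e ^ (((n : ℝ) + 1)⁻¹) := by
          refine mul_le_mul (Real.rpow_le_rpow_of_exponent_le hA1 hjinv)
            (Real.rpow_le_rpow_of_exponent_ge he0 he1 ?_) (by positivity) (by positivity)
          gcongr
      _ = _ := by
          rw [Real.rpow_one, he, ← Real.rpow_mul two_pos.le]
          congr 2; ring
  set w : ℝ := (2 : ℝ) ^ (-(β / (n + 1) * (∑ i, T i : ℕ))) with hw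
  have hw0 : 0 < w := by positivity
  calc _ ≤ 2 * (n + 1 : ℝ) * (A * w) := by
        gcongr
        exact Real.rpow_nonneg (minorNorm_nonneg _) _
    _ < (2 * (n + 1) * A + 1) * w := by linarith

section IteratedDerivatives

variable {E F : Type*} [NormedAddCommGroup E] [NormedSpace ℝ E] [NormedAddCommGroup F]
  [NormedSpace ℝ F]

theorem ContDiff.iteratedFDeriv_comp_perm {φ : E → F} (hφ : ContDiff ℝ (⊤ : ℕ∞) φ) {m : ℕ}
    (σ : Equiv.Perm (Fin m)) (x : E) (v : Fin m → E) :
    iteratedFDeriv ℝ m φ x (v ∘ σ) = iteratedFDeriv ℝ m φ x v := by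
  have hswap : ∀ (m : ℕ) (i : Fin m) (x : E) (v : Fin (m + 1) → E),
      iteratedFDeriv ℝ (m + 1) φ x (v ∘ Equiv.swap i.castSucc i.succ) =
        iteratedFDeriv ℝ (m + 1) φ x v := by
    intro m
    induction m with
    | zero => exact fun i => i.elim0
    | succ m ih =>
      intro i x v
      have hd : Differentiable ℝ (iteratedFDeriv ℝ (m + 1) φ) :=
        hφ.differentiable_iteratedFDeriv (by exact_mod_cast ENat.natCast_lt_top _)
      have e : ∀ v : Fin (m + 2) → E, iteratedFDeriv ℝ (m + 2) φ x v =
          fderiv ℝ (fun y => iteratedFDeriv ℝ (m + 1) φ y (Fin.tail v)) x (v 0) := fun v => by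
        rw [iteratedFDeriv_succ_apply_left]
        have := ((ContinuousMultilinearMap.apply ℝ (fun _ : Fin (m + 1) => E) F
          (Fin.tail v)).hasFDerivAt.comp x (hd x).hasFDerivAt).fderiv
        exact (congrArg (fun f => f (v 0)) this).symm
      refine Fin.cases ?_ (fun i => ?_) i
      · have hd' : ContDiff ℝ (⊤ : ℕ∞) fun y => iteratedFDeriv ℝ m φ y (Fin.tail (Fin.tail v)) :=
          (ContinuousMultilinearMap.apply ℝ (fun _ : Fin m => E) F _).contDiff.comp
            (hφ.iteratedFDeriv_right (m := ((⊤ : ℕ∞) : WithTop ℕ∞)) le_rfl)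
        have hdm : Differentiable ℝ (iteratedFDeriv ℝ m φ) :=
          hφ.differentiable_iteratedFDeriv (by exact_mod_cast ENat.natCast_lt_top _)
        have e2 : ∀ w : Fin (m + 2) → E, Fin.tail (Fin.tail w) = Fin.tail (Fin.tail v) →
            iteratedFDeriv ℝ (m + 2) φ x w = fderiv ℝ (fderiv ℝ
              fun y => iteratedFDeriv ℝ m φ y (Fin.tail (Fin.tail v))) x (w 0) (w 1) := by
          intro w hw
          rw [e, ← hw]
          have : (fun y => iteratedFDeriv ℝ (m + 1) φ y (Fin.tail w)) = fun y => fderiv ℝ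
              (fun y => iteratedFDeriv ℝ m φ y (Fin.tail (Fin.tail w))) y (w 1) := by
            funext y
            rw [iteratedFDeriv_succ_apply_left]
            have := ((ContinuousMultilinearMap.apply ℝ (fun _ : Fin m => E) F
              (Fin.tail (Fin.tail w))).hasFDerivAt.comp y (hdm y).hasFDerivAt).fderiv
            exact (congrArg (fun f => f (w 1)) this).symm
          rw [this, hw]
          have h1 : DifferentiableAt ℝ (fderiv ℝ
              fun y => iteratedFDeriv ℝ m φ y (Fin.tail (Fin.tail v))) x :=
            (hd'.fderiv_right (m := 1)
              (WithTop.coe_le_coe.2 (le_top : (1 + 1 : ℕ∞) ≤ ⊤))).differentiable one_ne_zero x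
          rw [fderiv_clm_apply h1 (by fun_prop)]
          simp
        have hsym := hd'.contDiffAt (x := x) |>.isSymmSndFDerivAt
          (by simpa [minSmoothness_of_isRCLikeNormedField] using
            (WithTop.coe_le_coe.2 (le_top : (2 : ℕ∞) ≤ ⊤)))
        rw [e2 _ ?_, e2 v rfl, hsym]
        · simp
        · ext k
          simp only [Fin.tail, Function.comp]
          rw [Equiv.swap_apply_of_ne_of_ne] <;> simp [Fin.ext_iff]
      · rw [e, e]
        have h0 : (v ∘ Equiv.swap i.succ.castSucc i.succ.succ) 0 = v 0 := by
          simp only [Function.comp]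
          rw [Equiv.swap_apply_of_ne_of_ne] <;> simp [Fin.ext_iff]
        have ht : Fin.tail (v ∘ Equiv.swap i.succ.castSucc i.succ.succ) =
            Fin.tail v ∘ Equiv.swap i.castSucc i.succ := by
          ext k
          simp only [Fin.tail, Function.comp]
          congr 1
          rw [← Fin.succ_castSucc, (Fin.succ_injective _).swap_apply]
        simp only [h0, ht, ih]
  cases m with
  | zero => congr 1; ext i; exact i.elim0
  | succ m =>
    have hmem : σ ∈ Submonoid.closure
        (Set.range fun i : Fin m => Equiv.swap i.castSucc i.succ) := by
      rw [Equiv.Perm.mclosure_swap_castSucc_succ]; trivial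
    induction hmem using Submonoid.closure_induction generalizing v with
    | mem τ hτ => obtain ⟨i, rfl⟩ := hτ; exact hswap m i x v
    | one => simp
    | mul τ τ' _ _ h1 h2 => rw [Equiv.Perm.coe_mul, ← Function.comp_assoc, h2, h1]

theorem ContinuousMultilinearMap.eq_zero_of_diagonal {m : ℕ} {D : E [×m]→L[ℝ] F}
    (hsymm : ∀ (σ : Equiv.Perm (Fin m)) (v : Fin m → E), D (v ∘ σ) = D v)
    (hD : ∀ x, D (fun _ => x) = 0) : D = 0 := by
  ext v
  have h := D.iteratedFDeriv_comp_diagonal 0 v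
  have h0 : (fun x => D fun _ => x) = fun _ => 0 := funext hD
  have hs : ∑ σ : Equiv.Perm (Fin m), D (fun i => v (σ i)) =
      ∑ _σ : Equiv.Perm (Fin m), D v := Finset.sum_congr rfl fun σ _ => hsymm σ v
  rw [h0, hs, iteratedFDeriv_fun_zero, Finset.sum_const, Finset.card_univ,
    ← Nat.cast_smul_eq_nsmul ℝ] at h
  exact (smul_eq_zero.1 h.symm).resolve_left (Nat.cast_ne_zero.2 Fintype.card_ne_zero)

theorem iteratedDeriv_comp_line {φ : E → F} (hφ : ContDiff ℝ (⊤ : ℕ∞) φ) (m : ℕ) (x v : E)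
    (t : ℝ) : iteratedDeriv m (fun t => φ (x + t • v)) t =
      iteratedFDeriv ℝ m φ (x + t • v) fun _ => v := by
  let L : ℝ →L[ℝ] E := ContinuousLinearMap.toSpanSingleton ℝ v
  have h1 : (fun t : ℝ => φ (x + t • v)) = (fun y => φ (x + y)) ∘ L := by
    funext t; simp [L]
  rw [iteratedDeriv_eq_iteratedFDeriv, h1, L.iteratedFDeriv_comp_right
    (f := fun y => φ (x + y)) (hφ.comp (contDiff_const.add contDiff_id)) t
    (i := m) (by exact_mod_cast le_top), iteratedFDeriv_comp_add_left]
  simp [L]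

end IteratedDerivatives

section TaylorExpansion

/-- Taylor's formula at a point where the derivatives of order between `1` and `m - 1` vanish. -/
theorem exists_abs_sub_iteratedFDeriv_le {E : Type*} [NormedAddCommGroup E] [NormedSpace ℝ E]
    [ProperSpace E] {φ : E → ℝ} (hφ : ContDiff ℝ (⊤ : ℕ∞) φ) (x : E) {m : ℕ} (hm : 1 ≤ m)
    (h0 : ∀ k, 1 ≤ k → k < m → iteratedFDeriv ℝ k φ x = 0) (R : ℝ) :
    ∃ C : ℝ, 0 ≤ C ∧ ∀ v, ‖v‖ ≤ R →
      |φ (x + v) - φ x - (m.factorial : ℝ)⁻¹ * iteratedFDeriv ℝ m φ x fun _ => v| ≤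
        C * ‖v‖ ^ (m + 1) := by
  have hcont : Continuous (iteratedFDeriv ℝ (m + 1) φ) :=
    hφ.continuous_iteratedFDeriv (WithTop.coe_le_coe.2 (le_top : ((m + 1 : ℕ) : ℕ∞) ≤ ⊤))
  obtain ⟨C, hC⟩ := (isCompact_closedBall x R).exists_bound_of_continuousOn hcont.continuousOn
  refine ⟨max C 0, le_max_right _ _, fun v hv => ?_⟩
  set f : ℝ → ℝ := fun t => φ (x + t • v) with hf
  have hfc : ContDiff ℝ (⊤ : ℕ∞) f := by
    refine hφ.comp ?_
    fun_prop
  obtain ⟨t, ht, h⟩ := taylor_mean_remainder_lagrange_iteratedDeriv (f := f) (x₀ := 0) (x := 1)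
    (n := m) zero_ne_one
    ((hfc.of_le (WithTop.coe_le_coe.2 (le_top : ((m + 1 : ℕ) : ℕ∞) ≤ ⊤))).contDiffOn)
  rw [Set.uIoo_of_le zero_le_one] at ht
  have hterm : ∀ k, iteratedDerivWithin k f (Set.uIcc 0 1) 0 =
      iteratedFDeriv ℝ k φ x fun _ => v := fun k => by
    rw [iteratedDerivWithin_eq_iteratedDeriv (uniqueDiffOn_uIcc zero_ne_one)
      (hfc.contDiffAt.of_le (WithTop.coe_le_coe.2 (le_top : (k : ℕ∞) ≤ ⊤))) (by simp), hf,
      iteratedDeriv_comp_line hφ]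
    simp
  obtain ⟨m, rfl⟩ := Nat.exists_eq_add_of_le' hm
  rw [taylor_within_apply, Finset.sum_range_succ, Finset.sum_range_succ'] at h
  have hmid : ∑ k ∈ Finset.range m, (((k + 1).factorial : ℝ)⁻¹ * (1 - 0 : ℝ) ^ (k + 1)) •
      iteratedDerivWithin (k + 1) f (Set.uIcc 0 1) 0 = 0 := by
    refine Finset.sum_eq_zero fun k hk => ?_
    rw [hterm, h0 _ (Nat.le_add_left _ _) (by simpa using hk)]
    simp
  rw [hmid, hterm, hterm] at h
  have e1 : f 1 = φ (x + v) := by simp [hf]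
  rw [e1, hf, iteratedDeriv_comp_line hφ] at h
  simp only [sub_zero, one_pow, mul_one, smul_eq_mul, zero_add, Nat.factorial_zero,
    Nat.cast_one, inv_one, pow_zero, one_mul, iteratedFDeriv_zero_apply] at h
  have e2 : φ (x + v) - φ x -
      ((m + 1).factorial : ℝ)⁻¹ * (iteratedFDeriv ℝ (m + 1) φ x fun _ => v) =
      (iteratedFDeriv ℝ (m + 1 + 1) φ (x + t • v) fun _ => v) / ((m + 1 + 1).factorial : ℝ) := by
    rw [← h]; ring
  rw [e2, abs_div, Nat.abs_cast]
  have hfac : (1 : ℝ) ≤ (m + 1 + 1).factorial := by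
    exact_mod_cast (m + 1 + 1).factorial_pos
  refine (div_le_self (abs_nonneg _) hfac).trans ?_
  have hmem : x + t • v ∈ Metric.closedBall x R := by
    rw [mem_closedBall_iff_norm, add_sub_cancel_left, norm_smul, Real.norm_eq_abs,
      abs_of_pos ht.1]
    exact (mul_le_of_le_one_left (norm_nonneg _) ht.2.le).trans hv
  calc _ ≤ ‖iteratedFDeriv ℝ (m + 1 + 1) φ (x + t • v)‖ * ∏ _i : Fin (m + 1 + 1), ‖v‖ :=
        ContinuousMultilinearMap.le_opNorm _ _
    _ ≤ max C 0 * ‖v‖ ^ (m + 1 + 1) := by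
        rw [Finset.prod_const, Finset.card_univ, Fintype.card_fin]
        gcongr
        exact (hC _ hmem).trans (le_max_left _ _)

theorem exists_abs_sub_le_pow {F : ℝ → ℝ} (hF : ContDiff ℝ (⊤ : ℕ∞) F) {M : ℕ}
    (h0 : ∀ k, 1 ≤ k → k ≤ M → iteratedDeriv k F 0 = 0) :
    ∃ C : ℝ, 0 ≤ C ∧ ∀ t, 0 ≤ t → t ≤ 1 → |F t - F 0| ≤ C * t ^ (M + 1) := by
  obtain ⟨C, hC⟩ := exists_taylor_mean_remainder_bound (f := F) (n := M) zero_le_one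
    ((hF.of_le (WithTop.coe_le_coe.2 (le_top : ((M + 1 : ℕ) : ℕ∞) ≤ ⊤))).contDiffOn)
  refine ⟨max C 0, le_max_right _ _, fun t ht0 ht1 => ?_⟩
  have h := hC t ⟨ht0, ht1⟩
  rw [taylor_within_apply, Finset.sum_range_succ', Finset.sum_eq_zero] at h
  · simp only [Nat.factorial_zero, Nat.cast_one, inv_one, sub_zero, pow_zero, mul_one,
      iteratedDerivWithin_zero, one_smul, zero_add, Real.norm_eq_abs] at h
    exact h.trans (by gcongr; exact le_max_left _ _)
  · intro k hk
    rw [iteratedDerivWithin_eq_iteratedDeriv (uniqueDiffOn_Icc zero_lt_one)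
      (hF.contDiffAt.of_le (WithTop.coe_le_coe.2 (le_top : ((k + 1 : ℕ) : ℕ∞) ≤ ⊤))) (by simp),
      h0 _ (Nat.le_add_left _ _) (by simpa using hk), smul_zero]

open Polynomial in
theorem Polynomial.eq_zero_of_abs_eval_le {q : ℝ[X]} {N : ℕ} (hN : q.natDegree < N) {C : ℝ}
    (h : ∀ t, 0 < t → t ≤ 1 → |q.eval t| ≤ C * t ^ N) : q = 0 := by
  have hdvd : ∀ k, k ≤ N → X ^ k ∣ q := by
    intro k
    induction k with
    | zero => simp
    | succ k ih =>
      intro hk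
      obtain ⟨r, hr⟩ := ih (Nat.le_of_succ_le hk)
      suffices X ∣ r by
        rw [hr, pow_succ]
        exact mul_dvd_mul_left _ this
      rw [X_dvd_iff, coeff_zero_eq_eval_zero]
      have hbound : ∀ t : ℝ, 0 < t → t ≤ 1 → |r.eval t| ≤ C * t ^ (N - k) := fun t ht ht1 => by
        have h1 := h t ht ht1
        rw [hr, eval_mul, eval_pow, eval_X, abs_mul, abs_of_pos (pow_pos ht k),
          ← Nat.add_sub_cancel' (Nat.le_of_succ_le hk), pow_add, mul_left_comm] at h1
        exact le_of_mul_le_mul_left h1 (pow_pos ht k)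
      have l1 : Filter.Tendsto (fun t : ℝ => |r.eval t|) (nhdsWithin 0 (Set.Ioi 0))
          (nhds |r.eval 0|) :=
        ((continuous_abs.comp r.continuous).tendsto 0).mono_left nhdsWithin_le_nhds
      have l2 : Filter.Tendsto (fun t : ℝ => C * t ^ (N - k)) (nhdsWithin 0 (Set.Ioi 0))
          (nhds 0) := by
        have : Continuous fun t : ℝ => C * t ^ (N - k) := by fun_prop
        have h2 := (this.tendsto 0).mono_left (nhdsWithin_le_nhds (s := Set.Ioi (0 : ℝ)))
        rwa [zero_pow (by omega), mul_zero] at h2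
      have := le_of_tendsto_of_tendsto l1 l2 (by
        filter_upwards [Ioc_mem_nhdsGT (zero_lt_one' ℝ)] with t ht
        exact hbound t ht.1 ht.2)
      exact abs_nonpos_iff.1 this
  by_contra hq
  exact hq (eq_zero_of_dvd_of_natDegree_lt (hdvd N le_rfl) (by simpa using hN))

theorem ContinuousMultilinearMap.diagonal_eq_sum {d m : ℕ} (D : (Fin d → ℝ) [×m]→L[ℝ] ℝ)
    (x : Fin d → ℝ) : (D fun _ => x) =
      ∑ σ : Fin m → Fin d, (D fun k => Pi.single (σ k) 1) * ∏ k, x (σ k) := by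
  have hx : x = ∑ i, x i • (Pi.single i 1 : Fin d → ℝ) := by
    ext j
    simp [Finset.sum_apply, Pi.single_apply]
  conv_lhs => rw [hx]
  rw [D.map_sum]
  refine Finset.sum_congr rfl fun σ _ => ?_
  rw [D.map_smul_univ, smul_eq_mul, mul_comm]

open Polynomial in
/-- There is a polynomial curve which is not contained in the zero set of a nonzero form of degree
at most `l`. -/
theorem exists_polynomial_curve (d l : ℕ) : ∃ ω : Fin d → ℝ[X], ∀ m ≤ l,
    ∀ D : (Fin d → ℝ) [×m]→L[ℝ] ℝ, (∀ t, (D fun _ i => (ω i).eval t) = 0) →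
      ∀ x, (D fun _ => x) = 0 := by
  let e := Fintype.equivFin (Fin d → Fin (l + 1))
  have hinj : Set.InjOn (fun p => ((e p : ℕ) : ℝ)) (Finset.univ : Finset (Fin d → Fin (l + 1))) :=
    fun p _ q _ h => e.injective (Fin.ext (Nat.cast_injective h))
  refine ⟨fun i => Lagrange.interpolate Finset.univ (fun p => ((e p : ℕ) : ℝ))
    fun p => ((p i : ℕ) : ℝ), fun m hm D hD x => ?_⟩
  let P : MvPolynomial (Fin d) ℝ := ∑ σ : Fin m → Fin d,
    MvPolynomial.C (D fun k => Pi.single (σ k) 1) * ∏ k, MvPolynomial.X (σ k)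
  have heval : ∀ y, MvPolynomial.eval y P = D fun _ => y := fun y => by
    simp only [P, D.diagonal_eq_sum, map_sum, map_mul, map_prod, MvPolynomial.eval_C,
      MvPolynomial.eval_X]
  have hP : P = 0 := by
    refine MvPolynomial.eq_zero_of_eval_zero_at_prod_finset P
      (fun _ => Finset.univ.image fun a : Fin (l + 1) => ((a : ℕ) : ℝ)) (fun i => ?_) fun y hy => ?_
    · rw [Finset.card_image_of_injective _ fun a b h => Fin.ext (Nat.cast_injective h),
        Finset.card_univ, Fintype.card_fin, Nat.lt_succ_iff]
      refine (MvPolynomial.degreeOf_le_totalDegree _ _).trans ?_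
      refine (MvPolynomial.totalDegree_finsetSum _ _).trans (Finset.sup_le fun σ _ => ?_)
      refine (MvPolynomial.totalDegree_mul _ _).trans ?_
      rw [MvPolynomial.totalDegree_C, zero_add]
      refine (MvPolynomial.totalDegree_finsetProd _ _).trans ?_
      simpa using hm
    · simp only [Finset.mem_image, Finset.mem_univ, true_and] at hy
      choose p hp using hy
      rw [heval, ← hD (e p : ℕ)]
      congr
      funext _ i
      rw [Lagrange.eval_interpolate_at_node (v := fun p => ((e p : ℕ) : ℝ)) _ hinj
        (Finset.mem_univ p), hp]
  rw [← heval, hP, map_zero]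

end TaylorExpansion

/-- A curve through the origin which detects the nonvanishing of the derivatives of order at most
`l` of all smooth functions. -/
theorem exists_detecting_curve (d l : ℕ) : ∃ (Γ : ℝ → Fin d → ℝ) (M : ℕ),
    ContDiff ℝ (⊤ : ℕ∞) Γ ∧ Γ 0 = 0 ∧ ∀ (φ : (Fin d → ℝ) → ℝ) (x : Fin d → ℝ),
      ContDiff ℝ (⊤ : ℕ∞) φ → (∃ m, 1 ≤ m ∧ m ≤ l ∧ iteratedFDeriv ℝ m φ x ≠ 0) →
        ∃ k, 1 ≤ k ∧ k ≤ M ∧ iteratedDeriv k (fun t => φ (x + Γ t)) 0 ≠ 0 := by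
  obtain ⟨ω, hω⟩ := exists_polynomial_curve d l
  set Δ := ∑ i, (ω i).natDegree with hΔ
  set N := l * Δ + 1 with hN
  let w : ℝ → Fin d → ℝ := fun t i => (ω i).eval t
  have hw : ContDiff ℝ (⊤ : ℕ∞) w := contDiff_pi.2 fun i => by
    simpa [Polynomial.aeval_def] using (ω i).contDiff_aeval (𝕜 := ℝ) ((⊤ : ℕ∞) : WithTop ℕ∞)
  have hΓ : ContDiff ℝ (⊤ : ℕ∞) fun t : ℝ => t ^ N • w t := (contDiff_id.pow N).smul hw
  refine ⟨fun t => t ^ N • w t, (l + 1) * N, hΓ, by simp [hN], fun φ x hφ hex => ?_⟩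
  classical
  by_contra! hcon
  set m := Nat.find hex with hmdef
  obtain ⟨hm1, hml, hm⟩ : 1 ≤ m ∧ m ≤ l ∧ iteratedFDeriv ℝ m φ x ≠ 0 := Nat.find_spec hex
  have hmin : ∀ k, 1 ≤ k → k < m → iteratedFDeriv ℝ k φ x = 0 := fun k hk hkm => by
    have := Nat.find_min hex hkm
    by_contra h
    exact this ⟨hk, hkm.le.trans hml, h⟩
  obtain ⟨R, hR⟩ := (isCompact_Icc (a := (0 : ℝ)) (b := 1)).exists_bound_of_continuousOn
    hw.continuous.continuousOn
  have hR0 : 0 ≤ R := (norm_nonneg _).trans (hR 0 (by simp))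
  obtain ⟨C₁, hC₁, h1⟩ := exists_abs_sub_iteratedFDeriv_le hφ x hm1 hmin R
  obtain ⟨C₂, hC₂, h2⟩ := exists_abs_sub_le_pow (F := fun t => φ (x + t ^ N • w t))
    (hφ.comp (contDiff_const.add hΓ)) hcon
  set D := iteratedFDeriv ℝ m φ x with hD
  refine hm (ContinuousMultilinearMap.eq_zero_of_diagonal
    (fun σ v => hφ.iteratedFDeriv_comp_perm σ x v) (hω m hml D ?_))
  let q : Polynomial ℝ := ∑ σ : Fin m → Fin d,
    Polynomial.C (D fun k => Pi.single (σ k) 1) * ∏ k, ω (σ k)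
  have hq : ∀ t, q.eval t = D fun _ => w t := fun t => by
    rw [D.diagonal_eq_sum, Polynomial.eval_finsetSum]
    simp [w, Polynomial.eval_prod]
  have hdeg : q.natDegree < N := by
    refine Nat.lt_succ_of_le (Polynomial.natDegree_sum_le_of_forall_le _ _ fun σ _ => ?_)
    refine (Polynomial.natDegree_C_mul_le _ _).trans ((Polynomial.natDegree_prod_le _ _).trans ?_)
    calc _ ≤ ∑ _k : Fin m, Δ := Finset.sum_le_sum fun k _ =>
          Finset.single_le_sum (f := fun i => (ω i).natDegree) (fun i _ => Nat.zero_le _)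
            (Finset.mem_univ (σ k))
      _ = m * Δ := by simp
      _ ≤ l * Δ := Nat.mul_le_mul_right _ hml
  have hq0 : q = 0 := by
    refine Polynomial.eq_zero_of_abs_eval_le hdeg
      (C := m.factorial * (C₂ + C₁ * R ^ (m + 1))) fun t ht0 ht1 => ?_
    rw [hq]
    have hnorm : ‖t ^ N • w t‖ ≤ t ^ N * R := by
      rw [norm_smul, norm_pow, Real.norm_eq_abs, abs_of_pos ht0]
      exact mul_le_mul_of_nonneg_left (hR t ⟨ht0.le, ht1⟩) (by positivity)
    have htN : t ^ N ≤ 1 := pow_le_one₀ ht0.le ht1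
    have h3 := h1 (t ^ N • w t) (hnorm.trans (mul_le_of_le_one_left hR0 htN))
    have h4 := h2 t ht0.le ht1
    simp only [zero_pow (show N ≠ 0 by omega), zero_smul, add_zero] at h4
    have hhom : (D fun _ => t ^ N • w t) = (t ^ N) ^ m * D fun _ => w t := by
      rw [D.map_smul_univ (fun _ => t ^ N) fun _ => w t]
      simp
    rw [hhom] at h3
    have h5 : C₁ * ‖t ^ N • w t‖ ^ (m + 1) ≤ C₁ * R ^ (m + 1) * (t ^ N) ^ (m + 1) := by
      calc _ ≤ C₁ * (t ^ N * R) ^ (m + 1) := by gcongr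
        _ = _ := by rw [mul_pow]; ring
    have h6 : C₂ * t ^ ((l + 1) * N + 1) ≤ C₂ * (t ^ N) ^ (m + 1) := by
      rw [← pow_mul]
      refine mul_le_mul_of_nonneg_left (pow_le_pow_of_le_one ht0.le ht1 ?_) hC₂
      nlinarith
    have hfac : (0 : ℝ) < m.factorial := by exact_mod_cast m.factorial_pos
    have h7 : |(m.factorial : ℝ)⁻¹ * ((t ^ N) ^ m * D fun _ => w t)| ≤
        (C₂ + C₁ * R ^ (m + 1)) * (t ^ N) ^ (m + 1) := by
      have := abs_sub_abs_le_abs_sub ((m.factorial : ℝ)⁻¹ * ((t ^ N) ^ m * D fun _ => w t))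
        (φ (x + t ^ N • w t) - φ x)
      rw [abs_sub_comm _ (φ (x + t ^ N • w t) - φ x)] at this
      linarith
    have hp : 0 < (t ^ N) ^ m := by positivity
    rw [abs_mul, abs_mul, abs_of_pos (inv_pos.2 hfac), abs_of_pos hp,
      inv_mul_le_iff₀ hfac, pow_succ] at h7
    refine le_of_mul_le_mul_left (h7.trans (le_of_eq ?_)) hp
    ring
  intro t
  rw [← Polynomial.eval_zero (x := t), ← hq0, hq]

theorem exists_nondegCurve {d s : ℕ} {g : (Fin d → ℝ) → Fin s → ℝ} (hg : ContDiff ℝ (⊤ : ℕ∞) g)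
    (x₀ : Fin d → ℝ) {l : ℕ} (hnd : ∀ b : Fin s → ℝ, b ≠ 0 → ∃ m, 1 ≤ m ∧ m ≤ l ∧
      iteratedFDeriv ℝ m (fun x => ∑ i, b i * g x i) x₀ ≠ 0) :
    ∃ Γ : ℝ → Fin d → ℝ, ContDiff ℝ (⊤ : ℕ∞) Γ ∧ Γ 0 = 0 ∧ ∃ r > 0, ∀ c ∈ Metric.ball x₀ r,
      NondegCurve (fun t => g (c + Γ t)) 0 r := by
  obtain ⟨Γ, M, hΓ, hΓ0, hdet⟩ := exists_detecting_curve d l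
  refine ⟨Γ, hΓ, hΓ0, ?_⟩
  let G : (Fin d → ℝ) × ℝ → Fin s → ℝ := fun p => g (p.1 + Γ p.2)
  have hG : ContDiff ℝ (⊤ : ℕ∞) G :=
    hg.comp (contDiff_fst.add (hΓ.comp contDiff_snd))
  let Φ : ℕ → (Fin d → ℝ) × ℝ → Fin s → ℝ := fun k p => iteratedFDeriv ℝ k G p fun _ => (0, 1)
  have hΦ : ∀ k, Continuous (Φ k) := fun k =>
    (ContinuousMultilinearMap.apply ℝ (fun _ : Fin k => (Fin d → ℝ) × ℝ) (Fin s → ℝ)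
      fun _ => (0, 1)).continuous.comp
      (hG.continuous_iteratedFDeriv (WithTop.coe_le_coe.2 (le_top : (k : ℕ∞) ≤ ⊤)))
  have hderiv : ∀ (b : Fin s → ℝ) (k : ℕ) (c : Fin d → ℝ) (t : ℝ),
      iteratedDeriv k (fun t => ∑ i, b i * g (c + Γ t) i) t = ∑ i, b i * Φ k (c, t) i := by
    intro b k c t
    let ℓ : (Fin s → ℝ) →L[ℝ] ℝ := ∑ i, b i • ContinuousLinearMap.proj i
    have hℓ : ∀ y, ℓ y = ∑ i, b i * y i := fun y => by simp [ℓ]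
    have h1 := iteratedDeriv_comp_line (φ := ℓ ∘ G) (ℓ.contDiff.comp hG) k (c, 0) (0, 1) t
    rw [ℓ.iteratedFDeriv_comp_left (hG.contDiffAt) (WithTop.coe_le_coe.2
      (le_top : (k : ℕ∞) ≤ ⊤))] at h1
    simpa [G, Φ, hℓ] using h1
  let L : (Fin s → ℝ) →ₗ[ℝ] (Fin M → ℝ) := LinearMap.pi fun k =>
    ∑ i, Φ (k + 1) (x₀, 0) i • LinearMap.proj i
  have hLapp : ∀ b k, L b k = ∑ i, b i * Φ (k + 1) (x₀, 0) i := fun b k => by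
    simp [L, mul_comm]
  have hL : LinearMap.ker L = ⊥ := by
    refine LinearMap.ker_eq_bot'.2 fun b hb => ?_
    by_contra hb0
    obtain ⟨k, hk1, hkM, hk⟩ := hdet _ x₀
      (ContDiff.sum fun i _ => contDiff_const.mul (contDiff_pi.1 hg i)) (hnd b hb0)
    simp only [hderiv] at hk
    obtain ⟨k, rfl⟩ := Nat.exists_eq_add_of_le' hk1
    exact hk ((hLapp b ⟨k, hkM⟩).symm.trans (congrFun hb _))
  obtain ⟨K, hK0, hK⟩ := L.exists_antilipschitzWith hL
  have hKn : ∀ b, ‖b‖ ≤ K * ‖L b‖ := fun b => by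
    simpa using hK.le_mul_dist b 0
  set η : ℝ := 1 / (2 * (s * K + 1)) with hη
  have hη0 : 0 < η := by positivity
  have hev : ∀ᶠ p in nhds ((x₀, 0) : (Fin d → ℝ) × ℝ), ∀ k ∈ Finset.range (M + 1),
      ‖Φ k p - Φ k (x₀, 0)‖ < η := by
    rw [Filter.eventually_all_finset]
    intro k _
    have := Metric.tendsto_nhds.1 ((hΦ k).continuousAt (x := (x₀, 0))) η hη0
    simpa only [dist_eq_norm] using this
  obtain ⟨r, hr, hball⟩ := Metric.eventually_nhds_iff.1 hev
  refine ⟨r / 2, half_pos hr, fun c hc => ⟨M, 3, fun b hb => ?_⟩⟩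
  have hLb : L b ≠ 0 := fun h => hb (LinearMap.ker_eq_bot'.1 hL b h)
  have hM : 0 < M := by
    rcases Nat.eq_zero_or_pos M with rfl | h
    · exact (hLb (funext fun k => k.elim0)).elim
    · exact h
  have : Nonempty (Fin M) := ⟨⟨0, hM⟩⟩
  obtain ⟨k, hk⟩ := Finite.exists_max fun k => ‖L b k‖
  have hk' : ‖L b k‖ = ‖L b‖ := le_antisymm (norm_le_pi_norm _ _)
    ((pi_norm_le_iff_of_nonneg (norm_nonneg _)).2 hk)
  have ha : 0 < ‖L b‖ := norm_pos_iff.2 hLb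
  refine ⟨‖L b‖ / 2, half_pos ha, k + 1, Nat.le_add_left _ _, k.2, fun t ht => ?_⟩
  rw [hderiv]
  have hd : dist ((c, t) : (Fin d → ℝ) × ℝ) (x₀, 0) < r := by
    rw [Prod.dist_eq, max_lt_iff, Real.dist_eq, sub_zero, abs_of_nonneg ht.1]
    exact ⟨(Metric.mem_ball.1 hc).trans (half_lt_self hr), ht.2.trans_lt (half_lt_self hr)⟩
  have hclose := hball hd (k + 1) (Finset.mem_range.2 (Nat.succ_lt_succ k.2))
  have hdiff : |∑ i, b i * Φ (k + 1) (c, t) i - L b k| ≤ ‖L b‖ / 2 := by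
    rw [hLapp, ← Finset.sum_sub_distrib]
    calc _ ≤ ∑ i, |b i * Φ (k + 1) (c, t) i - b i * Φ (k + 1) (x₀, 0) i| :=
          Finset.abs_sum_le_sum_abs _ _
      _ ≤ ∑ _i : Fin s, ‖b‖ * η := by
          refine Finset.sum_le_sum fun i _ => ?_
          rw [← mul_sub, abs_mul]
          refine mul_le_mul (norm_le_pi_norm b i) ?_ (abs_nonneg _) (norm_nonneg _)
          exact (norm_le_pi_norm (Φ (k + 1) (c, t) - Φ (k + 1) (x₀, 0)) i).trans hclose.le
      _ = s * ‖b‖ * η := by simp [mul_assoc]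
      _ ≤ s * (K * ‖L b‖) * η := by gcongr; exact hKn b
      _ = (s * K) / (s * K + 1) * (‖L b‖ / 2) := by rw [hη]; field_simp
      _ ≤ 1 * (‖L b‖ / 2) := by
          gcongr
          rw [div_le_one (by positivity)]
          linarith
      _ = _ := one_mul _
  rw [Real.norm_eq_abs] at hk'
  have h1 := abs_sub_abs_le_abs_sub (∑ i, b i * Φ (k + 1) (c, t) i) (L b k)
  have h2 := abs_sub_abs_le_abs_sub (L b k) (∑ i, b i * Φ (k + 1) (c, t) i)
  rw [abs_sub_comm] at h2
  constructor <;> linarith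

theorem measurableSet_frequently_smallVec {X : Type*} [TopologicalSpace X] [MeasurableSpace X]
    [OpensMeasurableSpace X] {n : ℕ} {f : X → Fin n → ℝ} (hf : Continuous f)
    (ε : (Fin n → ℕ) → ℝ) :
    MeasurableSet {x | ∃ᶠ T in Filter.cofinite, SmallVec T (f x) (ε T)} := by
  have hopen : ∀ T, IsOpen {x | SmallVec T (f x) (ε T)} := fun T => by
    have : {x | SmallVec T (f x) (ε T)} = ⋃ v ∈ {v : Fin (n + 1) → ℤ | v ≠ 0},
        {x | ‖flow T (f x) fun i => (v i : ℝ)‖ < ε T} := by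
      ext x
      simp [SmallVec]
    rw [this]
    refine isOpen_biUnion fun v _ => isOpen_lt (Continuous.norm (continuous_pi fun i => ?_))
      continuous_const
    refine Fin.cases ?_ (fun i => ?_) i
    · simp only [flow_zero]
      fun_prop
    · simp only [flow_succ]
      fun_prop
  have : {x | ∃ᶠ T in Filter.cofinite, SmallVec T (f x) (ε T)} =
      ⋂ F : Finset (Fin n → ℕ), ⋃ T ∈ {T | T ∉ F}, {x | SmallVec T (f x) (ε T)} := by
    ext x
    simp only [Set.mem_ofPred_eq, Filter.frequently_cofinite_iff_infinite, Set.mem_iInter,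
      Set.mem_iUnion, exists_prop]
    refine ⟨fun h F => ?_, fun h hfin => ?_⟩
    · obtain ⟨T, hT, hTF⟩ := h.exists_notMem_finset F
      exact ⟨T, hTF, hT⟩
    · obtain ⟨T, hTF, hT⟩ := h hfin.toFinset
      exact hTF (hfin.mem_toFinset.2 hT)
  rw [this]
  exact MeasurableSet.iInter fun F => MeasurableSet.biUnion (Set.to_countable _)
    fun T _ => (hopen T).measurableSet

theorem exists_volume_isVWMA_eq_zero {d n s : ℕ} {h : (Fin s → ℝ) →ᵃ[ℝ] (Fin n → ℝ)}
    (hh : Nondivergent h) {g : (Fin d → ℝ) → Fin s → ℝ} (hg : ContDiff ℝ (⊤ : ℕ∞) g)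
    (x₀ : Fin d → ℝ) {l : ℕ} (hnd : ∀ b : Fin s → ℝ, b ≠ 0 → ∃ m, 1 ≤ m ∧ m ≤ l ∧
      iteratedFDeriv ℝ m (fun x => ∑ i, b i * g x i) x₀ ≠ 0) :
    ∃ r > 0, volume {x ∈ Metric.ball x₀ r | IsVWMA (h (g x))} = 0 := by
  obtain ⟨Γ, hΓ, hΓ0, r, hr, hcurve⟩ := exists_nondegCurve hg x₀ hnd
  refine ⟨r / 2, half_pos hr, ?_⟩
  let E : ℕ → Set (Fin d → ℝ) := fun m => {x | ∃ᶠ T in Filter.cofinite,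
    SmallVec T (h (g x)) ((2 : ℝ) ^ (-(1 / ((m : ℝ) + 1) * (∑ i, T i : ℕ))))}
  have hhc : Continuous h := h.continuous_of_finiteDimensional
  have hE : ∀ m, MeasurableSet (E m) := fun m =>
    measurableSet_frequently_smallVec (hhc.comp hg.continuous) _
  suffices hnull : ∀ m, volume (Metric.ball x₀ (r / 2) ∩ E m) = 0 by
    refine measure_mono_null (fun x hx => ?_) (measure_iUnion_null hnull)
    obtain ⟨m, hm⟩ := hx.2.exists_frequently_smallVec
    exact Set.mem_iUnion.2 ⟨m, hx.1, hm⟩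
  intro m
  have hmeas : MeasurableSet {p : (Fin d → ℝ) × ℝ | p.1 + Γ p.2 ∉ E m} := by
    have hc : Continuous fun p : (Fin d → ℝ) × ℝ => p.1 + Γ p.2 :=
      continuous_fst.add (hΓ.continuous.comp continuous_snd)
    exact hc.measurable (hE m).compl
  have h1 : ∀ᵐ c ∂volume.restrict (Metric.ball x₀ r), ∀ᵐ t ∂volume.restrict (Set.Icc 0 r),
      c + Γ t ∉ E m := by
    filter_upwards [ae_restrict_mem measurableSet_ball] with c hc
    rw [ae_restrict_iff' measurableSet_Icc, ae_iff]
    have := volume_frequently_smallVec_eq_zero hh (G := fun t => g (c + Γ t))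
      (hg.comp (contDiff_const.add hΓ)) hr (hcurve c hc) (γ := 1 / ((m : ℝ) + 1)) (by positivity)
    refine measure_mono_null (fun t ht => ?_) this
    simp only [Set.mem_ofPred_eq, Classical.not_imp, not_not] at ht
    exact ht
  have h2 := (Measure.ae_ae_comm (p := fun c t => c + Γ t ∉ E m) hmeas).1 h1
  rw [ae_restrict_iff' measurableSet_Icc] at h2
  obtain ⟨t, ht, htr, htΓ⟩ : ∃ t, (t ∈ Set.Icc 0 r →
      ∀ᵐ c ∂volume.restrict (Metric.ball x₀ r), c + Γ t ∉ E m) ∧ t ∈ Set.Icc 0 r ∧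
      ‖Γ t‖ < r / 2 := by
    obtain ⟨η, hη, hηΓ⟩ := Metric.eventually_nhds_iff.1
      (Metric.tendsto_nhds.1 hΓ.continuous.continuousAt (r / 2) (half_pos hr))
    by_contra! hcon
    have hsub : Set.Ioo 0 (min η r) ⊆ {t | ¬ (t ∈ Set.Icc 0 r →
        ∀ᵐ c ∂volume.restrict (Metric.ball x₀ r), c + Γ t ∉ E m)} := by
      intro t ht hP
      refine not_lt.2 (hcon t hP ⟨ht.1.le, (ht.2.trans_le (min_le_right _ _)).le⟩) ?_
      have := hηΓ (y := t) (by
        rw [Real.dist_eq, sub_zero, abs_of_pos ht.1]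
        exact ht.2.trans_le (min_le_left _ _))
      rwa [hΓ0, dist_zero_right] at this
    have := measure_mono_null hsub (ae_iff.1 h2)
    rw [Real.volume_Ioo, ENNReal.ofReal_eq_zero] at this
    linarith [lt_min hη hr]
  have h3 := ht htr
  rw [ae_restrict_iff' measurableSet_ball, ae_iff] at h3
  rw [← measure_preimage_add_right volume (-Γ t)] at h3
  refine measure_mono_null (fun x hx => ?_) h3
  simp only [Set.mem_preimage, Set.mem_ofPred_eq, Classical.not_imp, not_not,
    neg_add_cancel_right]
  refine ⟨?_, hx.2⟩
  have := Metric.mem_ball.1 hx.1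
  rw [Metric.mem_ball, dist_eq_norm] at *
  calc ‖x + -Γ t - x₀‖ = ‖(x - x₀) - Γ t‖ := by congr 1; abel
    _ ≤ ‖x - x₀‖ + ‖Γ t‖ := norm_sub_le _ _
    _ < r := by linarith

theorem exists_contDiff_eventuallyEq {E F : Type*} [NormedAddCommGroup E] [NormedSpace ℝ E]
    [FiniteDimensional ℝ E] [NormedAddCommGroup F] [NormedSpace ℝ F] {k : ℕ∞}
    {f : E → F} {U : Set E} (hU : IsOpen U) (hf : ContDiffOn ℝ k f U) {x : E} (hx : x ∈ U) :
    ∃ g : E → F, ContDiff ℝ k g ∧ g =ᶠ[nhds x] f := by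
  obtain ⟨r, hr, hrU⟩ := Metric.nhds_basis_closedBall.mem_iff.1 (hU.mem_nhds hx)
  let χ : ContDiffBump x := ⟨r / 2, r, half_pos hr, half_lt_self hr⟩
  refine ⟨fun y => χ y • f y, contDiff_iff_contDiffAt.2 fun y => ?_, ?_⟩
  · by_cases hy : y ∈ U
    · exact χ.contDiff.contDiffAt.smul (hf.contDiffAt (hU.mem_nhds hy))
    · have hyt : y ∉ tsupport χ := by
        rw [χ.tsupport_eq]
        exact fun h => hy (hrU h)
      refine (contDiffAt_const (c := (0 : F))).congr_of_eventuallyEq ?_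
      filter_upwards [notMem_tsupport_iff_eventuallyEq.1 hyt] with z hz
      simp [hz]
  · filter_upwards [χ.eventuallyEq_one] with y hy
    simp [hy]

theorem AffineSubspace.exists_parametrization {n : ℕ} {L : AffineSubspace ℝ (Fin n → ℝ)}
    {p : Fin n → ℝ} (hp : p ∈ L) :
    ∃ (s : ℕ) (h : (Fin s → ℝ) →ᵃ[ℝ] (Fin n → ℝ)), Function.Injective h ∧
      Set.range h = (L : Set (Fin n → ℝ)) := by
  let e := (Module.finBasis ℝ L.direction).equivFun.symm
  let φ : (Fin (Module.finrank ℝ L.direction) → ℝ) →ₗ[ℝ] (Fin n → ℝ) :=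
    L.direction.subtype ∘ₗ e.toLinearMap
  let h : (Fin (Module.finrank ℝ L.direction) → ℝ) →ᵃ[ℝ] (Fin n → ℝ) :=
    φ.toAffineMap + AffineMap.const ℝ _ p
  have happ : ∀ z, h z = (e z : Fin n → ℝ) + p := fun z => rfl
  refine ⟨_, h, fun z w hzw => ?_, Set.ext fun y => ⟨?_, fun hy => ?_⟩⟩
  · rw [happ, happ] at hzw
    exact e.injective (Subtype.ext (add_right_cancel hzw))
  · rintro ⟨z, rfl⟩
    rw [happ]
    exact AffineSubspace.vadd_mem_of_mem_direction (e z).2 hp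
  · have hyp : y - p ∈ L.direction := AffineSubspace.vsub_mem_direction hy hp
    exact ⟨e.symm ⟨y - p, hyp⟩, by simp [happ]⟩

theorem direction_eq_range_linear {n s : ℕ} {h : (Fin s → ℝ) →ᵃ[ℝ] (Fin n → ℝ)}
    {L : AffineSubspace ℝ (Fin n → ℝ)} (hL : Set.range h = (L : Set (Fin n → ℝ))) :
    L.direction = LinearMap.range h.linear := by
  have : (⊤ : AffineSubspace ℝ (Fin s → ℝ)).map h = L := by
    apply SetLike.coe_injective
    simp [← hL]
  rw [← this, AffineSubspace.map_direction, AffineSubspace.direction_top, LinearMap.range_eq_map]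

theorem NondegAt.exists_iteratedFDeriv_ne_zero {d n : ℕ} {U : Set (Fin d → ℝ)} (hU : IsOpen U)
    {L : AffineSubspace ℝ (Fin n → ℝ)} {f : (Fin d → ℝ) → Fin n → ℝ}
    (hf : ContDiffOn ℝ (⊤ : ℕ∞) f U) {x : Fin d → ℝ} (hx : x ∈ U) (hnd : NondegAt U L f x) :
    ∃ l : ℕ, ∀ ψ : (Fin n → ℝ) →L[ℝ] ℝ, (∃ v ∈ L.direction, ψ v ≠ 0) →
      ∃ m, 1 ≤ m ∧ m ≤ l ∧ iteratedFDeriv ℝ m (ψ ∘ f) x ≠ 0 := by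
  obtain ⟨l, hl⟩ := hnd
  refine ⟨l, fun ψ ⟨v, hv, hψ⟩ => ?_⟩
  by_contra! hcon
  rw [← hl] at hv
  refine hψ (LinearMap.mem_ker.1 (Submodule.span_le (p := LinearMap.ker ψ.toLinearMap).2 ?_ hv))
  rintro _ ⟨m, hm1, hml, u, rfl⟩
  rw [SetLike.mem_coe, LinearMap.mem_ker, iteratedFDerivWithin_of_isOpen m hU hx]
  have h1 := hcon m hm1 hml
  rw [ψ.iteratedFDeriv_comp_left (hf.contDiffAt (hU.mem_nhds hx)) (WithTop.coe_le_coe.2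
      (le_top : (m : ℕ∞) ≤ ⊤))] at h1
  simpa using congrArg (fun F => F u) h1

theorem Nondivergent.isStronglyExtremal {d n s : ℕ} {h : (Fin s → ℝ) →ᵃ[ℝ] (Fin n → ℝ)}
    (hh : Nondivergent h) (hinj : Function.Injective h) {L : AffineSubspace ℝ (Fin n → ℝ)}
    (hL : Set.range h = (L : Set (Fin n → ℝ))) {U : Set (Fin d → ℝ)} (hU : IsOpen U)
    {f : (Fin d → ℝ) → Fin n → ℝ} (hf : ContDiffOn ℝ (⊤ : ℕ∞) f U) (hfL : ∀ x ∈ U, f x ∈ L)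
    (hnd : ∀ᵐ x ∂volume.restrict U, NondegAt U L f x) : IsStronglyExtremal U f := by
  have hlin : Function.Injective h.linear := h.linear_injective_iff.2 hinj
  obtain ⟨A, hA⟩ := h.linear.exists_leftInverse_of_injective (LinearMap.ker_eq_bot.2 hlin)
  have hA' : ∀ z, A (h.linear z) = z := fun z => LinearMap.congr_fun hA z
  have hzero : ∀ z, h z = h.linear z + h 0 := fun z => by
    conv_lhs => rw [AffineMap.decomp h]
    simp
  let Ac : (Fin n → ℝ) →L[ℝ] (Fin s → ℝ) := A.toContinuousLinearMap
  let g₀ : (Fin d → ℝ) → Fin s → ℝ := fun x => Ac (f x - h 0)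
  have hg₀ : ∀ x ∈ U, h (g₀ x) = f x := fun x hx => by
    have hfx := hfL x hx
    rw [← SetLike.mem_coe, ← hL] at hfx
    obtain ⟨z, hz⟩ := hfx
    have : g₀ x = z := by simp [g₀, Ac, ← hz, hzero z, hA']
    rw [this, hz]
  have hg₀c : ContDiffOn ℝ (⊤ : ℕ∞) g₀ U :=
    Ac.contDiff.comp_contDiffOn (hf.sub contDiffOn_const)
  rw [ae_restrict_iff' hU.measurableSet, ae_iff] at hnd
  suffices hnull : volume {x | x ∈ U ∧ NondegAt U L f x ∧ IsVWMA (f x)} = 0 by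
    refine measure_mono_null (fun x hx => ?_) (measure_union_null hnd hnull)
    by_cases hx' : NondegAt U L f x
    · exact Or.inr ⟨hx.1, hx', hx.2⟩
    · exact Or.inl fun H => hx' (H hx.1)
  refine measure_null_of_locally_null _ fun x₀ hx₀ => ?_
  obtain ⟨hx₀U, hx₀nd, -⟩ := hx₀
  obtain ⟨l, hl⟩ := hx₀nd.exists_iteratedFDeriv_ne_zero hU hf hx₀U
  obtain ⟨g, hg, hgeq⟩ := exists_contDiff_eventuallyEq hU hg₀c hx₀U
  obtain ⟨r, hr, hr0⟩ := exists_volume_isVWMA_eq_zero hh hg x₀ (l := l) fun b hb => by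
    let ℓ : (Fin s → ℝ) →L[ℝ] ℝ := ∑ i, b i • ContinuousLinearMap.proj i
    have hℓ : ∀ y, ℓ y = ∑ i, b i * y i := fun y => by simp [ℓ]
    obtain ⟨i, hi⟩ := Function.ne_iff.1 hb
    obtain ⟨m, hm1, hml, hm⟩ := hl (ℓ ∘L Ac) ⟨h.linear (Pi.single i 1), by
      rw [direction_eq_range_linear hL]
      exact LinearMap.mem_range_self _ _, by simpa [Ac, hA', hℓ, Pi.single_apply] using hi⟩
    refine ⟨m, hm1, hml, fun h0 => hm ?_⟩
    have heq : (fun x => ∑ i, b i * g x i) =ᶠ[nhds x₀]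
        (⇑(ℓ ∘L Ac) ∘ f) - fun _ => ℓ (Ac (h 0)) := by
      filter_upwards [hgeq] with x hx
      rw [hx, ← hℓ]
      simp [g₀]
    rw [(heq.iteratedFDeriv ℝ m).eq_of_nhds] at h0
    rw [← h0, iteratedFDeriv_sub_apply (((ℓ ∘L Ac).contDiff.contDiffAt.comp x₀
      (hf.contDiffAt (hU.mem_nhds hx₀U))).of_le (WithTop.coe_le_coe.2 (le_top : (m : ℕ∞) ≤ ⊤)))
      contDiffAt_const, iteratedFDeriv_const_of_ne (Nat.one_le_iff_ne_zero.1 hm1)]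
    simp
  refine ⟨_, Filter.inter_mem self_mem_nhdsWithin (mem_nhdsWithin_of_mem_nhds
    (Filter.inter_mem (Metric.ball_mem_nhds x₀ hr) hgeq)), measure_mono_null (fun x hx => ?_) hr0⟩
  obtain ⟨⟨hxU, -, hxv⟩, hxr, hxg⟩ := hx
  refine ⟨hxr, ?_⟩
  have hxg' : g x = g₀ x := hxg
  rwa [hxg', hg₀ x hxU]

theorem Nondivergent.isStronglyExtremal_univ {n s : ℕ} {h : (Fin s → ℝ) →ᵃ[ℝ] (Fin n → ℝ)}
    (hh : Nondivergent h) : IsStronglyExtremal Set.univ fun x => h x := by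
  refine measure_null_of_locally_null _ fun x₀ _ => ?_
  obtain ⟨r, hr, hr0⟩ := exists_volume_isVWMA_eq_zero hh contDiff_id x₀ (l := 1) fun b hb => by
    let ℓ : (Fin s → ℝ) →L[ℝ] ℝ := ∑ i, b i • ContinuousLinearMap.proj i
    have hℓ : (fun x : Fin s → ℝ => ∑ i, b i * id x i) = ℓ := funext fun y => by simp [ℓ]
    obtain ⟨i, hi⟩ := Function.ne_iff.1 hb
    refine ⟨1, le_rfl, le_rfl, fun h0 => hi ?_⟩
    rw [hℓ] at h0
    have := congrArg (fun F => F fun _ => Pi.single i 1) h0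
    simpa [iteratedFDeriv_one_apply, ℓ, Pi.single_apply] using this
  refine ⟨_, Filter.inter_mem self_mem_nhdsWithin (mem_nhdsWithin_of_mem_nhds
    (Metric.ball_mem_nhds x₀ hr)), measure_mono_null (fun x hx => ?_) hr0⟩
  exact ⟨hx.2, hx.1.2⟩

/-- **Theorem 1.4.** (a) If the affine subspace `L ⊆ ℝ^n` is strongly extremal, then any
smooth map `f : U → L`, `U ⊆ ℝ^d` open, which is nondegenerate in `L` is strongly extremal.
(b) If `L` is not strongly extremal, then all points of `L` are VWMA. -/
theorem strongly_extremal_subspace_inherited (n d : ℕ) (L : AffineSubspace ℝ (Fin n → ℝ)) :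
    (AffineStronglyExtremal L →
      ∀ (U : Set (Fin d → ℝ)), IsOpen U →
        ∀ f : (Fin d → ℝ) → Fin n → ℝ, ContDiffOn ℝ (⊤ : ℕ∞) f U →
          (∀ x ∈ U, f x ∈ L) →
          (∀ᵐ x ∂(volume.restrict U), NondegAt U L f x) →
          IsStronglyExtremal U f) ∧
    (¬ AffineStronglyExtremal L → ∀ y ∈ L, IsVWMA y) := by
  refine ⟨fun hse U hU f hf hfL hnd => ?_, fun hse y hy => ?_⟩
  · rcases U.eq_empty_or_nonempty with rfl | ⟨x, hx⟩
    · simp [IsStronglyExtremal]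
    obtain ⟨s, h, hinj, hL⟩ := AffineSubspace.exists_parametrization (hfL x hx)
    refine Nondivergent.isStronglyExtremal ?_ hinj hL hU hf hfL hnd
    by_contra hh
    have hall : {z ∈ (Set.univ : Set (Fin s → ℝ)) | IsVWMA (h z)} = Set.univ :=
      Set.eq_univ_of_forall fun z => ⟨trivial, isVWMA_of_not_nondivergent hh z⟩
    have h0 : volume {z ∈ (Set.univ : Set (Fin s → ℝ)) | IsVWMA (h z)} = 0 := hse s h hinj hL
    rw [hall] at h0
    exact NeZero.ne _ (Measure.measure_univ_eq_zero.1 h0)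
  · simp only [AffineStronglyExtremal, not_forall] at hse
    obtain ⟨s, h, -, hL, hne⟩ := hse
    rw [← SetLike.mem_coe, ← hL] at hy
    obtain ⟨z, rfl⟩ := hy
    exact isVWMA_of_not_nondivergent (fun hh => hne hh.isStronglyExtremal_univ) z
end

section
/- Let E ⊂ ℝ² be a discrete set which is homogeneous with respect to positive integers, i.e. kE ⊆ E for every k ∈ ℕ. Let a, b > 0, v > a/b, and γ = (bv - a)/(v + 1). Then the following are equivalent: (i) for every R > 0 there exists (x,z) ∈ E with |z| > R and |x| ≤ |z|^{-v}; (ii) for every S > 0 there exist t > S and (x,z) ∈ E \ {(0,0)} such that max(e^{at}|x|, e^{-bt}|z|) ≤ e^{-γt}. -/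
theorem finite_inter_of_isCompact_of_locally_finite {X : Type*} [TopologicalSpace X] {E K : Set X}
    (hE : ∀ p : X, ∃ V ∈ nhds p, (E ∩ V).Finite) (hK : IsCompact K) : (E ∩ K).Finite := by
  choose V hV hfin using hE
  obtain ⟨t, -, ht⟩ := hK.elim_nhds_subcover V fun x _ => hV x
  refine (t.finite_toSet.biUnion fun x _ => hfin x).subset ?_
  rintro x ⟨hxE, hxK⟩
  obtain ⟨y, hy, hxy⟩ := Set.mem_iUnion₂.1 (ht hxK)
  exact Set.mem_biUnion hy ⟨hxE, hxy⟩

theorem Set.Finite.exists_pos_le_of_pos {X : Type*} {F : Set X} (hF : F.Finite) {f : X → ℝ}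
    (hf : ∀ x ∈ F, 0 < f x) : ∃ δ : ℝ, 0 < δ ∧ ∀ x ∈ F, δ ≤ f x := by
  rcases F.eq_empty_or_nonempty with rfl | hne
  · exact ⟨1, one_pos, by simp⟩
  · obtain ⟨x, hx, hmin⟩ := F.exists_min_image f hF hne
    exact ⟨f x, hf x hx, hmin⟩

theorem max_exp_mul_le_exp_iff (a b g t x z : ℝ) :
    max (Real.exp (a * t) * x) (Real.exp (-b * t) * z) ≤ Real.exp (-g * t) ↔
      x ≤ Real.exp (-((a + g) * t)) ∧ z ≤ Real.exp ((b - g) * t) := by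
  rw [max_le_iff, ← le_div_iff₀' (Real.exp_pos _), ← le_div_iff₀' (Real.exp_pos _),
    ← Real.exp_sub, ← Real.exp_sub]
  ring_nf

theorem exists_large_of_zero_fst {E : Set (ℝ × ℝ)}
    (hhom : ∀ k : ℕ, 0 < k → ∀ z ∈ E, ((k : ℝ) * z.1, (k : ℝ) * z.2) ∈ E)
    {y : ℝ} (hy : y ≠ 0) (hmem : ((0 : ℝ), y) ∈ E) (v R : ℝ) :
    ∃ z ∈ E, R < |z.2| ∧ |z.1| ≤ |z.2| ^ (-v) := by
  obtain ⟨k, hk⟩ := exists_nat_gt (R / |y|)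
  have hy' : 0 < |y| := abs_pos.2 hy
  refine ⟨_, hhom (k + 1) k.succ_pos _ hmem, ?_, ?_⟩
  · rw [div_lt_iff₀ hy'] at hk
    rw [abs_mul, Nat.abs_cast]
    push_cast
    linarith
  · rw [mul_zero, abs_zero]
    exact Real.rpow_nonneg (abs_nonneg _) _

/-- **Lemma 2.1.** Let `E ⊆ ℝ²` be discrete (every point has a neighborhood meeting `E` in a
finite set) and homogeneous with respect to positive integers (`kE ⊆ E` for `k ∈ ℕ`, `k > 0`).
Take `a, b > 0`, `v > a/b` and `γ = (bv - a)/(v + 1)`. Then there exist `(x,z) ∈ E` with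
arbitrarily large `|z|` such that `|x| ≤ |z|^{-v}` if and only if there exist arbitrarily
large `t > 0` such that `max(e^{at}|x|, e^{-bt}|z|) ≤ e^{-γt}` for some `(x,z) ∈ E ∖ {0}`. -/
theorem discrete_homogeneous_growth_equiv (E : Set (ℝ × ℝ))
    (hdisc : ∀ p : ℝ × ℝ, ∃ V ∈ nhds p, (E ∩ V).Finite)
    (hhom : ∀ k : ℕ, 0 < k → ∀ z ∈ E, ((k : ℝ) * z.1, (k : ℝ) * z.2) ∈ E)
    (a b v : ℝ) (ha : 0 < a) (hb : 0 < b) (hv : a / b < v) :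
    (∀ R : ℝ, 0 < R → ∃ z ∈ E, R < |z.2| ∧ |z.1| ≤ |z.2| ^ (-v)) ↔
    (∀ S : ℝ, 0 < S → ∃ t : ℝ, S < t ∧ ∃ z ∈ E, z ≠ (0, 0) ∧
      max (Real.exp (a * t) * |z.1|) (Real.exp (-b * t) * |z.2|) ≤
        Real.exp (-((b * v - a) / (v + 1)) * t)) := by
  have hv0 : 0 < v := (div_pos ha hb).trans hv
  obtain ⟨c, hc, hag, hbg⟩ : ∃ c : ℝ, 0 < c ∧ a + (b * v - a) / (v + 1) = v * c ∧
      b - (b * v - a) / (v + 1) = c := by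
    refine ⟨(a + b) / (v + 1), by positivity, ?_, ?_⟩ <;> field_simp <;> ring
  simp only [max_exp_mul_le_exp_iff, hag, hbg]
  have hrpow : ∀ t : ℝ, Real.exp (c * t) ^ (-v) = Real.exp (-(v * c * t)) := fun t => by
    rw [← Real.exp_mul]
    ring_nf
  constructor
  · intro h S _
    obtain ⟨z, hzE, hz, hzx⟩ := h (Real.exp (c * S)) (Real.exp_pos _)
    have hz0 : 0 < |z.2| := (Real.exp_pos _).trans hz
    have hexp : Real.exp (c * (Real.log |z.2| / c)) = |z.2| := by
      rw [mul_div_cancel₀ _ hc.ne', Real.exp_log hz0]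
    refine ⟨Real.log |z.2| / c, ?_, z, hzE, ?_, ?_, hexp.ge⟩
    · rwa [lt_div_iff₀' hc, Real.lt_log_iff_exp_lt hz0]
    · rintro rfl
      simp at hz0
    · rwa [← hrpow, hexp]
  · intro h R hR
    by_cases h0 : ∃ y : ℝ, y ≠ 0 ∧ ((0 : ℝ), y) ∈ E
    · obtain ⟨y, hy, hmem⟩ := h0
      exact exists_large_of_zero_fst hhom hy hmem v R
    have hfin := finite_inter_of_isCompact_of_locally_finite hdisc
      ((isCompact_Icc (a := (-1 : ℝ)) (b := 1)).prod (isCompact_Icc (a := -R) (b := R)))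
    obtain ⟨δ, hδ, hmin⟩ := (hfin.subset (Set.sdiff_subset (t := {(0, 0)}))).exists_pos_le_of_pos
      (f := fun p => |p.1|) (by
        rintro ⟨x, y⟩ ⟨⟨hE, -⟩, hne⟩
        refine abs_pos.2 ?_
        rintro (rfl : x = 0)
        exact h0 ⟨y, fun hy => hne (by simp [hy]), hE⟩)
    have hvc : 0 < v * c := mul_pos hv0 hc
    obtain ⟨t, ht, z, hzE, hzne, hx, hz⟩ :=
      h (max 1 (-Real.log δ / (v * c))) (lt_max_of_lt_left one_pos)
    obtain ⟨ht1, htδ⟩ := max_lt_iff.1 ht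
    have hlt : Real.exp (-(v * c * t)) < δ := by
      rw [div_lt_iff₀' hvc] at htδ
      rw [← Real.lt_log_iff_exp_lt hδ]
      linarith
    have hle : Real.exp (-(v * c * t)) ≤ 1 :=
      Real.exp_le_one_iff.2 (neg_nonpos.2 (mul_pos hvc (one_pos.trans ht1)).le)
    have hRz : R < |z.2| := by
      by_contra! hcon
      exact (hx.trans_lt hlt).not_ge
        (hmin z ⟨⟨hzE, abs_le.1 (hx.trans hle), abs_le.1 hcon⟩, hzne⟩)
    refine ⟨z, hzE, hRz, hx.trans ?_⟩
    rw [← hrpow]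
    exact Real.rpow_le_rpow_of_nonpos (hR.trans hRz) hz (neg_nonpos.2 hv0.le)
end

section
/- For a row vector y ∈ ℝ^n the following are equivalent: (i) y is VWA; (ii) γ_F(u_y ℤ^{n+1}) > 0, where F = {g_t : t ≥ 0}; (iii) for some γ > 0 there exist infinitely many t ∈ ℕ such that δ(g_t u_y ℤ^{n+1}) ≤ e^{-γ t}. -/
open MeasureTheory

/-- `δ(Λ)`: the infimum of the (sup) norms of nonzero elements of `Λ`. -/
noncomputable def latDelta {k : ℕ} (Λ : Set (Fin k → ℝ)) : ℝ :=
  sInf ((fun v => ‖v‖) '' (Λ \ {0}))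

/-- The matrix `g_t = diag(e^t, e^{-t/n}, …, e^{-t/n})`. -/
noncomputable def gMat (n : ℕ) (t : ℝ) : Matrix (Fin (n + 1)) (Fin (n + 1)) ℝ :=
  Matrix.diagonal (Fin.cons (Real.exp t) fun _ => Real.exp (-t / (n : ℝ)))

/-- The lattice `u_y ℤ^{n+1} = {(y·q + p, q) : p ∈ ℤ, q ∈ ℤ^n}`. -/
def uLat {n : ℕ} (y : Fin n → ℝ) : Set (Fin (n + 1) → ℝ) :=
  {v | ∃ p : ℤ, ∃ q : Fin n → ℤ,
    v = Fin.cons ((∑ i, y i * (q i : ℝ)) + (p : ℝ)) fun i => (q i : ℝ)}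

/-- The growth exponent `γ_F(Λ)` of `Λ` with respect to `F = {g_t : t ≥ 0}`: the supremum of
all `γ ≥ 0` for which there exist arbitrarily large positive `t` with `δ(g_t Λ) ≤ e^{-γt}`. -/
noncomputable def growthExp (n : ℕ) (Λ : Set (Fin (n + 1) → ℝ)) : ℝ :=
  sSup {γ : ℝ | 0 ≤ γ ∧ ∀ T : ℝ, 0 < T → ∃ t : ℝ, T < t ∧
    latDelta ((gMat n t).mulVec '' Λ) ≤ Real.exp (-γ * t)}

section Approximation

variable {n : ℕ}

lemma one_le_norm_intCast {q : Fin n → ℤ} (hq : q ≠ 0) :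
    1 ≤ ‖(fun i => (q i : ℝ) : Fin n → ℝ)‖ := by
  obtain ⟨i, hi⟩ := Function.ne_iff.mp hq
  refine le_trans ?_ (norm_le_pi_norm _ i)
  rw [Real.norm_eq_abs]
  exact_mod_cast Int.one_le_abs hi

lemma finite_norm_intCast_le (R : ℝ) :
    {q : Fin n → ℤ | ‖(fun i => (q i : ℝ) : Fin n → ℝ)‖ ≤ R}.Finite := by
  refine (Set.finite_Icc (fun _ => -⌈R⌉ : Fin n → ℤ) (fun _ => ⌈R⌉)).subset fun q hq => ?_
  have h : ∀ i, |q i| ≤ ⌈R⌉ := fun i => by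
    have h1 : |(q i : ℝ)| ≤ R := (norm_le_pi_norm (fun i => (q i : ℝ)) i).trans hq
    exact_mod_cast h1.trans (Int.le_ceil R)
  exact ⟨fun i => (abs_le.mp (h i)).1, fun i => (abs_le.mp (h i)).2⟩

lemma gMat_mulVec_cons (t a : ℝ) (b : Fin n → ℝ) :
    (gMat n t).mulVec (Fin.cons a b) =
      Fin.cons (Real.exp t * a) (Real.exp (-t / (n : ℝ)) • b) := by
  ext i
  rw [gMat, Matrix.mulVec_diagonal]
  cases i using Fin.cases <;> simp

lemma norm_cons_eq_max (a : ℝ) (b : Fin n → ℝ) :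
    ‖(Fin.cons a b : Fin (n + 1) → ℝ)‖ = max |a| ‖b‖ := by
  apply le_antisymm
  · refine (pi_norm_le_iff_of_nonneg (le_max_of_le_left (abs_nonneg a))).mpr fun i => ?_
    cases i using Fin.cases with
    | zero => simp
    | succ i => exact (norm_le_pi_norm b i).trans (le_max_right _ _)
  · refine max_le (norm_le_pi_norm (Fin.cons a b : Fin (n + 1) → ℝ) 0) ?_
    exact (pi_norm_le_iff_of_nonneg (norm_nonneg _)).mpr fun i =>
      norm_le_pi_norm (Fin.cons a b : Fin (n + 1) → ℝ) i.succ

lemma norm_gMat_mulVec_cons (t a : ℝ) (b : Fin n → ℝ) :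
    ‖(gMat n t).mulVec (Fin.cons a b)‖ =
      max (Real.exp t * |a|) (Real.exp (-t / (n : ℝ)) * ‖b‖) := by
  rw [gMat_mulVec_cons, norm_cons_eq_max, abs_mul, Real.abs_exp, norm_smul, Real.norm_eq_abs,
    Real.abs_exp]

lemma latDelta_le_norm {k : ℕ} {Λ : Set (Fin k → ℝ)} {w : Fin k → ℝ} (hw : w ∈ Λ)
    (hw0 : w ≠ 0) : latDelta Λ ≤ ‖w‖ :=
  csInf_le ⟨0, by rintro _ ⟨v, -, rfl⟩; exact norm_nonneg v⟩ ⟨w, ⟨hw, hw0⟩, rfl⟩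

lemma latDelta_gMat_uLat_le (y : Fin n → ℝ) {t r : ℝ} {q : Fin n → ℤ} (hq : q ≠ 0) (p : ℤ)
    (hp : Real.exp t * |(∑ i, y i * (q i : ℝ)) + (p : ℝ)| ≤ r)
    (hr : Real.exp (-t / (n : ℝ)) * ‖(fun i => (q i : ℝ) : Fin n → ℝ)‖ ≤ r) :
    latDelta ((gMat n t).mulVec '' uLat y) ≤ r := by
  have hmem : Fin.cons ((∑ i, y i * (q i : ℝ)) + (p : ℝ)) (fun i => (q i : ℝ)) ∈ uLat y :=
    ⟨p, q, rfl⟩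
  refine (latDelta_le_norm (Set.mem_image_of_mem _ hmem) ?_).trans
    ((norm_gMat_mulVec_cons _ _ _).trans_le (max_le hp hr))
  rw [← norm_pos_iff, norm_gMat_mulVec_cons]
  exact lt_max_of_lt_right
    (mul_pos (Real.exp_pos _) (one_pos.trans_le (one_le_norm_intCast hq)))

lemma exists_of_latDelta_gMat_uLat_lt (y : Fin n → ℝ) {t r : ℝ} (ht : 0 ≤ t) (hr : r ≤ 1)
    (h : latDelta ((gMat n t).mulVec '' uLat y) < r) :
    ∃ (p : ℤ) (q : Fin n → ℤ), q ≠ 0 ∧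
      Real.exp t * |(∑ i, y i * (q i : ℝ)) + (p : ℝ)| < r ∧
      Real.exp (-t / (n : ℝ)) * ‖(fun i => (q i : ℝ) : Fin n → ℝ)‖ < r := by
  have hne : ((fun v => ‖v‖) '' ((gMat n t).mulVec '' uLat y \ {0})).Nonempty := by
    refine ⟨_, _, ⟨⟨_, ⟨1, 0, rfl⟩, rfl⟩, ?_⟩, rfl⟩
    rw [Set.mem_singleton_iff, ← ne_eq, ← norm_pos_iff, norm_gMat_mulVec_cons]
    exact lt_max_of_lt_left (by simp [Real.exp_pos])
  obtain ⟨_, ⟨_, ⟨⟨_, ⟨p, q, rfl⟩, rfl⟩, h0⟩, rfl⟩, hlt⟩ := exists_lt_of_csInf_lt hne h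
  simp only [norm_gMat_mulVec_cons] at hlt
  obtain ⟨h1, h2⟩ := max_lt_iff.mp hlt
  refine ⟨p, q, ?_, h1, h2⟩
  rintro rfl
  have hp : p ≠ 0 := by
    rintro rfl
    refine h0 ?_
    rw [Set.mem_singleton_iff, ← norm_eq_zero, norm_gMat_mulVec_cons]
    simp [← Pi.zero_def]
  have hp1 : (1 : ℝ) ≤ |(p : ℝ)| := by exact_mod_cast Int.one_le_abs hp
  have := one_le_mul_of_one_le_of_one_le (Real.one_le_exp ht) hp1
  simp at h1
  linarith

lemma le_one_div_of_latDelta_le (y : Fin n → ℝ) {γ t : ℝ} (ht : 0 < t)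
    (h : latDelta ((gMat n t).mulVec '' uLat y) ≤ Real.exp (-γ * t)) : γ ≤ 1 / n := by
  by_contra! hγ
  have hlt : Real.exp (-γ * t) < Real.exp (-t / n) := by
    rw [Real.exp_lt_exp, neg_mul, neg_div, neg_lt_neg_iff, div_eq_inv_mul, ← one_div]
    exact mul_lt_mul_of_pos_right hγ ht
  obtain ⟨p, q, hq, -, h2⟩ := exists_of_latDelta_gMat_uLat_lt y ht.le
    (Real.exp_le_one_iff.mpr (by rw [neg_div]; exact neg_nonpos.mpr (by positivity)))
    (h.trans_lt hlt)
  have h1 := one_le_norm_intCast hq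
  nlinarith [Real.exp_pos (-t / n)]

lemma growthExp_uLat_pos_iff (y : Fin n → ℝ) :
    0 < growthExp n (uLat y) ↔ ∃ γ : ℝ, 0 < γ ∧ ∀ T : ℝ, 0 < T → ∃ t : ℝ, T < t ∧
      latDelta ((gMat n t).mulVec '' uLat y) ≤ Real.exp (-γ * t) := by
  constructor
  · intro h
    have hne : {γ : ℝ | 0 ≤ γ ∧ ∀ T : ℝ, 0 < T → ∃ t : ℝ, T < t ∧
        latDelta ((gMat n t).mulVec '' uLat y) ≤ Real.exp (-γ * t)}.Nonempty := by
      by_contra he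
      rw [growthExp, Set.not_nonempty_iff_eq_empty.mp he, Real.sSup_empty] at h
      exact h.false
    obtain ⟨γ, hγ, hpos⟩ := exists_lt_of_lt_csSup hne h
    exact ⟨γ, hpos, hγ.2⟩
  · rintro ⟨γ, hγ, h⟩
    refine hγ.trans_le (le_csSup ⟨1 / n, ?_⟩ ⟨hγ.le, h⟩)
    rintro γ' ⟨-, h'⟩
    obtain ⟨t, ht, hδ⟩ := h' 1 one_pos
    exact le_one_div_of_latDelta_le y (one_pos.trans ht) hδ

lemma inW_of_sum_add_eq_zero (y : Fin n → ℝ) (v : ℝ) {q : Fin n → ℤ} (hq : q ≠ 0) {p : ℤ}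
    (h : (∑ i, y i * (q i : ℝ)) + (p : ℝ) = 0) : InW y v := by
  refine Set.infinite_of_injective_forall_mem (f := fun k : ℤ => k • q)
    (smul_left_injective ℤ hq) fun k => ⟨k * p, ?_⟩
  have : (∑ i, y i * (((k • q) i : ℤ) : ℝ)) + ((k * p : ℤ) : ℝ) = 0 := by
    calc _ = k * ((∑ i, y i * (q i : ℝ)) + (p : ℝ)) := by
          rw [mul_add, Finset.mul_sum]
          push_cast [Pi.smul_apply, smul_eq_mul]
          simp only [mul_left_comm]
      _ = 0 := by rw [h, mul_zero]
  rw [this, abs_zero]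
  positivity

lemma inW_of_frequently (y : Fin n → ℝ) {v : ℝ}
    (h : ∀ ε : ℝ, 0 < ε → ∃ (p : ℤ) (q : Fin n → ℤ), q ≠ 0 ∧
      |(∑ i, y i * (q i : ℝ)) + (p : ℝ)| < ε ∧
      |(∑ i, y i * (q i : ℝ)) + (p : ℝ)| ≤ ‖(fun i => (q i : ℝ) : Fin n → ℝ)‖ ^ (-v)) :
    InW y v := by
  by_contra hfin
  have hS := Set.not_infinite.mp hfin
  have hε : ∀ᶠ ε : ℝ in nhdsWithin 0 (Set.Ioi 0), ∀ q ∈ {q : Fin n → ℤ | ∃ p : ℤ,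
      |(∑ i, y i * (q i : ℝ)) + (p : ℝ)| ≤ ‖(fun i => (q i : ℝ) : Fin n → ℝ)‖ ^ (-v)},
      q ≠ 0 → ε < |(∑ i, y i * (q i : ℝ)) - round (∑ i, y i * (q i : ℝ))| := by
    refine (Filter.eventually_all_finite hS).mpr fun q _ => ?_
    by_cases hq : q = 0
    · simp [hq]
    · have hpos : 0 < |(∑ i, y i * (q i : ℝ)) - round (∑ i, y i * (q i : ℝ))| := by
        refine abs_pos.mpr fun h0 => hfin (inW_of_sum_add_eq_zero y v hq
          (p := -round (∑ i, y i * (q i : ℝ))) ?_)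
        push_cast
        rwa [← sub_eq_add_neg]
      filter_upwards [Ioo_mem_nhdsGT hpos] with ε hε _ using hε.2
  obtain ⟨ε, hε, hpos⟩ := (hε.and self_mem_nhdsWithin).exists
  obtain ⟨p, q, hq, hlt, hle⟩ := h ε hpos
  have h1 := hε q ⟨p, hle⟩ hq
  have h2 := round_le (∑ i, y i * (q i : ℝ)) (-p)
  push_cast at h2
  rw [sub_neg_eq_add] at h2
  linarith

lemma isVWA_of_frequently_latDelta_le (hn : 1 ≤ n) (y : Fin n → ℝ) {γ : ℝ} (hγ : 0 < γ)
    (h : ∀ T : ℝ, 0 < T → ∃ t : ℝ, T < t ∧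
      latDelta ((gMat n t).mulVec '' uLat y) ≤ Real.exp (-γ * t)) : IsVWA y := by
  have hn0 : (0 : ℝ) < n := by exact_mod_cast hn
  have hc : 0 < 1 / (n : ℝ) - γ / 2 := by
    obtain ⟨t, ht, hδ⟩ := h 1 one_pos
    have := le_one_div_of_latDelta_le y (one_pos.trans ht) hδ
    linarith
  have hnc : n * (1 / (n : ℝ) - γ / 2) = 1 - n * (γ / 2) := by field_simp
  set c := 1 / (n : ℝ) - γ / 2 with hc_def
  refine ⟨(1 + γ / 2) / c, ?_, inW_of_frequently y fun ε hε => ?_⟩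
  · rw [lt_div_iff₀ hc, hnc]
    nlinarith
  obtain ⟨t, ht, hδ⟩ := h (max 1 (-Real.log ε)) (lt_max_of_lt_left one_pos)
  obtain ⟨ht1, htε⟩ := max_lt_iff.mp ht
  have ht0 : 0 < t := one_pos.trans ht1
  have hlt : Real.exp (-γ * t) < Real.exp (-(γ / 2) * t) := by
    rw [Real.exp_lt_exp]; nlinarith
  obtain ⟨p, q, hq, hpq, hqr⟩ := exists_of_latDelta_gMat_uLat_lt y ht0.le
    (Real.exp_le_one_iff.mpr (by nlinarith)) (hδ.trans_lt hlt)
  have hpq' : |(∑ i, y i * (q i : ℝ)) + (p : ℝ)| < Real.exp (-(1 + γ / 2) * t) := by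
    rw [← lt_div_iff₀' (Real.exp_pos t), ← Real.exp_sub] at hpq
    rwa [show -(1 + γ / 2) * t = -(γ / 2) * t - t by ring]
  have hqr' : ‖(fun i => (q i : ℝ) : Fin n → ℝ)‖ < Real.exp (c * t) := by
    rw [← lt_div_iff₀' (Real.exp_pos _), ← Real.exp_sub] at hqr
    rwa [show c * t = -(γ / 2) * t - -t / n by rw [hc_def]; ring]
  refine ⟨p, q, hq, hpq'.trans ?_, hpq'.le.trans ?_⟩
  · rw [← Real.lt_log_iff_exp_lt hε]
    nlinarith
  · have h1 := one_le_norm_intCast hq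
    refine le_trans (le_of_eq ?_)
      (Real.rpow_le_rpow_of_nonpos (one_pos.trans_le h1) hqr'.le ?_)
    · rw [← Real.exp_mul]
      congr 1
      field_simp
    · exact neg_nonpos.mpr (by positivity)

lemma exists_infinite_latDelta_le_of_isVWA (hn : 1 ≤ n) (y : Fin n → ℝ) (h : IsVWA y) :
    ∃ γ : ℝ, 0 < γ ∧ {t : ℕ | latDelta ((gMat n (t : ℝ)).mulVec '' (uLat y)) ≤
      Real.exp (-γ * (t : ℝ))}.Infinite := by
  obtain ⟨v, hv, hW⟩ := h
  have hn0 : (0 : ℝ) < n := by exact_mod_cast hn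
  obtain ⟨w, hnw, hwv⟩ := exists_between hv
  have hw0 : 0 < 1 + w := by linarith
  set c : ℝ := (1 + n) / (n * (1 + w)) with hc_def
  have hc : 0 < c := by positivity
  have hγc : 1 / (n : ℝ) - (w - n) / (n * (1 + w)) = c := by
    rw [hc_def]; field_simp; ring
  have hγw : 1 + (w - n) / (n * (1 + w)) = w * c := by
    rw [hc_def]; field_simp; ring
  have hγ : 0 < (w - n) / (n * (1 + w)) := div_pos (by linarith) (by positivity)
  set γ : ℝ := (w - n) / (n * (1 + w))
  refine ⟨γ, hγ, Set.infinite_of_forall_exists_gt fun N => ?_⟩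
  obtain ⟨q, ⟨p, hp⟩, hq⟩ := hW.exists_notMem_finite
    (finite_norm_intCast_le (Real.exp (max (c * (N + 1)) (w * c / (v - w)))))
  rw [Set.mem_ofPred_eq, not_le] at hq
  set Q := ‖(fun i => (q i : ℝ) : Fin n → ℝ)‖
  have hQ : 0 < Q := (Real.exp_pos _).trans hq
  have hq0 : q ≠ 0 := by
    rintro rfl
    simp [Q, ← Pi.zero_def] at hQ
  obtain ⟨hL1, hL2⟩ := max_lt_iff.mp ((Real.lt_log_iff_exp_lt hQ).mpr hq)
  set L := Real.log Q
  have hQL : Q = Real.exp L := (Real.exp_log hQ).symm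
  have hL0 : 0 < L := lt_trans (by positivity) hL1
  have hceil := Nat.le_ceil (L / c)
  have hceil' := Nat.ceil_lt_add_one (div_pos hL0 hc).le
  set t := ⌈L / c⌉₊
  have hLt : L ≤ c * t := by rwa [div_le_iff₀' hc] at hceil
  have htL : c * t ≤ L + c := by
    have := mul_le_mul_of_nonneg_left hceil'.le hc.le
    rwa [mul_add, mul_div_cancel₀ _ hc.ne', mul_one] at this
  refine ⟨t, latDelta_gMat_uLat_le y hq0 p ?_ ?_, ?_⟩
  · refine (mul_le_mul_of_nonneg_left hp (Real.exp_pos _).le).trans ?_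
    rw [hQL, ← Real.exp_mul, ← Real.exp_add, Real.exp_le_exp]
    rw [div_lt_iff₀ (by linarith)] at hL2
    have h1 : (1 + γ) * t = w * (c * t) := by rw [hγw]; ring
    nlinarith
  · change _ * Q ≤ _
    rw [hQL, ← Real.exp_add, Real.exp_le_exp]
    have h1 : -(t : ℝ) / n = -(c + γ) * t := by rw [← hγc]; ring
    rw [h1]
    linarith
  · have : (N : ℝ) + 1 < t := lt_of_mul_lt_mul_left (hL1.trans_le hLt) hc.le
    have h2 : (N : ℝ) < t := by linarith
    exact_mod_cast h2

end Approximation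

/-- **Corollary 2.3.** For a row vector `y ∈ ℝ^n` the following are equivalent:
(i) `y` is VWA; (ii) `γ_F(u_y ℤ^{n+1}) > 0`; (iii) for some `γ > 0` there exist
infinitely many `t ∈ ℕ` with `δ(g_t u_y ℤ^{n+1}) ≤ e^{-γt}`. -/
theorem vwa_iff_growthExp_pos (n : ℕ) (hn : 1 ≤ n) (y : Fin n → ℝ) :
    (IsVWA y ↔ 0 < growthExp n (uLat y)) ∧
    (0 < growthExp n (uLat y) ↔ ∃ γ : ℝ, 0 < γ ∧
      {t : ℕ | latDelta ((gMat n (t : ℝ)).mulVec '' (uLat y)) ≤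
        Real.exp (-γ * (t : ℝ))}.Infinite) := by
  have himp : (∃ γ : ℝ, 0 < γ ∧
      {t : ℕ | latDelta ((gMat n (t : ℝ)).mulVec '' (uLat y)) ≤
        Real.exp (-γ * (t : ℝ))}.Infinite) → 0 < growthExp n (uLat y) := by
    rintro ⟨γ, hγ, hinf⟩
    refine (growthExp_uLat_pos_iff y).mpr ⟨γ, hγ, fun T _ => ?_⟩
    obtain ⟨t, ht, hlt⟩ := hinf.exists_gt ⌈T⌉₊
    exact ⟨t, (Nat.le_ceil T).trans_lt (by exact_mod_cast hlt), ht⟩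
  have hvwa : 0 < growthExp n (uLat y) → IsVWA y := fun h => by
    obtain ⟨γ, hγ, hfreq⟩ := (growthExp_uLat_pos_iff y).mp h
    exact isVWA_of_frequently_latDelta_le hn y hγ hfreq
  have hinf := exists_infinite_latDelta_le_of_isVWA hn y
  exact ⟨⟨fun h => himp (hinf h), hvwa⟩, ⟨fun h => hinf (hvwa h), himp⟩⟩
end
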